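/- Let d ≥ 5, and adopt the shell setup: Q_{4N} ⊆ D ⊆ Z^d, 16 ≤ n < n+m ≤ N with m ≤ n/8, L the loop erasure of simple random walk from 0 stopped at its first exit from D, α the initial segment of L up to its first hit of ∂_i Q_n with endpoint x₀, β the segment of L from x₀ up to its first hit of ∂_i Q(x₀,m), and A = Q(x₀ + (m/2)e₁, m/4) (rotated appropriately if x₀ is not on the face H_n). Then there exist constants c > 0 and C₁, depending only on d, such that P( c m² ≤ Cap( A ∩ β ) ≤ C₁ m² | α ) ≥ c, where Cap(B) = Σ_{u ∈ B} P^u( T⁺_B = ∞ ) is the capacity of the finite set B. -/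

import Mathlib

open MeasureTheory
open scoped ENNReal Classical

namespace USFPaper

/-- Vertices of the nearest-neighbour integer lattice `ℤ^d`. -/
abbrev V (d : ℕ) := Fin d → ℤ

variable {d : ℕ}

/-- Nearest-neighbour adjacency in `ℤ^d`. -/
def adj (x y : V d) : Prop := (∑ i, |x i - y i|) = 1

/-- The cube `Q(x,r) = { y : ‖x - y‖_∞ ≤ r }`. -/
def cube (x : V d) (r : ℕ) : Set (V d) := { y | ∀ i, |y i - x i| ≤ (r : ℤ) }

/-- Inner boundary `∂ᵢA` of a set `A`. -/
def innerBdry (A : Set (V d)) : Set (V d) := { x | x ∈ A ∧ ∃ y, adj x y ∧ y ∉ A }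

/-- Euclidean distance on `ℤ^d`. -/
noncomputable def eudist (x y : V d) : ℝ := Real.sqrt (∑ i, ((x i : ℝ) - (y i : ℝ)) ^ 2)

/-- The `k`-th coordinate unit vector. -/
def unitVec (k : ℕ) : V d := fun i => if (i : ℕ) = k then 1 else 0

/-- `μ` is the law of simple random walk on `ℤ^d` started at `x`, as a probability
measure on path space: every nearest-neighbour cylinder of length `n` starting at `x`
has probability `(2d)⁻ⁿ`. -/
def IsSRWLaw (μ : Measure (ℕ → V d)) (x : V d) : Prop :=
  IsProbabilityMeasure μ ∧
  ∀ (n : ℕ) (γ : ℕ → V d), γ 0 = x → (∀ i < n, adj (γ i) (γ (i + 1))) →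
    μ { ω | ∀ i ≤ n, ω i = γ i } = (2 * (d : ℝ≥0∞))⁻¹ ^ n

/-- First exit time `τ_A` from `A`, valued in `ℕ∞` (`⊤` if the path never leaves `A`). -/
noncomputable def exitTimeE (A : Set (V d)) (ω : ℕ → V d) : ENat :=
  if h : ∃ j, ω j ∉ A then (Nat.find h : ENat) else ⊤

/-- First hitting time `T_A` of `A`, valued in `ℕ∞`. -/
noncomputable def hitTimeE (A : Set (V d)) (ω : ℕ → V d) : ENat :=
  if h : ∃ j, ω j ∈ A then (Nat.find h : ENat) else ⊤

/-- First positive hitting time `T⁺_A` of `A`, valued in `ℕ∞`. -/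
noncomputable def hitTimePosE (A : Set (V d)) (ω : ℕ → V d) : ENat :=
  if h : ∃ j, 1 ≤ j ∧ ω j ∈ A then (Nat.find h : ENat) else ⊤

/-- First exit time from `A` as a natural number (junk value `0` if the path never exits). -/
noncomputable def exitTime (A : Set (V d)) (ω : ℕ → V d) : ℕ := (exitTimeE A ω).toNat

/-- Index of the first hit of `A` (junk value `0` if `A` is never hit). -/
noncomputable def hitIdx (A : Set (V d)) (γ : ℕ → V d) : ℕ := (hitTimeE A γ).toNat

/-- First index `≥ t` at which the path lies in `A` (junk value `t`). -/
noncomputable def hitIdxFrom (A : Set (V d)) (t : ℕ) (γ : ℕ → V d) : ℕ :=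
  if h : ∃ j, t ≤ j ∧ γ j ∈ A then Nat.find h else t

/-- The path frozen at its first exit from `D`. -/
noncomputable def stopAt (D : Set (V d)) (ω : ℕ → V d) : ℕ → V d :=
  fun j => if (j : ENat) ≤ exitTimeE D ω then ω j else ω (exitTime D ω)

/-- Time of the last visit of the path to the point `ω t`, at or after time `t`
(junk value if there are infinitely many such visits). -/
noncomputable def lastVisit (ω : ℕ → V d) (t : ℕ) : ℕ := sSup { j | t ≤ j ∧ ω j = ω t }

/-- The times of the chronological loop erasure (last-exit decomposition). -/
noncomputable def leTime (ω : ℕ → V d) : ℕ → ℕ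
  | 0 => lastVisit ω 0
  | k + 1 => lastVisit ω (leTime ω k + 1)

/-- Chronological loop erasure of an (infinite, transient) path. -/
noncomputable def infLoopErase (ω : ℕ → V d) : ℕ → V d := fun k => ω (leTime ω k)

/-- The loop erasure `L` of the walk stopped at its first exit from `D`. -/
noncomputable def lerw (D : Set (V d)) (ω : ℕ → V d) : ℕ → V d := infLoopErase (stopAt D ω)

/-- The event `T_A > τ_D`: the walk does not visit `A` at any time up to (and
including) its first exit from `D`; if it never exits `D`, it never visits `A`. -/
def avoidBeforeExit (D A : Set (V d)) (ω : ℕ → V d) : Prop :=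
  ∀ j : ℕ, (j : ENat) ≤ exitTimeE D ω → ω j ∉ A

/-- The event `T⁺_A > τ_D` (visits of `A` at positive times only). -/
def avoidBeforeExitPos (D A : Set (V d)) (ω : ℕ → V d) : Prop :=
  ∀ j : ℕ, 1 ≤ j → (j : ENat) ≤ exitTimeE D ω → ω j ∉ A

/-- The right-hand face (in the first coordinate direction) of the cube `Q(x₀,m)`. -/
def rightFace (x₀ : V d) (m : ℕ) : Set (V d) :=
  { y | y ∈ cube x₀ m ∧ ∀ i : Fin d, (i : ℕ) = 0 → y i = x₀ i + (m : ℤ) }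


/-- The unit vector pointing towards the face of the cube `Q(0,n)` on which `x₀`
lies (the first coordinate realising `|x₀ i| = n`; junk value `0` if there is none). -/
noncomputable def faceDir (x₀ : V d) (n : ℕ) : V d :=
  if h : ∃ i : Fin d, |x₀ i| = (n : ℤ) then
    fun j => if j = Classical.choose h then (if 0 ≤ x₀ (Classical.choose h) then 1 else -1) else 0
  else 0

/-- The point `x₁ = x₀ + (m/2) e₁` (with `e₁` replaced by the unit vector pointing
towards the face of `Q(0,n)` containing `x₀`). -/
noncomputable def x1pt (x₀ : V d) (n m : ℕ) : V d := x₀ + ((m / 2 : ℕ) : ℤ) • faceDir x₀ n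

/-- The box `A = Q(x₁, m/4)`. -/
noncomputable def boxA (x₀ : V d) (n m : ℕ) : Set (V d) := cube (x1pt x₀ n m) (m / 4)

/-- A second unit direction, orthogonal to `faceDir x₀ n`, reflected according to the
sign of the corresponding coordinate of `x₀` (junk value `0` in degenerate cases). -/
noncomputable def sideDir (x₀ : V d) (n : ℕ) : V d :=
  if h : ∃ i : Fin d, |x₀ i| = (n : ℤ) then
    (if h2 : ∃ j : Fin d, j ≠ Classical.choose h then
      fun t => if t = Classical.choose h2 then (if x₀ (Classical.choose h2) ≤ 0 then 1 else -1) else 0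
    else 0)
  else 0

/-- The point `x₂ = x₁ + m e₂` (suitably rotated/reflected). -/
noncomputable def x2pt (x₀ : V d) (n m : ℕ) : V d := x1pt x₀ n m + (m : ℤ) • sideDir x₀ n

/-- `α`: the initial segment of the loop erasure `L = lerw D ω` up to its first hit
of `∂ᵢ Q(0,n)`, as a list. -/
noncomputable def alphaList (D : Set (V d)) (n : ℕ) (ω : ℕ → V d) : List (V d) :=
  (List.range (hitIdx (innerBdry (cube 0 n)) (lerw D ω) + 1)).map (lerw D ω)

/-- The endpoint `x₀` of a finite path (junk value `0` for the empty path). -/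
def endPt (a : List (V d)) : V d := (a.getLast?).getD 0

/-- `β`: the segment of the loop erasure `L = lerw D ω` from its first hit `x₀` of
`∂ᵢ Q(0,n)` up to its first subsequent hit of `∂ᵢ Q(x₀,m)`, as a list. -/
noncomputable def betaList (D : Set (V d)) (n m : ℕ) (ω : ℕ → V d) : List (V d) :=
  let γ := lerw D ω
  let k₁ := hitIdx (innerBdry (cube 0 n)) γ
  let k₂ := hitIdxFrom (innerBdry (cube (γ k₁) m)) k₁ γ
  (List.range (k₂ - k₁ + 1)).map fun i => γ (k₁ + i)

/-- `H_A(γ)`: the number of points of the path `γ` lying in the set `A`. -/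
noncomputable def hitCount (A : Set (V d)) (l : List (V d)) : ℕ :=
  (l.map fun v => if v ∈ A then 1 else 0).sum

/-- The capacity `Cap(B) = Σ_{u ∈ B} P^u( T⁺_B = ∞ )` of a set `B ⊆ ℤ^d`, relative to
a family `P` assigning to each `u` the law of simple random walk started at `u`. -/
noncomputable def capacity (P : V d → Measure (ℕ → V d)) (B : Set (V d)) : ℝ :=
  ∑' u : B, ((P u.val) { ω | ∀ j : ℕ, 1 ≤ j → ω j ∉ B }).toReal

/-! ### averaging operator and minimum principle -/

def ee (i : Fin d) : V d := Pi.single i 1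

noncomputable def avg (f : V d → ℝ) (x : V d) : ℝ :=
  (∑ i, (f (x + ee i) + f (x - ee i))) / (2 * d)

lemma avg_mono' {f g : V d → ℝ} {x : V d}
    (h : ∀ i, f (x + ee i) ≤ g (x + ee i) ∧ f (x - ee i) ≤ g (x - ee i)) : avg f x ≤ avg g x := by
  unfold avg
  gcongr with i _
  · exact (h i).1
  · exact (h i).2

lemma avg_mono {f g : V d → ℝ} (h : ∀ y, f y ≤ g y) (x : V d) : avg f x ≤ avg g x :=
  avg_mono' fun _ => ⟨h _, h _⟩

lemma avg_congr' {f g : V d → ℝ} {x : V d}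
    (h : ∀ i, f (x + ee i) = g (x + ee i) ∧ f (x - ee i) = g (x - ee i)) : avg f x = avg g x :=
  le_antisymm (avg_mono' fun i => ⟨(h i).1.le, (h i).2.le⟩)
    (avg_mono' fun i => ⟨(h i).1.ge, (h i).2.ge⟩)

lemma avg_add (f g : V d → ℝ) (x : V d) : avg (fun y => f y + g y) x = avg f x + avg g x := by
  unfold avg
  rw [← add_div, ← Finset.sum_add_distrib]
  congr 1
  exact Finset.sum_congr rfl fun i _ => by ring

lemma avg_smul (c : ℝ) (f : V d → ℝ) (x : V d) : avg (fun y => c * f y) x = c * avg f x := by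
  unfold avg
  rw [← mul_div_assoc, Finset.mul_sum]
  congr 1
  exact Finset.sum_congr rfl fun i _ => by ring

lemma avg_sub (f g : V d → ℝ) (x : V d) : avg (fun y => f y - g y) x = avg f x - avg g x := by
  have := avg_add f (fun y => (-1) * g y) x
  rw [avg_smul] at this
  rw [sub_eq_add_neg, ← neg_one_mul, ← this]
  congr 1; ext y; ring

lemma avg_const (hd : 0 < d) (c : ℝ) (x : V d) : avg (fun _ => c) x = c := by
  unfold avg
  have : (d : ℝ) ≠ 0 := by positivity
  simp
  field_simp
  ring

lemma avg_nonneg {f : V d → ℝ} (h : ∀ y, 0 ≤ f y) (x : V d) : 0 ≤ avg f x := by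
  unfold avg
  exact div_nonneg (Finset.sum_nonneg fun i _ => add_nonneg (h _) (h _)) (by positivity)

lemma avg_sum {ι : Type*} (s : Finset ι) (f : ι → V d → ℝ) (x : V d) :
    avg (fun y => ∑ k ∈ s, f k y) x = ∑ k ∈ s, avg (f k) x := by
  induction s using Finset.induction_on with
  | empty => simp [avg]
  | insert a s ha ih => simp only [Finset.sum_insert ha, avg_add, ih]

lemma avg_le_of_le (hd : 0 < d) {f : V d → ℝ} {x : V d} {c : ℝ}
    (h : ∀ i, f (x + ee i) ≤ c ∧ f (x - ee i) ≤ c) : avg f x ≤ c := by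
  rw [← avg_const hd c x]; exact avg_mono' h

lemma le_avg_of_le (hd : 0 < d) {f : V d → ℝ} {x : V d} {c : ℝ}
    (h : ∀ i, c ≤ f (x + ee i) ∧ c ≤ f (x - ee i)) : c ≤ avg f x := by
  rw [← avg_const hd c x]; exact avg_mono' h

lemma single_le_avg {f : V d → ℝ} (h : ∀ y, 0 ≤ f y) (x : V d) (i : Fin d) :
    f (x + ee i) / (2 * d) ≤ avg f x ∧ f (x - ee i) / (2 * d) ≤ avg f x := by
  have key : f (x + ee i) + f (x - ee i) ≤ ∑ i, (f (x + ee i) + f (x - ee i)) :=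
    Finset.single_le_sum (f := fun i => f (x + ee i) + f (x - ee i))
      (fun i _ => add_nonneg (h _) (h _)) (Finset.mem_univ i)
  unfold avg
  constructor <;> gcongr <;> linarith [h (x + ee i), h (x - ee i)]

/-- Minimum principle. -/
lemma minP (hd : 0 < d) (u : V d → ℝ) (F : Set (V d)) (hs : ∀ x ∈ F, avg u x ≤ u x)
    (hb : ∀ x, x ∉ F → 0 ≤ u x) (hfin : ∀ η > 0, {x | u x ≤ -η}.Finite) : ∀ x, 0 ≤ u x := by
  intro x₀
  by_contra! hneg
  have hS : {x | u x ≤ u x₀}.Finite := by simpa using hfin (-u x₀) (by linarith)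
  obtain ⟨y, hy, hmin⟩ := Set.exists_min_image _ u hS ⟨x₀, by simp⟩
  have hglob : ∀ z, u y ≤ u z := by
    intro z
    by_cases hz : u z ≤ u x₀
    · exact hmin z hz
    · have : u y ≤ u x₀ := hy
      linarith
  have hS2 : {x | u x = u y}.Finite := hS.subset fun z hz => by
    have : u y ≤ u x₀ := hy
    have hz' : u z = u y := hz
    show u z ≤ u x₀
    linarith
  let i₀ : Fin d := ⟨0, hd⟩
  obtain ⟨z, hz, hmax⟩ := Set.exists_max_image _ (fun w : V d => w i₀) hS2 ⟨y, rfl⟩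
  have hz' : u z = u y := hz
  have hzF : z ∈ F := by
    by_contra h
    have := hb z h
    have : u y ≤ u x₀ := hy
    linarith
  have h1 := hs z hzF
  have h2 : avg (fun w => u w - u y) z ≤ 0 := by
    rw [avg_sub, avg_const hd]; linarith
  have h3 := (single_le_avg (f := fun w => u w - u y) (fun w => sub_nonneg.2 (hglob w)) z i₀).1
  have h4 : (u (z + ee i₀) - u y) / (2 * d) ≤ 0 := h3.trans h2
  have h5 : u (z + ee i₀) - u y ≤ 0 := by
    by_contra! h
    have : 0 < (u (z + ee i₀) - u y) / (2 * d) := by positivity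
    linarith
  have h6 : u (z + ee i₀) = u y := le_antisymm (by linarith) (hglob _)
  have h7 := hmax _ h6
  simp [ee] at h7

lemma minP_fin (hd : 0 < d) (u : V d → ℝ) (F : Set (V d)) (hF : F.Finite)
    (hs : ∀ x ∈ F, avg u x ≤ u x) (hb : ∀ x, x ∉ F → 0 ≤ u x) : ∀ x, 0 ≤ u x :=
  minP hd u F hs hb fun η hη => hF.subset fun x hx => by
    by_contra h
    have := hb x h
    have hx' : u x ≤ -η := hx
    linarith

/-! ### cubes -/

lemma mem_cube {x y : V d} {r : ℕ} : y ∈ cube x r ↔ ∀ i, |y i - x i| ≤ (r : ℤ) := Iff.rfl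

lemma cube_eq (x : V d) (r : ℕ) :
    cube x r = ↑(Fintype.piFinset fun i => Finset.Icc (x i - r) (x i + r)) := by
  ext y
  simp only [mem_cube, Finset.mem_coe, Fintype.mem_piFinset, Finset.mem_Icc, abs_le]
  exact forall_congr' fun i => by constructor <;> intro h <;> constructor <;> linarith [h.1, h.2]

lemma cube_finite (x : V d) (r : ℕ) : (cube x r).Finite := by
  rw [cube_eq]; exact Finset.finite_toSet _

lemma cube_mono {x : V d} {r s : ℕ} (h : r ≤ s) : cube x r ⊆ cube x s :=
  fun y hy i => (hy i).trans (by exact_mod_cast h)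

lemma self_mem_cube (x : V d) (r : ℕ) : x ∈ cube x r := fun i => by simp

lemma mem_cube_comm {x y : V d} {r : ℕ} : y ∈ cube x r ↔ x ∈ cube y r := by
  simp only [mem_cube]
  exact forall_congr' fun i => by rw [abs_sub_comm]

lemma cube_trans {x y z : V d} {r s : ℕ} (h1 : y ∈ cube x r) (h2 : z ∈ cube y s) :
    z ∈ cube x (r + s) := fun i => by
  have := h1 i; have := h2 i
  push_cast
  calc |z i - x i| = |(z i - y i) + (y i - x i)| := by ring_nf
    _ ≤ _ := (abs_add_le _ _).trans (by linarith)

lemma add_ee_mem (x : V d) (i : Fin d) : x + ee i ∈ cube x 1 ∧ x - ee i ∈ cube x 1 := by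
  constructor <;> intro j <;> by_cases h : j = i <;> simp [ee, h]

/-! ### squared norm -/

def nsq (x : V d) : ℝ := ∑ i, (x i : ℝ) ^ 2

lemma nsq_nonneg (x : V d) : 0 ≤ nsq x := Finset.sum_nonneg fun _ _ => by positivity

lemma sq_le_nsq (x : V d) (i : Fin d) : (x i : ℝ) ^ 2 ≤ nsq x :=
  Finset.single_le_sum (f := fun i => (x i : ℝ) ^ 2) (fun _ _ => by positivity) (Finset.mem_univ i)

lemma nsq_add (x : V d) (i : Fin d) : nsq (x + ee i) = nsq x + 2 * x i + 1 := by
  unfold nsq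
  have : ∀ j, (((x + ee i) j : ℤ) : ℝ) ^ 2 = (x j : ℝ) ^ 2 + (if j = i then 2 * (x i : ℝ) + 1 else 0) := by
    intro j
    by_cases h : j = i
    · subst h; simp [ee]; ring
    · simp [ee, h]
  simp only [this, Finset.sum_add_distrib]
  simp; ring

lemma nsq_sub (x : V d) (i : Fin d) : nsq (x - ee i) = nsq x - 2 * x i + 1 := by
  unfold nsq
  have : ∀ j, (((x - ee i) j : ℤ) : ℝ) ^ 2 = (x j : ℝ) ^ 2 + (if j = i then - 2 * (x i : ℝ) + 1 else 0) := by
    intro j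
    by_cases h : j = i
    · subst h; simp [ee]; ring
    · simp [ee, h]
  simp only [this, Finset.sum_add_distrib]
  simp; ring

lemma avg_nsq (hd : 0 < d) (z x : V d) : avg (fun y => nsq (y - z)) x = nsq (x - z) + 1 := by
  unfold avg
  have h : ∀ i, nsq (x + ee i - z) + nsq (x - ee i - z) = 2 * nsq (x - z) + 2 := by
    intro i
    rw [show x + ee i - z = (x - z) + ee i by abel, show x - ee i - z = (x - z) - ee i by abel,
      nsq_add, nsq_sub]; ring
  simp only [h]
  have : (d : ℝ) ≠ 0 := by positivity
  simp
  field_simp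

lemma nsq_le_of_mem {x z : V d} {r : ℕ} (h : x ∈ cube z r) : nsq (x - z) ≤ d * (r : ℝ) ^ 2 := by
  unfold nsq
  calc ∑ i, (((x - z) i : ℤ) : ℝ) ^ 2 ≤ ∑ i : Fin d, (r : ℝ) ^ 2 := by
        refine Finset.sum_le_sum fun i _ => ?_
        have := h i
        have h2 : |(((x - z) i : ℤ) : ℝ)| ≤ (r : ℝ) := by
          rw [← Int.cast_abs]; exact_mod_cast this
        exact sq_le_sq' (by linarith [(abs_le.1 h2).1]) (abs_le.1 h2).2
    _ = _ := by simp

lemma nsq_ge_of_not_mem {x z : V d} {r : ℕ} (h : x ∉ cube z r) : ((r : ℝ) + 1) ^ 2 ≤ nsq (x - z) := by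
  simp only [mem_cube, not_forall, not_le] at h
  obtain ⟨i, hi⟩ := h
  refine le_trans ?_ (sq_le_nsq (x - z) i)
  rw [← sq_abs (((x - z) i : ℤ) : ℝ), ← Int.cast_abs]
  have : ((r : ℝ) + 1) ≤ ((|(x - z) i| : ℤ) : ℝ) := by
    have h2 : (r : ℤ) + 1 ≤ |(x - z) i| := hi
    exact_mod_cast h2
  gcongr

lemma nsq_small_finite (z : V d) (C : ℝ) : {x | nsq (x - z) ≤ C}.Finite := by
  refine (cube_finite z ⌈C⌉₊).subset fun x hx => ?_
  by_contra h
  have h1 := nsq_ge_of_not_mem h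
  have h2 : nsq (x - z) ≤ C := hx
  have h3 := Nat.le_ceil C
  nlinarith

/-! ### the superharmonic function `1/(|x|²+A)` -/

noncomputable def fA (A : ℝ) (z x : V d) : ℝ := 1 / (nsq (x - z) + A)

lemma fA_pos {A : ℝ} (hA : 0 < A) (z x : V d) : 0 < fA A z x := by
  have := nsq_nonneg (x - z)
  unfold fA; positivity

lemma fA_super (hd : 5 ≤ d) {A : ℝ} (hA : 20 ≤ A) (z x : V d) :
    avg (fA A z) x + (A + 1) / (nsq (x - z) + A + 1) ^ 3 ≤ fA A z x := by
  set D := nsq (x - z) with hD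
  have hD0 : 0 ≤ D := nsq_nonneg _
  set B := D + A + 1 with hB
  have hB21 : 21 ≤ B := by linarith
  have hd' : (5 : ℝ) ≤ d := by exact_mod_cast hd
  set y : Fin d → ℝ := fun i => ((x - z) i : ℤ) with hy
  have hyD : ∀ i, y i ^ 2 ≤ D := fun i => sq_le_nsq (x - z) i
  have hterm : ∀ i, fA A z (x + ee i) + fA A z (x - ee i) ≤ 2 / B + 10 * y i ^ 2 / B ^ 3 := by
    intro i
    unfold fA
    rw [show x + ee i - z = (x - z) + ee i by abel, show x - ee i - z = (x - z) - ee i by abel,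
      nsq_add, nsq_sub]
    have e1 : nsq (x - z) + 2 * (((x - z) i : ℤ) : ℝ) + 1 + A = B + 2 * y i := by
      simp only [hB, hD, hy]; ring
    have e2 : nsq (x - z) - 2 * (((x - z) i : ℤ) : ℝ) + 1 + A = B - 2 * y i := by
      simp only [hB, hD, hy]; ring
    rw [e1, e2]
    have h1 : y i ^ 2 ≤ B - 21 := by linarith [hyD i]
    have hs : 20 * y i ^ 2 ≤ B ^ 2 := by nlinarith
    have hp : 0 < B + 2 * y i := by nlinarith
    have hm : 0 < B - 2 * y i := by nlinarith
    have e3 : 1 / (B + 2 * y i) + 1 / (B - 2 * y i) = 2 * B / (B ^ 2 - 4 * y i ^ 2) := by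
      have : B ^ 2 - 4 * y i ^ 2 = (B + 2 * y i) * (B - 2 * y i) := by ring
      rw [this]; field_simp; ring
    rw [e3]
    have e4 : 2 / B + 10 * y i ^ 2 / B ^ 3 = (2 * B ^ 2 + 10 * y i ^ 2) / B ^ 3 := by
      field_simp
    have hBp : 0 < B := by linarith
    rw [e4, div_le_div_iff₀ (by nlinarith) (by positivity)]
    nlinarith [mul_nonneg (sq_nonneg (y i)) (sub_nonneg.2 hs)]
  have hBp : 0 < B := by linarith
  have hsum : ∑ i, y i ^ 2 = D := rfl
  have h1 : avg (fA A z) x ≤ 1 / B + D / B ^ 3 := by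
    unfold avg
    rw [div_le_iff₀ (by positivity)]
    calc _ ≤ ∑ i, (2 / B + 10 * y i ^ 2 / B ^ 3) := Finset.sum_le_sum fun i _ => hterm i
      _ = d * (2 / B) + 10 * D / B ^ 3 := by
        have e5 : ∑ i, 10 * y i ^ 2 / B ^ 3 = 10 * D / B ^ 3 := by
          rw [← Finset.sum_div, ← Finset.mul_sum, hsum]
        rw [Finset.sum_add_distrib, e5]; simp
      _ ≤ _ := by
        have : 0 ≤ D / B ^ 3 := by positivity
        rw [mul_div_assoc]
        have e : (1 / B + D / B ^ 3) * (2 * d) = d * (2 / B) + 2 * d * (D / B ^ 3) := by ring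
        rw [e]
        nlinarith
  have h2 : 1 / B + D / B ^ 3 + (A + 1) / B ^ 3 = 1 / B + 1 / B ^ 2 := by
    have : D = B - (A + 1) := by simp only [hB]; ring
    rw [this]; field_simp; ring
  have h3 : fA A z x = 1 / (B - 1) := by unfold fA; congr 1; simp only [hB, hD]; ring
  rw [h3]
  have h4 : 1 / B + 1 / B ^ 2 ≤ 1 / (B - 1) := by
    have : 1 / B + 1 / B ^ 2 = (B + 1) / B ^ 2 := by field_simp
    rw [this, div_le_div_iff₀ (by positivity) (by linarith)]
    nlinarith
  linarith

/-! ### killed semigroup and Green potentials -/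

noncomputable def it (B : Set (V d)) (φ : V d → ℝ) : ℕ → V d → ℝ
  | 0 => fun x => if x ∈ B then φ x else 0
  | t + 1 => fun x => if x ∈ B then avg (it B φ t) x else 0

noncomputable def Gp (B : Set (V d)) (φ : V d → ℝ) (x : V d) : ℝ := ∑' t, it B φ t x

lemma it_off {B : Set (V d)} {φ : V d → ℝ} {x : V d} (hx : x ∉ B) (t : ℕ) : it B φ t x = 0 := by
  cases t <;> simp [it, hx]

lemma it_nonneg {B : Set (V d)} {φ : V d → ℝ} (hφ : ∀ x, 0 ≤ φ x) (t : ℕ) (x : V d) :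
    0 ≤ it B φ t x := by
  induction t generalizing x with
  | zero => simp only [it]; split_ifs <;> simp [hφ]
  | succ t ih => simp only [it]; split_ifs <;> simp [avg_nonneg ih]

lemma it_mono {B B' : Set (V d)} {φ φ' : V d → ℝ} (hB : B ⊆ B') (hφ' : ∀ x, 0 ≤ φ' x)
    (h : ∀ x ∈ B, φ x ≤ φ' x) (t : ℕ) (x : V d) : it B φ t x ≤ it B' φ' t x := by
  induction t generalizing x with
  | zero =>
    by_cases hx : x ∈ B
    · simp [it, hx, hB hx, h x hx]
    · rw [it_off hx]; exact it_nonneg hφ' _ _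
  | succ t ih =>
    by_cases hx : x ∈ B
    · simp only [it, hx, hB hx, if_true]; exact avg_mono ih x
    · rw [it_off hx]; exact it_nonneg hφ' _ _

lemma it_add (B : Set (V d)) (φ ψ : V d → ℝ) (t : ℕ) (x : V d) :
    it B (fun y => φ y + ψ y) t x = it B φ t x + it B ψ t x := by
  induction t generalizing x with
  | zero => simp only [it]; split_ifs <;> simp
  | succ t ih =>
    simp only [it]
    split_ifs
    · rw [← avg_add]; congr 1; ext y; exact ih y
    · simp

lemma it_smul (B : Set (V d)) (c : ℝ) (φ : V d → ℝ) (t : ℕ) (x : V d) :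
    it B (fun y => c * φ y) t x = c * it B φ t x := by
  induction t generalizing x with
  | zero => simp only [it]; split_ifs <;> simp
  | succ t ih =>
    simp only [it]
    split_ifs
    · rw [← avg_smul]; congr 1; ext y; exact ih y
    · simp

lemma it_sum {ι : Type*} (B : Set (V d)) (s : Finset ι) (φ : ι → V d → ℝ) (t : ℕ) (x : V d) :
    it B (fun y => ∑ k ∈ s, φ k y) t x = ∑ k ∈ s, it B (φ k) t x := by
  induction s using Finset.induction_on with
  | empty =>
    have := it_smul B 0 (fun _ => (0 : ℝ)) t x
    simpa using this
  | insert a s ha ih => simp only [Finset.sum_insert ha, it_add, ih]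

lemma it_le_dom {B : Set (V d)} {φ W : V d → ℝ} (hW : ∀ x, 0 ≤ W x)
    (h : ∀ x ∈ B, φ x + avg W x ≤ W x) (n : ℕ) (x : V d) :
    ∑ t ∈ Finset.range n, it B φ t x ≤ W x := by
  induction n generalizing x with
  | zero => simpa using hW x
  | succ n ih =>
    by_cases hx : x ∈ B
    · rw [Finset.sum_range_succ']
      simp only [it, hx, if_true]
      rw [← avg_sum]
      have := avg_mono ih x
      linarith [h x hx]
    · simp only [it_off hx, Finset.sum_const_zero]; exact hW x

structure Dom (B : Set (V d)) (φ W : V d → ℝ) : Prop where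
  nn : ∀ x, 0 ≤ φ x
  W0 : ∀ x, 0 ≤ W x
  sup : ∀ x ∈ B, φ x + avg W x ≤ W x

lemma Dom.summable {B : Set (V d)} {φ W : V d → ℝ} (h : Dom B φ W) (x : V d) :
    Summable fun t => it B φ t x :=
  summable_of_sum_range_le (fun t => it_nonneg h.nn t x) (fun n => it_le_dom h.W0 h.sup n x)

lemma Dom.le {B : Set (V d)} {φ W : V d → ℝ} (h : Dom B φ W) (x : V d) : Gp B φ x ≤ W x :=
  Real.tsum_le_of_sum_range_le (fun t => it_nonneg h.nn t x) (fun n => it_le_dom h.W0 h.sup n x)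

lemma Gp_nonneg {B : Set (V d)} {φ : V d → ℝ} (h : ∀ x, 0 ≤ φ x) (x : V d) : 0 ≤ Gp B φ x :=
  tsum_nonneg fun t => it_nonneg h t x

lemma Gp_off {B : Set (V d)} {φ : V d → ℝ} {x : V d} (hx : x ∉ B) : Gp B φ x = 0 := by
  simp [Gp, it_off hx]

lemma Dom.eqn {B : Set (V d)} {φ W : V d → ℝ} (h : Dom B φ W) {x : V d} (hx : x ∈ B) :
    Gp B φ x = φ x + avg (Gp B φ) x := by
  unfold Gp
  rw [(h.summable x).tsum_eq_zero_add]
  simp only [it, hx, if_true]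
  congr 1
  unfold avg
  rw [tsum_div_const, Summable.tsum_finsetSum]
  · congr 1
    refine Finset.sum_congr rfl fun i _ => ?_
    exact ((h.summable _).tsum_add (h.summable _))
  · intro i _; exact (h.summable _).add (h.summable _)

lemma Dom.gp_mono {B B' : Set (V d)} {φ φ' W W' : V d → ℝ} (h : Dom B φ W) (h' : Dom B' φ' W')
    (hB : B ⊆ B') (hφ : ∀ x ∈ B, φ x ≤ φ' x) (x : V d) : Gp B φ x ≤ Gp B' φ' x :=
  (h.summable x).tsum_le_tsum (fun t => it_mono hB h'.nn hφ t x) (h'.summable x)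

lemma minP_loc (hd : 0 < d) (u : V d → ℝ) (F : Set (V d)) (hF : F.Finite)
    (hs : ∀ x ∈ F, avg u x ≤ u x)
    (hb : ∀ x ∈ F, ∀ i, (x + ee i ∉ F → 0 ≤ u (x + ee i)) ∧ (x - ee i ∉ F → 0 ≤ u (x - ee i))) :
    ∀ x ∈ F, 0 ≤ u x := by
  have key := minP_fin hd (fun x => if x ∈ F then u x else 0) F hF (fun x hx => by
    simp only [hx, if_true]
    refine le_trans (avg_mono' fun i => ⟨?_, ?_⟩) (hs x hx)
    · split_ifs with h
      · exact le_rfl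
      · exact (hb x hx i).1 h
    · split_ifs with h
      · exact le_rfl
      · exact (hb x hx i).2 h) (fun x hx => by simp [hx])
  intro x hx
  simpa [hx] using key x

lemma avg_shift (f : V d → ℝ) (z x : V d) : avg (fun y => f (y - z)) x = avg f (x - z) := by
  unfold avg
  simp only [show ∀ i, x + ee i - z = x - z + ee i from fun i => by abel,
    show ∀ i, x - ee i - z = x - z - ee i from fun i => by abel]

lemma avg_lin (hd : 0 < d) (i : Fin d) (x : V d) : avg (fun y => ((y i : ℤ) : ℝ)) x = x i := by
  have hd' : (d : ℝ) ≠ 0 := by positivity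
  unfold avg
  have h : ∀ j : Fin d, (((x + ee j) i : ℤ) : ℝ) + (((x - ee j) i : ℤ) : ℝ) = 2 * x i := by
    intro j; simp only [Pi.add_apply, Pi.sub_apply]; push_cast; ring
  simp only [h]; simp; field_simp

lemma avg_sqc (hd : 0 < d) (i : Fin d) (x : V d) :
    avg (fun y => ((y i : ℤ) : ℝ) ^ 2) x = (x i : ℝ) ^ 2 + 1 / d := by
  have hd' : (d : ℝ) ≠ 0 := by positivity
  unfold avg
  have h : ∀ j, (((x + ee j) i : ℤ) : ℝ) ^ 2 + (((x - ee j) i : ℤ) : ℝ) ^ 2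
      = 2 * (x i : ℝ) ^ 2 + (if i = j then 2 else 0) := by
    intro j
    by_cases hj : i = j
    · subst hj; simp [ee]; ring
    · simp [ee, hj]; ring
  simp only [h, Finset.sum_add_distrib]
  simp; field_simp

lemma avg_quad (hd : 0 < d) (i : Fin d) (z x : V d) (α β γ δ : ℝ) :
    avg (fun y => α + β * (y i : ℝ) + γ * (y i : ℝ) ^ 2 + δ * nsq (y - z)) x
      = α + β * (x i : ℝ) + γ * (x i : ℝ) ^ 2 + δ * nsq (x - z) + γ / d + δ := by
  rw [avg_add, avg_add, avg_add, avg_smul, avg_smul, avg_smul, avg_const hd, avg_lin hd, avg_sqc hd,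
    avg_nsq hd]
  ring

lemma avg_nsq2 (hd : 0 < d) (z x : V d) : avg (fun y => nsq (y - z) ^ 2) x
    = nsq (x - z) ^ 2 + 2 * nsq (x - z) + 1 + 4 * nsq (x - z) / d := by
  have hd' : (d : ℝ) ≠ 0 := by positivity
  unfold avg
  have h : ∀ i, nsq (x + ee i - z) ^ 2 + nsq (x - ee i - z) ^ 2
      = 2 * (nsq (x - z) + 1) ^ 2 + 8 * (((x - z) i : ℤ) : ℝ) ^ 2 := by
    intro i
    rw [show x + ee i - z = (x - z) + ee i by abel, show x - ee i - z = (x - z) - ee i by abel,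
      nsq_add, nsq_sub]; ring
  simp only [h, Finset.sum_add_distrib, ← Finset.mul_sum]
  rw [show ∑ i, (((x - z) i : ℤ) : ℝ) ^ 2 = nsq (x - z) from rfl]
  simp; field_simp; ring

/-- growth lemma -/
lemma growL (hd : 5 ≤ d) (u : V d → ℝ) (z : V d) (S : ℝ) (hS : 4 * (d : ℝ) ^ 2 ≤ S) (hu : ∀ x, 0 ≤ u x)
    (hs : ∀ x, nsq (x - z) < S * (1 + 1 / d) → avg u x ≤ u x)
    {θ : ℝ} (hθ : 0 ≤ θ) (h1 : ∀ x, nsq (x - z) ≤ S → θ ≤ u x) :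
    ∀ x, nsq (x - z) ≤ S * (1 + 1 / (2 * d)) → θ / (d + 2) ^ 2 ≤ u x := by
  have hd5 : (5 : ℝ) ≤ d := by exact_mod_cast hd
  have hS0 : 0 < S := by nlinarith
  set κ : ℝ := 1 / d with hκ
  have hκd : κ * d = 1 := by rw [hκ]; field_simp
  have hκ0 : 0 < κ := by positivity
  have hκ1 : κ ≤ 1 / 5 := by rw [hκ]; gcongr
  set T' := S * (1 + 2 * κ) with hT'
  set T := S * (1 + κ) with hT
  set w : V d → ℝ := fun x => (T' - nsq (x - z)) ^ 2 - (S * κ) ^ 2 with hw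
  have hT'0 : 0 < T' := by positivity
  set c := θ / T' ^ 2 with hc
  have hc0 : 0 ≤ c := by positivity
  have hfar : ∀ x y : V d, nsq (x - z) < T → (∃ i, y = x + ee i ∨ y = x - ee i) →
      ¬ nsq (y - z) < T → w y ≤ 0 := by
    rintro x y hx ⟨i, hi⟩ hy
    have hxi : (((x - z) i : ℤ) : ℝ) ^ 2 < T := lt_of_le_of_lt (sq_le_nsq (x - z) i) hx
    set b := (((x - z) i : ℤ) : ℝ)
    have hb : |b| * 2 + 1 ≤ 2 * (S * κ) := by
      have h2 : (2 * |b| + 1) ^ 2 ≤ (2 * (S * κ)) ^ 2 := by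
        have e : |b| ^ 2 = b ^ 2 := sq_abs b
        have h3 : S * κ * (S * κ) ≥ 4 * S := by
          have : S * (κ * d) * (S * (κ * d)) ≥ 4 * S * (d : ℝ) ^ 2 := by rw [hκd]; nlinarith
          have h4 : S * κ * (S * κ) * (d : ℝ) ^ 2 ≥ 4 * S * (d : ℝ) ^ 2 := by nlinarith
          exact le_of_mul_le_mul_right h4 (by positivity)
        have h5 : T ≤ S * (6 / 5) := by rw [hT]; gcongr; linarith
        nlinarith [sq_nonneg (|b| - 2)]
      exact (by linarith [abs_le_of_sq_le_sq h2 (by positivity), le_abs_self (2 * |b| + 1)])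
    have hyle : nsq (y - z) ≤ nsq (x - z) + 2 * |b| + 1 := by
      rcases hi with rfl | rfl
      · rw [show x + ee i - z = (x - z) + ee i by abel, nsq_add]; linarith [le_abs_self b]
      · rw [show x - ee i - z = (x - z) - ee i by abel, nsq_sub]; linarith [neg_abs_le b]
    have e1 : T' = T + S * κ := by rw [hT', hT]; ring
    simp only [hw]
    push Not at hy
    nlinarith
  have key := minP_loc (by omega) (fun x => u x - c * (if nsq (x - z) < T then w x else 0))
    {x | S < nsq (x - z) ∧ nsq (x - z) < T}
    ((nsq_small_finite z T).subset fun x hx => hx.2.le) ?_ ?_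
  · intro x hx
    have hx' : nsq (x - z) ≤ S * (1 + κ / 2) := by
      convert hx using 2
      rw [hκ]; field_simp
    have hxT : nsq (x - z) < T := by rw [hT]; nlinarith
    have hcd : θ / (d + 2) ^ 2 ≤ θ * 1 := by
      rw [mul_one]; exact div_le_self hθ (by nlinarith)
    by_cases hxS : nsq (x - z) ≤ S
    · linarith [h1 x hxS]
    have h2 := key x ⟨not_le.1 hxS, hxT⟩
    simp only [hxT, if_true] at h2
    have h3 : S ^ 2 * κ ^ 2 ≤ w x := by
      simp only [hw, hT']
      have : S * (κ * (3 / 2)) ≤ S * (1 + 2 * κ) - nsq (x - z) := by nlinarith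
      have := pow_le_pow_left₀ (by positivity) this 2
      nlinarith [mul_pos (mul_pos hS0 hS0) (mul_pos hκ0 hκ0)]
    have h4 : c * (S ^ 2 * κ ^ 2) = θ / (d + 2) ^ 2 := by
      rw [hc, hT', hκ]; field_simp
    nlinarith [mul_le_mul_of_nonneg_left h3 hc0]
  · rintro x ⟨hxS, hxT⟩
    rw [avg_sub, avg_smul]
    simp only [hxT, if_true]
    have h2 : w x ≤ avg (fun y => if nsq (y - z) < T then w y else 0) x := by
      have h3 : avg w x ≤ avg (fun y => if nsq (y - z) < T then w y else 0) x := by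
        refine avg_mono' fun i => ⟨?_, ?_⟩ <;> split_ifs with h
        · exact le_rfl
        · exact hfar x _ hxT ⟨i, Or.inl rfl⟩ h
        · exact le_rfl
        · exact hfar x _ hxT ⟨i, Or.inr rfl⟩ h
      refine le_trans ?_ h3
      have e : w = fun y => (T' ^ 2 - (S * κ) ^ 2) + (-2 * T') * nsq (y - z) + nsq (y - z) ^ 2 := by
        ext y; simp only [hw]; ring
      have e2 : avg w x = (T' ^ 2 - (S * κ) ^ 2) + (-2 * T') * (nsq (x - z) + 1)
          + (nsq (x - z) ^ 2 + 2 * nsq (x - z) + 1 + 4 * nsq (x - z) / d) := by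
        rw [e, avg_add, avg_add, avg_const (by omega), avg_smul, avg_nsq (by omega),
          avg_nsq2 (by omega)]
      rw [e2]
      have e3 : 4 * nsq (x - z) / d = 4 * κ * nsq (x - z) := by rw [hκ]; ring
      rw [e3]
      simp only [hw, hT']
      nlinarith
    have := hs x hxT
    nlinarith [mul_le_mul_of_nonneg_left h2 hc0]
  · intro x hx
    have gen : ∀ y, y ∉ {x | S < nsq (x - z) ∧ nsq (x - z) < T} →
        0 ≤ u y - c * (if nsq (y - z) < T then w y else 0) := by
      intro y hy
      by_cases hyT : nsq (y - z) < T
      · have hyS : nsq (y - z) ≤ S := by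
          by_contra h; exact hy ⟨not_le.1 h, hyT⟩
        simp only [hyT, if_true]
        have h2 : w y ≤ T' ^ 2 := by
          simp only [hw]
          have h0 := nsq_nonneg (y - z)
          have hST : S ≤ T' := by rw [hT']; nlinarith
          linarith [sq_nonneg (S * κ), mul_nonneg h0 (show 0 ≤ 2 * T' - nsq (y - z) by linarith),
            show T' ^ 2 - (T' - nsq (y - z)) ^ 2 = nsq (y - z) * (2 * T' - nsq (y - z)) by ring]
        have h3 : c * T' ^ 2 = θ := by rw [hc]; field_simp
        nlinarith [h1 y hyS, mul_le_mul_of_nonneg_left h2 hc0]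
      · simp [hyT, hu y]
    exact fun i => ⟨gen _, gen _⟩

lemma polyGrowth (hd : 5 ≤ d) : ∃ b : ℕ, ∀ (u : V d → ℝ) (z : V d) (S T θ : ℝ),
    4 * (d : ℝ) ^ 2 ≤ S → S ≤ T → 0 ≤ θ → (∀ x, 0 ≤ u x) →
    (∀ x, nsq (x - z) < 3 * T → avg u x ≤ u x) → (∀ x, nsq (x - z) ≤ S → θ ≤ u x) →
    ∀ x, nsq (x - z) ≤ T → θ * (S / (2 * T)) ^ b ≤ u x := by
  have hd5 : (5 : ℝ) ≤ d := by exact_mod_cast hd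
  set q : ℝ := 1 + 1 / (2 * d) with hq
  have hκ0 : (0 : ℝ) < 1 / (2 * d) := by positivity
  have hκ1 : (1 : ℝ) / (2 * d) ≤ 1 / 10 := by gcongr; linarith
  have hq1 : 1 < q := by linarith
  obtain ⟨b, hb⟩ := pow_unbounded_of_one_lt (((d : ℝ) + 2) ^ 2) hq1
  refine ⟨b, fun u z S T θ hS hST hθ hu hs h1 x hx => ?_⟩
  have hS0 : 0 < S := by nlinarith
  have hT0 : 0 < T := by linarith
  have ind : ∀ j : ℕ, S * q ^ j ≤ 2 * T → ∀ x, nsq (x - z) ≤ S * q ^ j → θ / (((d : ℝ) + 2) ^ 2) ^ j ≤ u x := by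
    intro j
    induction j with
    | zero => intro _ x hx; simpa using h1 x (by simpa using hx)
    | succ j ih =>
      intro hj x hx
      have hle : S * q ^ j ≤ S * q ^ (j + 1) := by
        gcongr
        · exact hq1.le
        · omega
      have h1j : (1 : ℝ) ≤ q ^ j := one_le_pow₀ hq1.le
      have := growL hd u z (S * q ^ j) (by nlinarith) hu (fun x hx => hs x (lt_of_lt_of_le hx ?_))
        (θ := θ / (((d : ℝ) + 2) ^ 2) ^ j) (by positivity) (ih (by linarith)) x
        (by rw [← hq]; calc _ ≤ _ := hx
              _ = _ := by ring)
      · rw [pow_succ, ← div_div]; exact this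
      · have hk : (1 : ℝ) / d ≤ 1 / 5 := by gcongr
        have : 0 ≤ S * q ^ j := by positivity
        nlinarith
  obtain ⟨j, hj1, hj2⟩ : ∃ j : ℕ, T ≤ S * q ^ j ∧ S * q ^ j ≤ 2 * T := by
    have hex : ∃ j : ℕ, T ≤ S * q ^ j := by
      obtain ⟨j, hj⟩ := pow_unbounded_of_one_lt (T / S) hq1
      exact ⟨j, by rw [div_lt_iff₀ hS0] at hj; linarith⟩
    refine ⟨Nat.find hex, Nat.find_spec hex, ?_⟩
    rcases Nat.eq_zero_or_pos (Nat.find hex) with h0 | h0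
    · rw [h0]; simp; linarith
    · have := Nat.find_min hex (m := Nat.find hex - 1) (by omega)
      push Not at this
      have e : S * q ^ (Nat.find hex) = S * q ^ (Nat.find hex - 1) * q := by
        rw [mul_assoc, ← pow_succ]; congr 2; omega
      rw [e]
      nlinarith
  refine le_trans ?_ (ind j hj2 x (hx.trans hj1))
  rw [div_eq_mul_inv]
  refine mul_le_mul_of_nonneg_left ?_ hθ
  have hqj : 0 < q ^ j := by positivity
  have h3 : S / (2 * T) ≤ (q ^ j)⁻¹ := by
    rw [div_le_iff₀ (by positivity), ← div_eq_inv_mul, le_div_iff₀ hqj]; linarith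
  calc (S / (2 * T)) ^ b ≤ ((q ^ j)⁻¹) ^ b := by gcongr
    _ = ((q ^ b) ^ j)⁻¹ := by rw [inv_pow, ← pow_mul, ← pow_mul, mul_comm]
    _ ≤ _ := by gcongr

/-- coordinate reflection `x i ↦ k - x i`. -/
def rfl' (i : Fin d) (k : ℤ) (x : V d) : V d := Function.update x i (k - x i)

lemma rfl'_self (i : Fin d) (k : ℤ) (x : V d) : rfl' i k x i = k - x i := by simp [rfl']
lemma rfl'_ne {i j : Fin d} (h : j ≠ i) (k : ℤ) (x : V d) : rfl' i k x j = x j := by simp [rfl', h]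

lemma rfl'_rfl' (i : Fin d) (k : ℤ) (x : V d) : rfl' i k (rfl' i k x) = x := by
  ext j
  by_cases h : j = i
  · subst h; simp [rfl'_self]
  · simp [rfl'_ne h]

lemma ee_self (i : Fin d) : (ee i : V d) i = 1 := by simp [ee]
lemma ee_ne {i j : Fin d} (h : j ≠ i) : (ee i : V d) j = 0 := by simp [ee, h]

lemma rfl'_add_ne {i j : Fin d} (h : j ≠ i) (k : ℤ) (x : V d) :
    rfl' i k (x + ee j) = rfl' i k x + ee j ∧ rfl' i k (x - ee j) = rfl' i k x - ee j := by
  constructor <;> ext l <;> by_cases hl : l = i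
  · subst hl; simp [rfl'_self, ee_ne h.symm]
  · simp [rfl'_ne hl]
  · subst hl; simp [rfl'_self, ee_ne h.symm]
  · simp [rfl'_ne hl]

lemma rfl'_add_self (i : Fin d) (k : ℤ) (x : V d) :
    rfl' i k (x + ee i) = rfl' i k x - ee i ∧ rfl' i k (x - ee i) = rfl' i k x + ee i := by
  constructor <;> ext l <;> by_cases hl : l = i
  · subst hl; simp [rfl'_self, ee_self]; ring
  · simp [rfl'_ne hl, ee_ne hl]
  · subst hl; simp [rfl'_self, ee_self]; ring
  · simp [rfl'_ne hl, ee_ne hl]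

lemma avg_rfl' (i : Fin d) (k : ℤ) (u : V d → ℝ) (x : V d) :
    avg (fun y => u (rfl' i k y)) x = avg u (rfl' i k x) := by
  unfold avg
  congr 1
  refine Finset.sum_congr rfl fun j _ => ?_
  beta_reduce
  by_cases h : j = i
  · subst h; rw [(rfl'_add_self j k x).1, (rfl'_add_self j k x).2, add_comm]
  · rw [(rfl'_add_ne h k x).1, (rfl'_add_ne h k x).2]

/-- gradient estimate -/
lemma grad (hd : 5 ≤ d) (u : V d → ℝ) (z : V d) (r : ℕ) (hr : 1 ≤ r) (M : ℝ)
    (hu : ∀ x ∈ cube z r, avg u x = u x) (hM : ∀ x ∈ cube z (r + 1), 0 ≤ u x ∧ u x ≤ M) (i : Fin d) :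
    |u z - u (z + ee i)| ≤ 4 * d * M / r := by
  have hM0 : 0 ≤ M := (hM z (self_mem_cube _ _)).1.trans (hM z (self_mem_cube _ _)).2
  have hd5 : (5 : ℝ) ≤ d := by exact_mod_cast hd
  have hr1 : (1 : ℝ) ≤ r := by exact_mod_cast hr
  set R := rfl' i (2 * z i + 1) with hR
  set w : V d → ℝ := fun x => u x - u (R x) with hw
  set w' : V d → ℝ := fun x => if x i ≤ z i then |w x| else 0 with hw'
  have hRmem : ∀ x ∈ cube z (r - 1), x i ≤ z i → R x ∈ cube z r := by
    intro x hx hxi j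
    have := abs_le.1 (hx j)
    rw [abs_le]
    by_cases hj : j = i
    · subst hj; rw [hR, rfl'_self]; push_cast [Nat.cast_sub hr] at this ⊢; constructor <;> linarith
    · rw [hR, rfl'_ne hj]; push_cast [Nat.cast_sub hr] at this ⊢; constructor <;> linarith
  have hRmem' : ∀ x ∈ cube z r, x i ≤ z i → R x ∈ cube z (r + 1) := by
    intro x hx hxi j
    have := abs_le.1 (hx j)
    rw [abs_le]
    by_cases hj : j = i
    · subst hj; rw [hR, rfl'_self]; push_cast; constructor <;> linarith
    · rw [hR, rfl'_ne hj]; push_cast; constructor <;> linarith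
  have hsub : ∀ x ∈ cube z (r - 1), x i ≤ z i → w' x ≤ avg w' x := by
    intro x hx hxi
    have h1 : avg w x = w x := by
      simp only [hw]
      rw [avg_sub, avg_rfl', hu x (cube_mono (by omega) hx), hu _ (hRmem x hx hxi)]
    simp only [hw', hxi, if_true]
    have hdp : (0 : ℝ) < 2 * d := by linarith
    rcases hxi.lt_or_eq with hlt | heq
    · rw [abs_le]
      have e : ∀ y : V d, (∃ j, y = x + ee j ∨ y = x - ee j) → y i ≤ z i := by
        rintro y ⟨j, rfl | rfl⟩ <;> by_cases hj : i = j
        · subst hj; simp [ee_self]; omega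
        · simp [ee_ne hj]; omega
        · subst hj; simp [ee_self]; omega
        · simp [ee_ne hj]; omega
      constructor
      · have : avg (fun y => (-1) * w y) x ≤ avg w' x := by
          refine avg_mono' fun j => ⟨?_, ?_⟩
          · simp only [hw', e _ ⟨j, Or.inl rfl⟩, if_true]; linarith [neg_abs_le (w (x + ee j))]
          · simp only [hw', e _ ⟨j, Or.inr rfl⟩, if_true]; linarith [neg_abs_le (w (x - ee j))]
        rw [avg_smul, h1] at this; linarith
      · rw [← h1]
        refine avg_mono' fun j => ⟨?_, ?_⟩
        · simp only [hw', e _ ⟨j, Or.inl rfl⟩, if_true]; exact le_abs_self _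
        · simp only [hw', e _ ⟨j, Or.inr rfl⟩, if_true]; exact le_abs_self _
    · have hwx : w (x + ee i) = - w x := by
        have : R x = x + ee i := by
          ext l
          by_cases hl : l = i
          · subst hl; simp [hR, rfl'_self, ee_self, heq]; ring
          · simp [hR, rfl'_ne hl, ee_ne hl]
        simp only [hw]
        rw [← this, hR, rfl'_rfl']; ring
      -- combine
      have hb : ∀ σ : ℝ, |σ| ≤ 1 → σ * w x + σ * w x / (2 * d) ≤ avg w' x := by
        intro σ hσ
        have hab : ∀ y, σ * w y ≤ |w y| := fun y => by
          calc σ * w y ≤ |σ * w y| := le_abs_self _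
            _ = |σ| * |w y| := abs_mul _ _
            _ ≤ 1 * |w y| := by gcongr
            _ = _ := one_mul _
        have h2 : avg (fun y => σ * w y + (if y = x + ee i then σ * w x else 0)) x ≤ avg w' x := by
          refine avg_mono' fun j => ⟨?_, ?_⟩
          · by_cases hj : j = i
            · subst hj
              simp only [hw', if_true, hwx]
              rw [if_neg (by simp [ee_self, heq])]; linarith
            · have h3 : x + ee j ≠ x + ee i := by
                intro h; have := congrFun (add_left_cancel h) i; simp [ee_self, ee_ne (Ne.symm hj)] at this
              rw [if_neg h3]
              simp only [hw']
              rw [if_pos (by simp [ee_ne (Ne.symm hj), heq])]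
              linarith [hab (x + ee j)]
          · have h3 : x - ee j ≠ x + ee i := by
              intro h
              have h4 := congrFun h i
              by_cases hj : i = j
              · subst hj; simp [ee_self] at h4; omega
              · simp [ee_self, ee_ne hj] at h4
            rw [if_neg h3]
            simp only [hw']
            rw [if_pos]
            · linarith [hab (x - ee j)]
            · by_cases hj : i = j
              · subst hj; simp [ee_self, heq]
              · simp [ee_ne hj, heq]
        rw [avg_add, avg_smul, h1] at h2
        have h5 : avg (fun y => if y = x + ee i then σ * w x else 0) x = σ * w x / (2 * d) := by
          unfold avg
          congr 1
          rw [Finset.sum_eq_single i]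
          · have h3 : x - ee i ≠ x + ee i := by
              intro h
              have h4 := congrFun h i
              simp [ee_self] at h4; omega
            simp [h3]
          · intro j _ hj
            have h3 : x + ee j ≠ x + ee i := by
              intro h; have := congrFun (add_left_cancel h) i; simp [ee_self, ee_ne (Ne.symm hj)] at this
            have h3' : x - ee j ≠ x + ee i := by
              intro h
              have h4 := congrFun h i
              simp [ee_self, ee_ne (Ne.symm hj)] at h4
            beta_reduce; rw [if_neg h3, if_neg h3', add_zero]
          · simp
        rw [h5] at h2
        exact h2
      rcases le_total 0 (w x) with hx0 | hx0
      · rw [abs_of_nonneg hx0]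
        have := hb 1 (by simp)
        have : 0 ≤ 1 * w x / (2 * d) := by positivity
        linarith
      · rw [abs_of_nonpos hx0]
        have h7 := hb (-1) (by simp)
        have : 0 ≤ -1 * w x / (2 * d) := div_nonneg (by linarith) (by linarith)
        linarith
  -- barrier
  set k : ℝ := (z i : ℝ) + 1
  set ψ : V d → ℝ := fun x => d * (r + 1) * (k - x i) - (d - 1) * (k - x i) ^ 2
    + (nsq (x - z) - ((x i : ℝ) - z i) ^ 2) with hψ
  have hψavg : ∀ x, avg ψ x = ψ x := by
    intro x
    have e : ψ = fun y => (d * (r + 1) * k - (d - 1) * k ^ 2 - (z i : ℝ) ^ 2)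
        + (- (d * (r + 1)) + 2 * (d - 1) * k + 2 * z i) * (y i : ℝ) + (-d) * (y i : ℝ) ^ 2
        + 1 * nsq (y - z) := by
      ext y; simp only [hψ]; ring
    rw [e, avg_quad (by omega)]
    field_simp; ring
  have hlat : ∀ x : V d, 0 ≤ nsq (x - z) - ((x i : ℝ) - z i) ^ 2 := by
    intro x
    have := sq_le_nsq (x - z) i
    simp at this; linarith
  have hlat2 : ∀ (x : V d) j, j ≠ i → ((x j : ℝ) - z j) ^ 2 ≤ nsq (x - z) - ((x i : ℝ) - z i) ^ 2 := by
    intro x j hj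
    have : ((x j : ℝ) - z j) ^ 2 + ((x i : ℝ) - z i) ^ 2 ≤ nsq (x - z) := by
      unfold nsq
      have := Finset.sum_le_sum_of_subset_of_nonneg (s := {j, i}) (t := Finset.univ)
        (f := fun l => (((x - z) l : ℤ) : ℝ) ^ 2) (by simp) (fun _ _ _ => by positivity)
      rw [Finset.sum_pair hj] at this
      simpa using this
    linarith
  have key := minP_loc (by omega) (fun x => 2 * M / r ^ 2 * ψ x - w' x)
    {x | x ∈ cube z (r - 1) ∧ x i ≤ z i} ((cube_finite z (r - 1)).subset fun x hx => hx.1)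
    (fun x hx => by
      rw [avg_sub, avg_smul, hψavg]
      linarith [hsub x hx.1 hx.2]) ?_ z ⟨self_mem_cube _ _, le_rfl⟩
  · have e1 : w' z = |u z - u (z + ee i)| := by
      simp only [hw', le_refl, if_true, hw]
      congr 3
      ext l
      by_cases hl : l = i
      · subst hl; simp [hR, rfl'_self, ee_self]; ring
      · simp [hR, rfl'_ne hl, ee_ne hl]
    rw [← e1]
    have h3 : ψ z ≤ 2 * d * r := by
      simp only [hψ, k, sub_self]
      simp [nsq]
      nlinarith
    have h4 : 2 * M / r ^ 2 * ψ z ≤ 2 * M / r ^ 2 * (2 * d * r) := by gcongr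
    have h5 : 2 * M / r ^ 2 * (2 * d * r) = 4 * d * M / r := by field_simp; ring
    linarith
  · intro x hx
    have gen : ∀ y, y ∈ cube z r → y i ≤ z i + 1 → y ∉ {x | x ∈ cube z (r - 1) ∧ x i ≤ z i} →
        0 ≤ 2 * M / r ^ 2 * ψ y - w' y := by
      intro y hy hyi hyF
      rcases hyi.lt_or_eq with hlt | heq
      · have hyi' : y i ≤ z i := by omega
        have hw2 : w' y ≤ M := by
          simp only [hw', hyi', if_true, hw]
          have h1 := hM y (cube_mono (by omega) hy)
          have h2 := hM _ (hRmem' y hy hyi')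
          rw [abs_le]; constructor <;> linarith
        have hyc : y ∉ cube z (r - 1) := fun h => hyF ⟨h, hyi'⟩
        have hyik := (abs_le.1 (hy i)).1
        have hyik1 : (1 : ℝ) ≤ k - y i := by
          have : (y i : ℝ) ≤ z i := by exact_mod_cast hyi'
          simp only [k]; linarith
        have hyik2 : k - y i ≤ r + 1 := by
          have : -(r : ℝ) ≤ y i - z i := by exact_mod_cast hyik
          simp only [k]; linarith
        have hψ1 : (r : ℝ) ^ 2 ≤ ψ y := by
          simp only [mem_cube, not_forall, not_le] at hyc
          obtain ⟨j, hj⟩ := hyc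
          have hj2 : (r : ℤ) ≤ |y j - z j| := by push_cast [Nat.cast_sub hr] at hj; omega
          have hj3 : (r : ℝ) ≤ |(y j : ℝ) - z j| := by exact_mod_cast hj2
          by_cases hji : j = i
          · subst hji
            have hk : k - y j = r + 1 := by
              rw [abs_of_nonpos (by simp only [k] at hyik1; linarith)] at hj3
              simp only [k] at hyik1 hyik2 ⊢; linarith
            simp only [hψ, hk]
            nlinarith [hlat y]
          · have h6 := hlat2 y j hji
            have h7 : (r : ℝ) ^ 2 ≤ ((y j : ℝ) - z j) ^ 2 := by
              rw [← sq_abs ((y j : ℝ) - z j)]; gcongr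
            have h8 : 0 ≤ (k - y i) * (d * (r + 1) - (d - 1) * (k - y i)) :=
              mul_nonneg (by linarith) (by nlinarith)
            simp only [hψ]
            nlinarith
        have h9 : 2 * M / r ^ 2 * r ^ 2 ≤ 2 * M / r ^ 2 * ψ y := by gcongr
        have h10 : 2 * M / r ^ 2 * (r : ℝ) ^ 2 = 2 * M := by field_simp
        linarith
      · have : w' y = 0 := by simp only [hw']; rw [if_neg (by omega)]
        rw [this, sub_zero]
        refine mul_nonneg (by positivity) ?_
        have hk : k - y i = 0 := by simp only [k, heq]; push_cast; ring
        simp only [hψ, hk]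
        linarith [hlat y]
    intro j
    have h1 : cube x 1 ⊆ cube z r := fun y hy => by
      have := cube_trans hx.1 hy
      rwa [Nat.sub_add_cancel hr] at this
    have hxi := hx.2
    refine ⟨gen _ (h1 (add_ee_mem x j).1) ?_, gen _ (h1 (add_ee_mem x j).2) ?_⟩
    · have := (abs_le.1 ((add_ee_mem x j).1 i)).2; push_cast at this; linarith
    · have := (abs_le.1 ((add_ee_mem x j).2 i)).2; push_cast at this; linarith

lemma mem_cube_norm {x z : V d} {r : ℕ} : x ∈ cube z r ↔ ‖x - z‖ ≤ r := by
  rw [pi_norm_le_iff_of_nonneg (by positivity), mem_cube]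
  refine forall_congr' fun i => ?_
  rw [Int.norm_eq_abs, ← Int.cast_abs]
  simp only [Pi.sub_apply]
  exact_mod_cast Iff.rfl

/-- `ℓ¹` path induction inside a cube. -/
lemma cube_path (z : V d) (r : ℕ) (p : V d → ℕ → Prop) (h0 : p z 0)
    (hs : ∀ x k, x ∈ cube z r → p x k → ∀ y, y ∈ cube z r → (∃ i, y = x + ee i ∨ y = x - ee i) → p y (k + 1))
    (y : V d) (hy : y ∈ cube z r) : ∃ k ≤ d * r, p y k := by
  have main : ∀ k : ℕ, ∀ y ∈ cube z r, (∑ i, (y i - z i).natAbs) = k → p y k := by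
    intro k
    induction k with
    | zero =>
      intro y _ h
      have : y = z := by
        ext i
        have := (Finset.sum_eq_zero_iff.1 h) i (Finset.mem_univ i)
        omega
      rwa [this]
    | succ k ih =>
      intro y hy h
      obtain ⟨i, hi⟩ : ∃ i, (y i - z i).natAbs ≠ 0 := by
        by_contra! hc; simp [hc] at h
      set σ : ℤ := if 0 < y i - z i then 1 else -1 with hσ
      set x : V d := Function.update y i (y i - σ) with hx
      have hσ2 : (y i - σ - z i).natAbs + 1 = (y i - z i).natAbs := by
        simp only [hσ]; split_ifs <;> omega
      have hxi : x i = y i - σ := by simp [hx]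
      have hxj : ∀ j, j ≠ i → x j = y j := fun j hj => by simp [hx, hj]
      have hxc : x ∈ cube z r := by
        intro j
        by_cases hj : j = i
        · subst hj; rw [hxi]; have := hy j; rw [Int.abs_eq_natAbs] at this ⊢; omega
        · rw [hxj j hj]; exact hy j
      have hsum : (∑ j, (x j - z j).natAbs) = k := by
        rw [← Finset.add_sum_erase _ _ (Finset.mem_univ i)] at h ⊢
        have : ∑ j ∈ Finset.univ.erase i, (x j - z j).natAbs = ∑ j ∈ Finset.univ.erase i, (y j - z j).natAbs :=
          Finset.sum_congr rfl fun j hj => by rw [hxj j (Finset.ne_of_mem_erase hj)]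
        rw [this, hxi]; omega
      refine hs x k hxc (ih x hxc hsum) y hy ⟨i, ?_⟩
      by_cases h0 : 0 < y i - z i
      · have hσ1 : σ = 1 := by simp only [hσ]; rw [if_pos h0]
        left; ext j
        by_cases hj : j = i
        · subst hj; simp [hxi, hσ1, ee_self]
        · simp [hxj j hj, ee_ne hj]
      · have hσ1 : σ = -1 := by simp only [hσ]; rw [if_neg h0]
        right; ext j
        by_cases hj : j = i
        · subst hj; simp [hxi, hσ1, ee_self]
        · simp [hxj j hj, ee_ne hj]
  refine ⟨_, ?_, main _ y hy rfl⟩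
  calc (∑ i, (y i - z i).natAbs) ≤ ∑ i : Fin d, r := Finset.sum_le_sum fun i _ => by
        have := hy i; rw [Int.abs_eq_natAbs] at this; omega
    _ = d * r := by simp

lemma crude (u : V d → ℝ) (z : V d) (r : ℕ) (hu : ∀ x, 0 ≤ u x) (hd : 0 < d)
    (hs : ∀ x ∈ cube z r, avg u x ≤ u x) : ∀ y ∈ cube z r, u z / (2 * d) ^ (d * r) ≤ u y := by
  intro y hy
  have h2d : (1 : ℝ) ≤ 2 * d := by have : (1 : ℝ) ≤ d := by exact_mod_cast hd
                                   linarith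
  obtain ⟨k, hk, h⟩ := cube_path z r (fun x k => u z / (2 * d) ^ k ≤ u x) (by simp)
    (fun x k _ h y hy hxy => by
      have h3 : u x / (2 * d) ≤ avg u y := by
        obtain ⟨i, rfl | rfl⟩ := hxy
        · have := (single_le_avg hu (x + ee i) i).2; simpa using this
        · have := (single_le_avg hu (x - ee i) i).1; simpa using this
      rw [pow_succ, ← div_div]
      calc u z / (2 * d) ^ k / (2 * d) ≤ u x / (2 * d) := by gcongr
        _ ≤ _ := h3.trans (hs y hy)) y hy
  refine le_trans ?_ h
  gcongr
  exact hu z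

/-- Harnack inequality -/
lemma harnack (hd : 5 ≤ d) : ∃ C : ℝ, 1 ≤ C ∧ ∀ (R : ℕ), 1 ≤ R → ∀ (u : V d → ℝ) (z : V d),
    (∀ x, 0 ≤ u x) → (∀ x ∈ cube z (5 * d * R), avg u x = u x) →
    ∀ x ∈ cube z (R / 2), u x ≤ C * u z := by
  obtain ⟨b, hb⟩ := polyGrowth hd
  have hd5 : (5 : ℝ) ≤ d := by exact_mod_cast hd
  set c1 : ℝ := min (1 / 2) (1 / (2 * d) ^ (d * (2 * d))) with hc1
  have hc1p : 0 < c1 := by positivity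
  set κ : ℝ := 1 / (64 * d ^ 2 * 4 ^ b) with hκ
  have hκp : 0 < κ := by positivity
  have h4b : (1 : ℝ) ≤ 4 ^ b := one_le_pow₀ (by norm_num)
  have hκ1 : κ ≤ 1 / 64 := by
    rw [hκ]; gcongr
    nlinarith
  set C : ℝ := (32 * d ^ 2 / κ ^ 2) ^ b / c1 with hC
  refine ⟨max C 1, le_max_right _ _, fun R hR u z hu hh x hx => ?_⟩
  suffices hsuff : u x ≤ C * u z from
    hsuff.trans (mul_le_mul_of_nonneg_right (le_max_left _ _) (hu z))
  have hR1 : (1 : ℝ) ≤ R := by exact_mod_cast hR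
  set ρ : V d → ℝ := fun y => R + 1 - ‖y - z‖ with hρ
  have hcm : ∀ {r : ℕ} {y : V d}, y ∈ cube z r ↔ ‖y - z‖ ≤ r := mem_cube_norm
  obtain ⟨p, hp, hmax⟩ := Set.exists_max_image (cube z R) (fun y => u y * ρ y ^ (2 * b))
    (cube_finite z R) ⟨z, self_mem_cube _ _⟩
  have hpR := hcm.1 hp
  have hρp : 1 ≤ ρ p := by simp only [hρ]; linarith
  have hρpR : ρ p ≤ R + 1 := by simp only [hρ]; linarith [norm_nonneg (p - z)]
  -- local bound near p
  have hloc : ∀ y, ‖y - p‖ ≤ ρ p / 2 → y ∈ cube z R → u y ≤ 4 ^ b * u p := by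
    intro y hy hyR
    have h1 := hmax y hyR
    have h2 : ρ p / 2 ≤ ρ y := by
      have : ‖y - z‖ ≤ ‖y - p‖ + ‖p - z‖ := by
        calc ‖y - z‖ = ‖(y - p) + (p - z)‖ := by congr 1; abel
          _ ≤ _ := norm_add_le _ _
      simp only [hρ] at hy ⊢; linarith
    have h3 : (ρ p / 2) ^ (2 * b) ≤ ρ y ^ (2 * b) := by gcongr
    have h4 : (ρ p / 2) ^ (2 * b) = ρ p ^ (2 * b) / 4 ^ b := by
      rw [div_pow, pow_mul (2 : ℝ)]; norm_num
    have h5 : u y * (ρ p ^ (2 * b) / 4 ^ b) ≤ u p * ρ p ^ (2 * b) := by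
      rw [← h4]; exact (mul_le_mul_of_nonneg_left h3 (hu y)).trans h1
    have h6 : 0 < ρ p ^ (2 * b) := by positivity
    have h7 : u y / 4 ^ b ≤ u p := by
      refine le_of_mul_le_mul_right ?_ h6
      calc u y / 4 ^ b * ρ p ^ (2 * b) = u y * (ρ p ^ (2 * b) / 4 ^ b) := by ring
        _ ≤ _ := h5
    rw [div_le_iff₀ (by positivity)] at h7
    linarith
  have hharm : ∀ y, ‖y - p‖ ≤ 4 * d * R → avg u y = u y := by
    intro y hy
    refine hh y (hcm.2 ?_)
    have : ‖y - z‖ ≤ ‖y - p‖ + ‖p - z‖ := by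
      calc ‖y - z‖ = ‖(y - p) + (p - z)‖ := by congr 1; abel
        _ ≤ _ := norm_add_le _ _
    push_cast; nlinarith
  -- half bound on a cube of radius κρ
  have hhalf : ∀ y, ‖y - p‖ ≤ κ * ρ p → 1 / 2 * u p ≤ u y := by
    intro y hy
    set k : ℕ := ⌊κ * ρ p⌋₊ with hk
    have hk1 : (k : ℝ) ≤ κ * ρ p := Nat.floor_le (by positivity)
    have hyk : y ∈ cube p k := by
      simp only [mem_cube]
      intro i
      have h1 : ‖(y - p) i‖ ≤ κ * ρ p := (norm_le_pi_norm _ i).trans hy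
      rw [Int.norm_eq_abs] at h1
      have h2 : ((y i - p i).natAbs : ℝ) ≤ κ * ρ p := by
        rw [Nat.cast_natAbs, Int.cast_abs]; simpa using h1
      have := Nat.le_floor h2
      rw [← hk] at this; rw [Int.abs_eq_natAbs]; omega
    by_cases hk0 : k = 0
    · have : y = p := by
        ext i; have := hyk i; rw [hk0] at this; simp at this; omega
      rw [this]; linarith [hu p]
    have hk1' : (1 : ℝ) ≤ k := by exact_mod_cast Nat.one_le_iff_ne_zero.2 hk0
    -- ρ p ≥ 64
    have hρ64 : 64 ≤ ρ p := by nlinarith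
    set r : ℕ := ⌊ρ p / 4⌋₊ - 1 with hr
    have hr2 : (16 : ℕ) ≤ ⌊ρ p / 4⌋₊ := Nat.le_floor (by push_cast; linarith)
    have hr3 : (⌊ρ p / 4⌋₊ : ℝ) ≤ ρ p / 4 := Nat.floor_le (by positivity)
    have hr4 : ρ p / 4 < ⌊ρ p / 4⌋₊ + 1 := Nat.lt_floor_add_one _
    have hrr : (r : ℝ) = ⌊ρ p / 4⌋₊ - 1 := by rw [hr]; push_cast [Nat.cast_sub (show 1 ≤ ⌊ρ p / 4⌋₊ by omega)]; ring
    have hr8 : ρ p / 8 ≤ r := by linarith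
    have hstep : ∀ x i, x ∈ cube p k → |u x - u (x + ee i)| ≤ 4 * d * (4 ^ b * u p) / r := by
      intro x i hx
      have hxk := mem_cube_norm.1 hx
      refine grad hd u x r (by omega) _ (fun y hy => ?_) (fun y hy => ⟨hu y, ?_⟩) i
      · refine hharm y ?_
        have h1 := mem_cube_norm.1 hy
        have : ‖y - p‖ ≤ ‖y - x‖ + ‖x - p‖ := by
          calc ‖y - p‖ = ‖(y - x) + (x - p)‖ := by congr 1; abel
            _ ≤ _ := norm_add_le _ _
        have h4 : κ * ρ p ≤ 1 / 64 * ρ p := by gcongr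
        nlinarith
      · have h1 := mem_cube_norm.1 hy
        have : ‖y - p‖ ≤ ‖y - x‖ + ‖x - p‖ := by
          calc ‖y - p‖ = ‖(y - x) + (x - p)‖ := by congr 1; abel
            _ ≤ _ := norm_add_le _ _
        have h4 : κ * ρ p ≤ 1 / 64 * ρ p := by gcongr
        have h5 : ‖y - p‖ ≤ ρ p / 2 := by push_cast at h1; linarith
        refine hloc y h5 (hcm.2 ?_)
        have : ‖y - z‖ ≤ ‖y - p‖ + ‖p - z‖ := by
          calc ‖y - z‖ = ‖(y - p) + (p - z)‖ := by congr 1; abel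
            _ ≤ _ := norm_add_le _ _
        simp only [hρ] at h5 hρ64; linarith
    set η := 4 * d * (4 ^ b * u p) / r with hη
    obtain ⟨t, ht, h⟩ := cube_path p k (fun x t => u p - t * η ≤ u x) (by simp)
      (fun x t hx h y hy hxy => by
        have h3 : |u x - u y| ≤ η := by
          obtain ⟨i, rfl | rfl⟩ := hxy
          · exact hstep x i hx
          · have := hstep _ i hy; rw [abs_sub_comm]; simpa using this
        have := (abs_le.1 h3).2
        push_cast; linarith) y hyk
    have hη0 : 0 ≤ η := by have := hu p; positivity
    have h5 : (t : ℝ) * η ≤ 1 / 2 * u p := by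
      have ht' : (t : ℝ) ≤ d * (κ * ρ p) := by
        have : (t : ℝ) ≤ d * k := by exact_mod_cast ht
        exact this.trans (by gcongr)
      have h6 : η ≤ 4 * d * (4 ^ b * u p) / (ρ p / 8) := by
        rw [hη]; have := hu p; gcongr
      calc (t : ℝ) * η ≤ d * (κ * ρ p) * (4 * d * (4 ^ b * u p) / (ρ p / 8)) := by gcongr
        _ = 1 / 2 * u p := by
          rw [hκ]; field_simp; ring
    linarith
  -- growth
  have hgrow := hb u p (max (4 * (d : ℝ) ^ 2) (κ ^ 2 * ρ p ^ 2)) (4 * (d : ℝ) ^ 2 * R ^ 2) (c1 * u p)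
    (le_max_left _ _) (max_le (le_mul_of_one_le_right (by positivity) (one_le_pow₀ hR1)) (by
      have : κ * ρ p ≤ 2 * R := by nlinarith
      have h2 : (κ * ρ p) ^ 2 ≤ (2 * R) ^ 2 := by gcongr
      rw [mul_pow, mul_pow] at h2
      nlinarith [mul_nonneg (by nlinarith : (0:ℝ) ≤ (d:ℝ) ^ 2 - 1) (sq_nonneg (R:ℝ))])) (mul_nonneg hc1p.le (hu p)) hu (fun y hy => (hharm y ?_).le) (fun y hy => ?_) z ?_
  · set S := max (4 * (d : ℝ) ^ 2) (κ ^ 2 * ρ p ^ 2)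
    have h1 : c1 * u p * (κ ^ 2 * ρ p ^ 2 / (2 * (4 * (d : ℝ) ^ 2 * R ^ 2))) ^ b ≤ u z := by
      refine le_trans ?_ hgrow
      refine mul_le_mul_of_nonneg_left ?_ (mul_nonneg hc1p.le (hu p))
      gcongr
      exact le_max_right _ _
    have h2 := hmax x (cube_mono (Nat.div_le_self _ _) hx)
    have h3 : (R : ℝ) / 2 ≤ ρ x := by
      have := hcm.1 hx
      have h4 : ((R / 2 : ℕ) : ℝ) ≤ R / 2 := Nat.cast_div_le
      simp only [hρ]; linarith
    have h4 : u x * ((R : ℝ) / 2) ^ (2 * b) ≤ u p * ρ p ^ (2 * b) :=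
      (mul_le_mul_of_nonneg_left (by gcongr) (hu x)).trans h2
    have h5 : c1 * u p * (κ ^ 2 * ρ p ^ 2 / (2 * (4 * (d : ℝ) ^ 2 * R ^ 2))) ^ b
        = c1 * (κ ^ 2 / (2 * (4 * (d : ℝ) ^ 2 * R ^ 2))) ^ b * (u p * ρ p ^ (2 * b)) := by
      rw [pow_mul, show κ ^ 2 * ρ p ^ 2 / (2 * (4 * (d : ℝ) ^ 2 * R ^ 2))
        = κ ^ 2 / (2 * (4 * (d : ℝ) ^ 2 * R ^ 2)) * ρ p ^ 2 by ring, mul_pow]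
      ring
    rw [h5] at h1
    have h6 : c1 * (κ ^ 2 / (2 * (4 * (d : ℝ) ^ 2 * R ^ 2))) ^ b * (u x * ((R : ℝ) / 2) ^ (2 * b)) ≤ u z :=
      le_trans (by gcongr) h1
    have h7 : c1 * (κ ^ 2 / (2 * (4 * (d : ℝ) ^ 2 * R ^ 2))) ^ b * (u x * ((R : ℝ) / 2) ^ (2 * b))
        = u x / C := by
      have e : (κ ^ 2 / (2 * (4 * (d : ℝ) ^ 2 * R ^ 2))) ^ b * ((R : ℝ) / 2) ^ (2 * b)
          = (κ ^ 2 / (32 * d ^ 2)) ^ b := by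
        rw [pow_mul, ← mul_pow]; congr 1; field_simp; ring
      calc _ = c1 * u x * ((κ ^ 2 / (2 * (4 * (d : ℝ) ^ 2 * R ^ 2))) ^ b * ((R : ℝ) / 2) ^ (2 * b)) := by ring
        _ = u x * (c1 * (κ ^ 2 / (32 * d ^ 2)) ^ b) := by rw [e]; ring
        _ = _ := by
          rw [hC, div_eq_mul_inv (u x), inv_div]
          congr 1
          rw [div_eq_mul_inv c1, ← inv_pow, inv_div]
    rw [h7, div_le_iff₀ (by positivity)] at h6
    linarith
  · rw [pi_norm_le_iff_of_nonneg (by positivity)]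
    intro i
    rw [Int.norm_eq_abs]
    refine abs_le_of_sq_le_sq ?_ (by positivity)
    have := sq_le_nsq (y - p) i
    nlinarith [sq_nonneg ((d : ℝ) * R)]
  · by_cases hcase : nsq (y - p) ≤ 4 * (d : ℝ) ^ 2
    · have hyc : y ∈ cube p (2 * d) := by
        by_contra h
        have := nsq_ge_of_not_mem h
        push_cast at this; nlinarith
      have := crude u p (2 * d) hu (by omega) (fun x hx => (hharm x ?_).le) y hyc
      · refine le_trans ?_ this
        rw [div_eq_mul_one_div, mul_comm]
        exact mul_le_mul_of_nonneg_left (min_le_right _ _) (hu p)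
      · have := mem_cube_norm.1 hx; push_cast at this; nlinarith
    · have h1 : nsq (y - p) ≤ κ ^ 2 * ρ p ^ 2 := by
        rcases le_max_iff.1 hy with h | h
        · exact absurd h hcase
        · exact h
      have h2 : ‖y - p‖ ≤ κ * ρ p := by
        rw [pi_norm_le_iff_of_nonneg (by positivity)]
        intro i
        rw [Int.norm_eq_abs]
        refine abs_le_of_sq_le_sq ?_ (by positivity)
        have := sq_le_nsq (y - p) i
        nlinarith
      exact le_trans (mul_le_mul_of_nonneg_right (min_le_left _ _) (hu p)) (hhalf y h2)
  · have := nsq_le_of_mem (mem_cube_comm.1 hp)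
    nlinarith [sq_nonneg (R : ℝ), mul_nonneg (by linarith : (0:ℝ) ≤ d - 5) (sq_nonneg (R : ℝ))]

noncomputable def ind (s : Set (V d)) : V d → ℝ := fun x => if x ∈ s then 1 else 0

lemma ind_nonneg (s : Set (V d)) (x : V d) : 0 ≤ ind s x := by unfold ind; split_ifs <;> norm_num

lemma ind_le_one (s : Set (V d)) (x : V d) : ind s x ≤ 1 := by unfold ind; split_ifs <;> norm_num

lemma ind_of_mem {s : Set (V d)} {x : V d} (h : x ∈ s) : ind s x = 1 := if_pos h

lemma ind_of_not_mem {s : Set (V d)} {x : V d} (h : x ∉ s) : ind s x = 0 := if_neg h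

noncomputable def g0 (x : V d) : ℝ := Gp Set.univ (ind {(0 : V d)}) x

lemma dom_cube (hd : 5 ≤ d) (z : V d) (R : ℕ) (hR : 1 ≤ R) :
    Dom Set.univ (ind (cube z R))
      (fun x => ((d : ℝ) + 21) ^ 3 / 20 * R ^ 4 * fA (20 * R ^ 2) z x) := by
  have hR1 : (1 : ℝ) ≤ R := by exact_mod_cast hR
  have hR2 : (1 : ℝ) ≤ R ^ 2 := one_le_pow₀ hR1
  have hA : (20 : ℝ) ≤ 20 * R ^ 2 := by linarith
  refine ⟨ind_nonneg _, fun x => ?_, fun x _ => ?_⟩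
  · have := fA_pos (by linarith : (0:ℝ) < 20 * (R:ℝ) ^ 2) z x
    positivity
  · rw [avg_smul]
    have h := fA_super hd hA z x
    have hn := nsq_nonneg (x - z)
    have key : ind (cube z R) x ≤ ((d : ℝ) + 21) ^ 3 / 20 * R ^ 4 *
        ((20 * R ^ 2 + 1) / (nsq (x - z) + 20 * R ^ 2 + 1) ^ 3) := by
      by_cases hx : x ∈ cube z R
      · rw [ind_of_mem hx]
        have h1 := nsq_le_of_mem hx
        have h2 : nsq (x - z) + 20 * R ^ 2 + 1 ≤ (d + 21) * (R:ℝ) ^ 2 := by nlinarith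
        have h3 : (20 * (R:ℝ) ^ 2) / ((d + 21) * (R:ℝ) ^ 2) ^ 3
            ≤ (20 * R ^ 2 + 1) / (nsq (x - z) + 20 * R ^ 2 + 1) ^ 3 := by
          gcongr
          linarith
        calc (1 : ℝ) = ((d : ℝ) + 21) ^ 3 / 20 * R ^ 4 * ((20 * (R:ℝ) ^ 2) / ((d + 21) * (R:ℝ) ^ 2) ^ 3) := by
              field_simp
          _ ≤ _ := by gcongr
      · rw [ind_of_not_mem hx]; positivity
    have hc : 0 ≤ ((d : ℝ) + 21) ^ 3 / 20 * R ^ 4 := by positivity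
    have := mul_le_mul_of_nonneg_left h hc
    rw [mul_add] at this
    linarith

lemma gp_cube (hd : 5 ≤ d) (z : V d) (R : ℕ) (hR : 1 ≤ R) (x : V d) :
    Gp Set.univ (ind (cube z R)) x ≤ ((d : ℝ) + 21) ^ 3 * R ^ 2 := by
  refine ((dom_cube hd z R hR).le x).trans ?_
  have hR1 : (1 : ℝ) ≤ R := by exact_mod_cast hR
  have : fA (20 * (R:ℝ) ^ 2) z x ≤ 1 / (20 * (R:ℝ) ^ 2) := by
    unfold fA
    have hn := nsq_nonneg (x - z)
    gcongr
    linarith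
  calc ((d : ℝ) + 21) ^ 3 / 20 * R ^ 4 * fA (20 * R ^ 2) z x
      ≤ ((d : ℝ) + 21) ^ 3 / 20 * R ^ 4 * (1 / (20 * (R:ℝ) ^ 2)) := by gcongr
    _ = ((d : ℝ) + 21) ^ 3 * R ^ 2 / 400 := by field_simp; norm_num
    _ ≤ _ := by
      have : 0 ≤ ((d : ℝ) + 21) ^ 3 * R ^ 2 := by positivity
      linarith

lemma dom_fin (hd : 5 ≤ d) {s : Set (V d)} (hs : s.Finite) : ∃ W, Dom Set.univ (ind s) W := by
  obtain ⟨R, hR, h⟩ : ∃ R : ℕ, 1 ≤ R ∧ s ⊆ cube 0 R := by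
    induction s, hs using Set.Finite.induction_on with
    | empty => exact ⟨1, le_rfl, Set.empty_subset _⟩
    | @insert a s _ _ ih =>
      obtain ⟨R, h1, h2⟩ := ih
      refine ⟨R + ∑ i, (a i).natAbs, by omega, Set.insert_subset ?_ (h2.trans (cube_mono (by omega)))⟩
      intro i
      have := Finset.single_le_sum (f := fun i => (a i).natAbs) (fun _ _ => Nat.zero_le _) (Finset.mem_univ i)
      simp only [Pi.zero_apply, sub_zero]
      rw [Int.abs_eq_natAbs]; omega
  obtain ⟨h1, h2, h3⟩ := dom_cube hd 0 R hR
  refine ⟨_, ind_nonneg _, h2, fun x hx => le_trans ?_ (h3 x hx)⟩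
  gcongr
  unfold ind
  split_ifs with h5 h6
  · exact le_rfl
  · exact absurd (h h5) h6
  · norm_num
  · exact le_rfl

lemma it_univ_shift (φ : V d → ℝ) (z : V d) (t : ℕ) (x : V d) :
    it Set.univ (fun y => φ (y - z)) t x = it Set.univ φ t (x - z) := by
  induction t generalizing x with
  | zero => simp [it]
  | succ t ih =>
    simp only [it, Set.mem_univ, if_true]
    rw [← avg_shift]
    exact avg_congr' fun i => ⟨ih _, ih _⟩

lemma it_univ_neg (φ : V d → ℝ) (t : ℕ) (x : V d) :
    it Set.univ (fun y => φ (-y)) t x = it Set.univ φ t (-x) := by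
  induction t generalizing x with
  | zero => simp [it]
  | succ t ih =>
    simp only [it, Set.mem_univ, if_true]
    unfold avg
    congr 1
    refine Finset.sum_congr rfl fun i _ => ?_
    rw [ih, ih, neg_add, neg_sub', sub_neg_eq_add]
    rw [← sub_eq_add_neg, add_comm]

lemma ind_singleton_shift (z y : V d) : ind {(0 : V d)} (y - z) = ind {z} y := by
  simp [ind, sub_eq_zero]

lemma g0_shift (x z : V d) : g0 (x - z) = Gp Set.univ (ind {z}) x := by
  unfold g0 Gp
  refine tsum_congr fun t => ?_
  rw [← it_univ_shift]
  simp_rw [ind_singleton_shift]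

lemma g0_neg (x : V d) : g0 (-x) = g0 x := by
  unfold g0 Gp
  refine tsum_congr fun t => ?_
  rw [← it_univ_neg]
  congr 1; ext y; simp [ind]

lemma g0_nonneg (x : V d) : 0 ≤ g0 x := Gp_nonneg (ind_nonneg _) x

lemma g0_eqn (hd : 5 ≤ d) (x : V d) : g0 x = ind {(0 : V d)} x + avg g0 x := by
  obtain ⟨W, hW⟩ := dom_fin hd (Set.finite_singleton (0 : V d))
  exact hW.eqn (Set.mem_univ x)

lemma g0_super (hd : 5 ≤ d) (x : V d) : avg g0 x ≤ g0 x := by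
  rw [g0_eqn hd x]; linarith [ind_nonneg {(0 : V d)} x]

lemma g0_harm (hd : 5 ≤ d) {x : V d} (hx : x ≠ 0) : avg g0 x = g0 x := by
  rw [g0_eqn hd x, ind_of_not_mem (by simpa using hx)]; simp

lemma one_le_g0 (hd : 5 ≤ d) : 1 ≤ g0 (0 : V d) := by
  rw [g0_eqn hd, ind_of_mem (Set.mem_singleton _)]; linarith [avg_nonneg (g0_nonneg (d := d)) 0]

lemma gp_finset (hd : 5 ≤ d) (s : Finset (V d)) (x : V d) :
    Gp Set.univ (ind (s : Set (V d))) x = ∑ y ∈ s, g0 (x - y) := by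
  simp_rw [g0_shift]
  unfold Gp
  rw [← Summable.tsum_finsetSum]
  · refine tsum_congr fun t => ?_
    rw [← it_sum]
    congr 1; ext y
    simp [ind]
  · intro y _
    obtain ⟨W, hW⟩ := dom_fin hd (Set.finite_singleton y)
    exact hW.summable x

lemma cube_card (z : V d) (R : ℕ) : (cube_finite z R).toFinset.card = (2 * R + 1) ^ d := by
  have : (cube_finite z R).toFinset = Fintype.piFinset fun i => Finset.Icc (z i - R) (z i + R) := by
    ext x
    rw [Set.Finite.mem_toFinset, cube_eq, Finset.mem_coe]
  rw [this, Fintype.card_piFinset]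
  simp only [Int.card_Icc]
  have : ∀ i, (z i + R + 1 - (z i - R)).toNat = 2 * R + 1 := fun i => by omega
  simp [this]

lemma sum_cube_g0 (hd : 5 ≤ d) (z : V d) (R : ℕ) (hR : 1 ≤ R) (x : V d) :
    ∑ y ∈ (cube_finite z R).toFinset, g0 (x - y) ≤ ((d : ℝ) + 21) ^ 3 * R ^ 2 := by
  rw [← gp_finset hd]
  simpa using gp_cube hd z R hR x

lemma g0_bdd (hd : 5 ≤ d) : ∃ M : ℝ, 0 < M ∧ ∀ x : V d, g0 x ≤ M := by
  refine ⟨((d : ℝ) + 21) ^ 3 * (1:ℕ) ^ 2, by positivity, fun x => ?_⟩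
  refine le_trans ?_ (sum_cube_g0 hd 0 1 le_rfl x)
  have := Finset.single_le_sum (f := fun y => g0 (x - y)) (s := (cube_finite (0 : V d) 1).toFinset)
    (fun y _ => g0_nonneg _) (a := 0) (by simpa using self_mem_cube 0 1)
  simpa using this

/-- decay of `g0` at scale `R` -/
lemma g0_decay (hd : 5 ≤ d) : ∃ C : ℝ, 0 < C ∧ ∀ (R : ℕ) (x : V d), 1 ≤ R →
    x ∉ cube 0 (12 * d * R) → g0 x ≤ C / R ^ 3 := by
  obtain ⟨C, hC, hH⟩ := harnack hd
  refine ⟨C * ((d : ℝ) + 21) ^ 3, by positivity, fun R x hR hx => ?_⟩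
  have hR1 : (1 : ℝ) ≤ R := by exact_mod_cast hR
  have h1 : ∀ y ∈ (cube_finite x R).toFinset, g0 x / C ≤ g0 (0 - y) := by
    intro y hy
    have hy : y ∈ cube x R := by simpa using hy
    rw [zero_sub, g0_neg, div_le_iff₀ (by linarith), mul_comm]
    refine hH (2 * R) (by omega) g0 y g0_nonneg (fun w hw => g0_harm hd ?_) x ?_
    · rintro rfl
      refine hx (mem_cube_comm.1 (cube_mono ?_ (cube_trans hy hw)))
      nlinarith
    · rw [Nat.mul_div_cancel_left _ (by norm_num)]
      exact mem_cube_comm.1 hy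
  have h2 := Finset.card_nsmul_le_sum _ _ _ h1
  rw [cube_card, nsmul_eq_mul] at h2
  have h3 := h2.trans (sum_cube_g0 hd x R hR 0)
  have h4 : (R : ℝ) ^ 5 ≤ ((2 * R + 1) ^ d : ℕ) := by
    push_cast
    calc (R : ℝ) ^ 5 ≤ (2 * R + 1) ^ 5 := by gcongr; linarith
      _ ≤ _ := by gcongr; linarith
  have hg : 0 ≤ g0 x / C := div_nonneg (g0_nonneg x) (by linarith)
  have h5 := (mul_le_mul_of_nonneg_right h4 hg).trans h3
  rw [le_div_iff₀ (by positivity)]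
  have h6 : (R:ℝ) ^ 2 * (g0 x * R ^ 3) ≤ (R:ℝ) ^ 2 * (C * (d + 21) ^ 3) := by
    calc (R:ℝ) ^ 2 * (g0 x * R ^ 3) = C * ((R:ℝ) ^ 5 * (g0 x / C)) := by field_simp
      _ ≤ C * ((d + 21) ^ 3 * R ^ 2) := by gcongr
      _ = _ := by ring
  exact le_of_mul_le_mul_left h6 (by positivity)

lemma g0_small_finite (hd : 5 ≤ d) {η : ℝ} (hη : 0 < η) : {x : V d | η ≤ g0 x}.Finite := by
  obtain ⟨C, hC, h⟩ := g0_decay hd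
  obtain ⟨R, hR⟩ := exists_nat_gt (C / η)
  have hR0 : (0:ℝ) < R := lt_of_le_of_lt (by positivity) hR
  have hR1 : 1 ≤ R := by exact_mod_cast hR0
  have hR1' : (1 : ℝ) ≤ R := by exact_mod_cast hR1
  refine (cube_finite 0 (12 * d * R)).subset fun x hx => ?_
  by_contra hxc
  have h1 := h R x hR1 hxc
  have h2 : C / R ^ 3 < η := by
    rw [div_lt_iff₀ (by positivity)]
    rw [div_lt_iff₀ hη] at hR
    have : (R:ℝ) ≤ R ^ 3 := le_self_pow₀ hR1' (by norm_num)
    nlinarith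
  exact absurd (hx.out.trans h1) (not_le.2 h2)

lemma g0_le_zero (hd : 5 ≤ d) (x : V d) : g0 x ≤ g0 (0 : V d) := by
  have := minP (by omega) (fun x => g0 (0 : V d) - g0 x) {x : V d | x ≠ 0}
    (fun x hx => by rw [avg_sub, avg_const (by omega), g0_harm hd hx])
    (fun x hx => by simp only [ne_eq, Set.mem_ofPred_eq, not_not] at hx; rw [hx, sub_self])
    (fun η hη => (g0_small_finite hd hη).subset fun x hx => by
      have := hx.out; have := one_le_g0 hd
      have := hη
      simp only [Set.mem_ofPred_eq]; linarith) x
  linarith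

/-- max principle for finite potentials -/
lemma pot_max (hd : 5 ≤ d) (s : Finset (V d)) {K : ℝ} (hK : 0 ≤ K)
    (h : ∀ x ∈ s, ∑ y ∈ s, g0 (x - y) ≤ K) (x : V d) : ∑ y ∈ s, g0 (x - y) ≤ K := by
  have := minP (by omega) (fun x => K - ∑ y ∈ s, g0 (x - y)) {x : V d | x ∉ s}
    (fun x hx => by
      rw [avg_sub, avg_const (by omega), avg_sum]
      simp_rw [avg_shift]
      refine sub_le_sub_left (Finset.sum_le_sum fun y hy => ?_) _
      rw [g0_harm hd]
      intro h
      exact hx (by rw [sub_eq_zero.1 h]; exact hy))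
    (fun x hx => by simp at hx; linarith [h x hx])
    (fun η hη => by
      by_cases hs : s = ∅
      · subst hs
        refine Set.Finite.subset Set.finite_empty fun x hx => ?_
        have := hx.out; simp at this; linarith
      have hc : 0 < s.card := Finset.card_pos.2 (Finset.nonempty_iff_ne_empty.2 hs)
      have hc' : (0 : ℝ) < s.card := by exact_mod_cast hc
      refine Set.Finite.subset (s.finite_toSet.biUnion fun y _ =>
        (g0_small_finite hd (div_pos hη hc')).image fun w => w + y) fun x hx => ?_
      by_contra hcon
      have h1 : ∀ y ∈ s, g0 (x - y) < η / s.card := by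
        intro y hy
        by_contra hlt
        refine hcon (Set.mem_biUnion hy ⟨x - y, not_lt.1 hlt, by simp⟩)
      have h2 := Finset.sum_lt_sum_of_nonempty (Finset.nonempty_iff_ne_empty.2 hs) h1
      rw [Finset.sum_const, nsmul_eq_mul, mul_div_cancel₀ _ hc'.ne'] at h2
      have := hx.out; linarith) x
  linarith

/-- dominator for `g0` -/
noncomputable def WW (x : V d) : ℝ := ∑' k : ℕ, (2 : ℝ) ^ k * fA (20 * 4 ^ k) 0 x

lemma WW_summable (x : V d) : Summable fun k : ℕ => (2 : ℝ) ^ k * fA (20 * 4 ^ k) 0 x := by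
  have hg : Summable fun k : ℕ => (1 / 2 : ℝ) ^ k := summable_geometric_two
  refine Summable.of_nonneg_of_le (fun k => ?_) (fun k => ?_) hg
  · have := fA_pos (by positivity : (0:ℝ) < 20 * 4 ^ k) 0 x
    positivity
  · have h1 : fA (20 * 4 ^ k) 0 x ≤ 1 / 4 ^ k := by
      unfold fA
      have hn := nsq_nonneg (x - 0)
      have : (0:ℝ) < 4 ^ k := by positivity
      gcongr
      linarith
    calc (2 : ℝ) ^ k * fA (20 * 4 ^ k) 0 x ≤ 2 ^ k * (1 / 4 ^ k) := by gcongr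
      _ = (1 / 2) ^ k := by
        rw [mul_one_div, ← div_pow]; norm_num

lemma avg_WW (x : V d) : avg WW x = ∑' k : ℕ, (2 : ℝ) ^ k * avg (fA (20 * 4 ^ k) 0) x := by
  have e : ∀ k : ℕ, (2 : ℝ) ^ k * avg (fA (20 * 4 ^ k) 0) x
      = (∑ i : Fin d, ((2 : ℝ) ^ k * fA (20 * 4 ^ k) 0 (x + ee i) + (2 : ℝ) ^ k * fA (20 * 4 ^ k) 0 (x - ee i))) / (2 * d) := by
    intro k; unfold avg; rw [mul_div_assoc', Finset.mul_sum]; simp_rw [mul_add]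
  simp_rw [e]
  rw [tsum_div_const, Summable.tsum_finsetSum fun i _ => (WW_summable _).add (WW_summable _)]
  unfold avg WW
  congr 1
  exact Finset.sum_congr rfl fun i _ => ((WW_summable _).tsum_add (WW_summable _)).symm

lemma WW_super (hd : 5 ≤ d) (x : V d) (k : ℕ) :
    avg WW x + 2 ^ k * ((20 * 4 ^ k + 1) / (nsq x + 20 * 4 ^ k + 1) ^ 3) ≤ WW x := by
  have hs : ∀ j : ℕ, (2:ℝ) ^ j * avg (fA (20 * 4 ^ j) 0) x
      + 2 ^ j * ((20 * 4 ^ j + 1) / (nsq x + 20 * 4 ^ j + 1) ^ 3) ≤ 2 ^ j * fA (20 * 4 ^ j) 0 x := by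
    intro j
    have h4 : (1:ℝ) ≤ 4 ^ j := one_le_pow₀ (by norm_num)
    have := fA_super hd (by linarith : (20:ℝ) ≤ 20 * 4 ^ j) 0 x
    rw [sub_zero] at this
    rw [← mul_add]
    gcongr
  have hn := nsq_nonneg x
  have hpos : ∀ j : ℕ, (0:ℝ) ≤ 2 ^ j * ((20 * 4 ^ j + 1) / (nsq x + 20 * 4 ^ j + 1) ^ 3) := by
    intro j; positivity
  have hsumA : Summable fun j : ℕ => (2:ℝ) ^ j * avg (fA (20 * 4 ^ j) 0) x := by
    refine Summable.of_nonneg_of_le (fun j => ?_) (fun j => ?_) (WW_summable x)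
    · exact mul_nonneg (by positivity) (avg_nonneg (fun y => (fA_pos (by positivity) 0 y).le) x)
    · linarith [hs j, hpos j]
  rw [avg_WW]
  have h1 := (hsumA.add ((hasSum_ite_eq k (2 ^ k * ((20 * 4 ^ k + 1) / (nsq x + 20 * 4 ^ k + 1) ^ 3))).summable)).tsum_le_tsum
    (fun j => ?_) (WW_summable x)
  · rw [Summable.tsum_add hsumA (hasSum_ite_eq k _).summable, tsum_ite_eq] at h1
    exact h1
  · split_ifs with hj
    · subst hj; exact hs j
    · linarith [hs j, hpos j]

lemma dom_g0 (hd : 5 ≤ d) : ∃ C : ℝ, Dom Set.univ (g0 (d := d)) (fun x => C * WW x) := by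
  obtain ⟨C, hC, hdec⟩ := g0_decay hd
  obtain ⟨M, hM, hg⟩ := g0_bdd hd
  have hd5 : (5:ℝ) ≤ d := by exact_mod_cast hd
  -- g0 x ≤ K / 8^k when 4^k ≤ nsq x + 1
  set K : ℝ := (24 * d ^ 2) ^ 3 * (C + M) with hK
  have hb : ∀ (x : V d) (k : ℕ), (4:ℝ) ^ k ≤ nsq x + 1 → g0 x ≤ K / 8 ^ k := by
    intro x k hk
    have h8 : (8:ℝ) ^ k = (2 ^ k) ^ 3 := by rw [← pow_mul, mul_comm, pow_mul]; norm_num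
    by_cases hsm : (2:ℝ) ^ k < 24 * d ^ 2
    · rw [le_div_iff₀ (by positivity), h8, hK]
      have h1 : ((2:ℝ) ^ k) ^ 3 ≤ (24 * d ^ 2) ^ 3 := by gcongr
      have h2 := hg x
      calc g0 x * (2 ^ k) ^ 3 ≤ (C + M) * (24 * d ^ 2) ^ 3 := by
            gcongr; linarith
        _ = _ := by ring
    · push Not at hsm
      set R : ℕ := 2 ^ k / (12 * d ^ 2) with hR
      have hR2 : 2 ≤ R := by
        rw [hR, Nat.le_div_iff_mul_le (by positivity)]
        have : (24 * d ^ 2 : ℕ) ≤ 2 ^ k := by exact_mod_cast hsm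
        omega
      have hRle : R * (12 * d ^ 2) ≤ 2 ^ k := Nat.div_mul_le_self _ _
      have hRge : 2 ^ k < (R + 1) * (12 * d ^ 2) := by
        rw [← Nat.div_lt_iff_lt_mul (by positivity)]; omega
      have hx : x ∉ cube 0 (12 * d * R) := by
        intro hx
        have h1 := nsq_le_of_mem hx
        rw [sub_zero] at h1
        have h2 : ((R:ℝ) * (12 * d ^ 2)) ^ 2 ≤ 4 ^ k := by
          have : (R:ℝ) * (12 * d ^ 2) ≤ 2 ^ k := by exact_mod_cast hRle
          calc ((R:ℝ) * (12 * d ^ 2)) ^ 2 ≤ (2 ^ k) ^ 2 := by gcongr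
            _ = 4 ^ k := by rw [← pow_mul, mul_comm, pow_mul]; norm_num
        push_cast at h1
        have hR2' : (2:ℝ) ≤ R := by exact_mod_cast hR2
        have h3 : (1:ℝ) ≤ (12 * d * R) ^ 2 := by
          refine one_le_pow₀ ?_
          nlinarith
        have e1 : ((R:ℝ) * (12 * d ^ 2)) ^ 2 = d * (d * (12 * d * R) ^ 2) := by ring
        rw [e1] at h2
        have h4 : 5 * (d * (12 * (d:ℝ) * R) ^ 2) ≤ d * (d * (12 * d * R) ^ 2) := by gcongr
        have h5 : (12 * (d:ℝ) * R) ^ 2 * 5 ≤ d * (12 * (d:ℝ) * R) ^ 2 := by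
          rw [mul_comm]; gcongr
        linarith
      refine (hdec R x (by omega) hx).trans ?_
      rw [div_le_div_iff₀ (by positivity) (by positivity), h8, hK]
      have h1 : (2:ℝ) ^ k ≤ 24 * d ^ 2 * R := by
        have : (2:ℝ) ^ k < (R + 1) * (12 * d ^ 2) := by exact_mod_cast hRge
        have hR2' : (2:ℝ) ≤ R := by exact_mod_cast hR2
        nlinarith [sq_nonneg (d:ℝ)]
      calc C * (2 ^ k) ^ 3 ≤ (C + M) * (24 * d ^ 2 * R) ^ 3 := by gcongr; linarith
        _ = _ := by ring
  refine ⟨K * 24 ^ 3 / 20, g0_nonneg, fun x => ?_, fun x _ => ?_⟩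
  · refine mul_nonneg (by positivity) (tsum_nonneg fun k => ?_)
    exact mul_nonneg (by positivity) (fA_pos (by positivity) 0 x).le
  · have hn := nsq_nonneg x
    obtain ⟨k, hk1, hk2⟩ := exists_nat_pow_near (by linarith : (1:ℝ) ≤ nsq x + 1) (by norm_num : (1:ℝ) < 4)
    have h1 := WW_super hd x k
    have h2 := hb x k hk1
    have h3 : 1 / 8 ^ k ≤ 24 ^ 3 / 20 * (2 ^ k * ((20 * 4 ^ k + 1) / (nsq x + 20 * 4 ^ k + 1) ^ 3)) := by
      have a1 : nsq x + 20 * 4 ^ k + 1 ≤ 24 * 4 ^ k := by rw [pow_succ] at hk2; linarith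
      have a2 : (20 * (4:ℝ) ^ k) / (24 * 4 ^ k) ^ 3 ≤ (20 * 4 ^ k + 1) / (nsq x + 20 * 4 ^ k + 1) ^ 3 := by
        gcongr; linarith
      calc (1:ℝ) / 8 ^ k = 24 ^ 3 / 20 * (2 ^ k * ((20 * (4:ℝ) ^ k) / (24 * 4 ^ k) ^ 3)) := by
            have e4 : (4:ℝ) ^ k = 2 ^ k * 2 ^ k := by rw [← mul_pow]; norm_num
            have e8 : (8:ℝ) ^ k = 2 ^ k * 2 ^ k * 2 ^ k := by rw [← mul_pow, ← mul_pow]; norm_num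
            rw [e4, e8]; field_simp
        _ ≤ _ := by gcongr
    rw [avg_smul]
    have h4 : K / 8 ^ k ≤ K * 24 ^ 3 / 20 * (2 ^ k * ((20 * 4 ^ k + 1) / (nsq x + 20 * 4 ^ k + 1) ^ 3)) := by
      calc K / 8 ^ k = K * (1 / 8 ^ k) := by ring
        _ ≤ K * (24 ^ 3 / 20 * (2 ^ k * ((20 * 4 ^ k + 1) / (nsq x + 20 * 4 ^ k + 1) ^ 3))) := by gcongr
        _ = _ := by ring
    have h5 := mul_le_mul_of_nonneg_left h1 (by positivity : 0 ≤ K * 24 ^ 3 / 20)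
    rw [mul_add] at h5
    linarith

lemma e_summable (hd : 5 ≤ d) : Summable fun j => it Set.univ (g0 (d := d)) j 0 := by
  obtain ⟨C, h⟩ := dom_g0 hd
  exact h.summable 0

def sh (j : ℕ) (ω : ℕ → V d) : ℕ → V d := fun i => ω (j + i)

def cyl (γ : ℕ → V d) (n : ℕ) : Set (ℕ → V d) := {ω | ∀ i ≤ n, ω i = γ i}

lemma mem_cyl {γ ω : ℕ → V d} {n : ℕ} : ω ∈ cyl γ n ↔ ∀ i ≤ n, ω i = γ i := Iff.rfl

lemma sh_apply (j : ℕ) (ω : ℕ → V d) (i : ℕ) : sh j ω i = ω (j + i) := rfl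

lemma sh_sh (j k : ℕ) (ω : ℕ → V d) : sh k (sh j ω) = sh (j + k) ω := by
  ext i; simp [sh, add_assoc]

lemma sh_zero (ω : ℕ → V d) : sh 0 ω = ω := by ext i; simp [sh]

lemma meas_sh (j : ℕ) : Measurable (sh (d := d) j) :=
  measurable_pi_lambda _ fun i => measurable_pi_apply (j + i)

lemma meas_V (s : Set (V d)) : MeasurableSet s := s.to_countable.measurableSet

/-- restriction to the first `n+1` coordinates -/
def res (n : ℕ) (ω : ℕ → V d) : Fin (n + 1) → V d := fun i => ω i

def ext' (n : ℕ) (γ : Fin (n + 1) → V d) : ℕ → V d := fun i => γ ⟨min i n, by omega⟩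

lemma meas_res (n : ℕ) : Measurable (res (d := d) n) :=
  measurable_pi_lambda _ fun i => measurable_pi_apply (i : ℕ)

lemma res_eq_iff {n : ℕ} {ω : ℕ → V d} {γ : Fin (n + 1) → V d} :
    res n ω = γ ↔ ω ∈ cyl (ext' n γ) n := by
  constructor
  · rintro rfl i hi
    simp [ext', res, hi]
  · intro h; ext1 i
    have := h i (by omega)
    simp only [res, this, ext']
    congr 1; ext; simp; omega

lemma ext'_res (n : ℕ) (ω : ℕ → V d) (i : ℕ) (hi : i ≤ n) : ext' n (res n ω) i = ω i := by
  simp [ext', res, hi]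

lemma res_preimage (n : ℕ) (γ : Fin (n + 1) → V d) : res n ⁻¹' {γ} = cyl (ext' n γ) n := by
  ext ω; exact res_eq_iff

/-- sets depending on finitely many coordinates are measurable -/
lemma meas_dep (n : ℕ) (E : Set (ℕ → V d)) (h : ∀ ω ω', (∀ i ≤ n, ω i = ω' i) → ω ∈ E → ω' ∈ E) :
    MeasurableSet E := by
  have : E = res n ⁻¹' {γ | ext' n γ ∈ E} := by
    ext ω
    refine ⟨fun hω => h ω _ (fun i hi => (ext'_res n ω i hi).symm) hω,
      fun hω => h _ ω (fun i hi => ext'_res n ω i hi) hω⟩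
  rw [this]
  exact meas_res n (Set.to_countable _).measurableSet

lemma meas_cyl (γ : ℕ → V d) (n : ℕ) : MeasurableSet (cyl γ n) :=
  meas_dep n _ fun ω ω' h hω i hi => by rw [← h i hi]; exact hω i hi

lemma isPi_cyl : IsPiSystem {s : Set (ℕ → V d) | ∃ γ n, s = cyl γ n} := by
  rintro _ ⟨γ, n, rfl⟩ _ ⟨γ', n', rfl⟩ ⟨ω, h1, h2⟩
  refine ⟨ω, max n n', ?_⟩
  ext ω'
  constructor
  · rintro ⟨h3, h4⟩ i hi
    rcases le_max_iff.1 hi with h | h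
    · rw [h3 i h, h1 i h]
    · rw [h4 i h, h2 i h]
  · intro h
    exact ⟨fun i hi => by rw [h i (le_max_of_le_left hi), h1 i hi],
      fun i hi => by rw [h i (le_max_of_le_right hi), h2 i hi]⟩

lemma gen_cyl : (MeasurableSpace.pi : MeasurableSpace (ℕ → V d))
    = MeasurableSpace.generateFrom {s | ∃ γ n, s = cyl γ n} := by
  apply le_antisymm
  · refine iSup_le fun i => ?_
    rintro _ ⟨s, -, rfl⟩
    have : (fun ω : ℕ → V d => ω i) ⁻¹' s
        = ⋃ γ : {γ : Fin (i + 1) → V d // ext' i γ i ∈ s}, cyl (ext' i γ.1) i := by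
      ext ω
      simp only [Set.mem_preimage, Set.mem_iUnion]
      constructor
      · intro h
        exact ⟨⟨res i ω, by rwa [ext'_res _ _ _ le_rfl]⟩, res_eq_iff.1 rfl⟩
      · rintro ⟨⟨γ, hγ⟩, h⟩
        rw [h i le_rfl]; exact hγ
    rw [this]
    exact MeasurableSet.iUnion fun γ => MeasurableSpace.measurableSet_generateFrom ⟨_, _, rfl⟩
  · refine MeasurableSpace.generateFrom_le ?_
    rintro _ ⟨γ, n, rfl⟩
    exact meas_cyl γ n

lemma adj_iff {x y : V d} : adj x y ↔ ∃ i, y = x + ee i ∨ y = x - ee i := by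
  constructor
  · intro h
    unfold adj at h
    obtain ⟨i, hi⟩ : ∃ i, |x i - y i| ≠ 0 := by
      by_contra! hc; simp [hc] at h
    have h1 : ∀ j, 0 ≤ |x j - y j| := fun j => abs_nonneg _
    rw [← Finset.add_sum_erase _ _ (Finset.mem_univ i)] at h
    have h2 : 0 ≤ ∑ j ∈ Finset.univ.erase i, |x j - y j| := Finset.sum_nonneg fun j _ => h1 j
    have h3 : ∑ j ∈ Finset.univ.erase i, |x j - y j| = 0 := by
      have := h1 i; omega
    have h4 : |x i - y i| = 1 := by omega
    have h5 : ∀ j, j ≠ i → y j = x j := fun j hj => by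
      have := (Finset.sum_eq_zero_iff_of_nonneg (fun j _ => h1 j)).1 h3 j (by simp [hj])
      rw [abs_eq_zero] at this; omega
    refine ⟨i, ?_⟩
    rcases (abs_eq (by norm_num)).1 h4 with h6 | h6
    · right; ext j
      by_cases hj : j = i
      · subst hj; simp [ee_self]; omega
      · simp [ee_ne hj, h5 j hj]
    · left; ext j
      by_cases hj : j = i
      · subst hj; simp [ee_self]; omega
      · simp [ee_ne hj, h5 j hj]
  · have key : ∀ i : Fin d, ∑ j, |(ee i : V d) j| = 1 := by
      intro i
      rw [Finset.sum_eq_single i]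
      · simp [ee_self]
      · intro j _ hj; simp [ee_ne hj]
      · simp
    rintro ⟨i, rfl | rfl⟩
    · simpa [adj] using key i
    · simpa [adj] using key i

noncomputable def nbr (x : V d) : Finset (V d) :=
  (Finset.univ.image fun i => x + ee i) ∪ (Finset.univ.image fun i => x - ee i)

lemma mem_nbr {x y : V d} : y ∈ nbr x ↔ adj x y := by
  rw [adj_iff]
  simp only [nbr, Finset.mem_union, Finset.mem_image, Finset.mem_univ, true_and]
  constructor
  · rintro (⟨i, rfl⟩ | ⟨i, rfl⟩)
    · exact ⟨i, Or.inl rfl⟩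
    · exact ⟨i, Or.inr rfl⟩
  · rintro ⟨i, rfl | rfl⟩
    · exact Or.inl ⟨i, rfl⟩
    · exact Or.inr ⟨i, rfl⟩

lemma ee_inj {i j : Fin d} (h : (ee i : V d) = ee j) : i = j := by
  by_contra hne
  have := congrFun h i
  rw [ee_self, ee_ne hne] at this; omega

lemma sum_nbr {M : Type*} [AddCommMonoid M] (x : V d) (f : V d → M) :
    ∑ y ∈ nbr x, f y = ∑ i, (f (x + ee i) + f (x - ee i)) := by
  unfold nbr
  rw [Finset.sum_union, Finset.sum_image, Finset.sum_image, ← Finset.sum_add_distrib]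
  · intro i _ j _ h; exact ee_inj (by simpa using h)
  · intro i _ j _ h; exact ee_inj (by simpa using h)
  · rw [Finset.disjoint_left]
    intro y hy hy'
    obtain ⟨i, -, rfl⟩ := Finset.mem_image.1 hy
    obtain ⟨j, -, h⟩ := Finset.mem_image.1 hy'
    have := congrFun h i
    simp only [Pi.sub_apply, Pi.add_apply, ee_self] at this
    by_cases hij : i = j
    · subst hij; rw [ee_self] at this; omega
    · rw [ee_ne hij] at this; omega

lemma two_d_ne (hd : 0 < d) : (2 * (d : ℝ≥0∞)) ≠ 0 ∧ (2 * (d : ℝ≥0∞)) ≠ ⊤ := by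
  constructor
  · simp; omega
  · exact ENNReal.mul_ne_top (by simp) (by simp)

lemma law_cyl {μ : Measure (ℕ → V d)} {x : V d} (h : IsSRWLaw μ x) {n : ℕ} {γ : ℕ → V d}
    (h0 : γ 0 = x) (hn : ∀ i < n, adj (γ i) (γ (i + 1))) : μ (cyl γ n) = (2 * (d : ℝ≥0∞))⁻¹ ^ n :=
  h.2 n γ h0 hn

lemma upd_cyl (γ : ℕ → V d) (n : ℕ) (v : V d) :
    cyl (Function.update γ (n + 1) v) (n + 1) = cyl γ n ∩ {ω | ω (n + 1) = v} := by
  ext ω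
  constructor
  · intro h
    refine ⟨fun i hi => ?_, ?_⟩
    · rw [h i (by omega), Function.update_of_ne (by omega)]
    · have := h (n + 1) le_rfl; simpa using this
  · rintro ⟨h1, h2⟩ i hi
    by_cases h : i = n + 1
    · subst h; simpa using h2
    · rw [Function.update_of_ne h]; exact h1 i (by omega)

lemma cyl_step_zero (hd : 0 < d) {μ : Measure (ℕ → V d)} {x : V d} (h : IsSRWLaw μ x) {n : ℕ} {γ : ℕ → V d}
    (h0 : γ 0 = x) (hn : ∀ i < n, adj (γ i) (γ (i + 1))) :
    μ (cyl γ n ∩ {ω | ¬ adj (γ n) (ω (n + 1))}) = 0 := by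
  have := h.1
  have h1 : ∀ v ∈ nbr (γ n), μ (cyl γ n ∩ {ω | ω (n + 1) = v}) = (2 * (d : ℝ≥0∞))⁻¹ ^ (n + 1) := by
    intro v hv
    rw [← upd_cyl]
    refine law_cyl h (by simp [h0]) fun i hi => ?_
    by_cases hin : i = n
    · subst hin
      rw [Function.update_of_ne (by omega), Function.update_self]
      exact mem_nbr.1 hv
    · rw [Function.update_of_ne (by omega), Function.update_of_ne (by omega)]
      exact hn i (by omega)
  have hm : ∀ v : V d, MeasurableSet (cyl γ n ∩ {ω | ω (n + 1) = v}) := fun v => by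
    rw [← upd_cyl]; exact meas_cyl _ _
  have h2 : μ (⋃ v ∈ nbr (γ n), cyl γ n ∩ {ω | ω (n + 1) = v}) = (2 * (d : ℝ≥0∞))⁻¹ ^ n := by
    rw [measure_biUnion_finset]
    · rw [Finset.sum_congr rfl h1, sum_nbr]
      simp only [Finset.sum_const, Finset.card_univ, Fintype.card_fin, nsmul_eq_mul]
      rw [pow_succ, ← two_mul, ← mul_assoc, mul_comm (d : ℝ≥0∞) 2]
      rw [mul_comm, mul_assoc, ENNReal.inv_mul_cancel (two_d_ne hd).1 (two_d_ne hd).2, mul_one]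
    · intro v _ w _ hvw
      rw [Function.onFun, Set.disjoint_left]
      rintro ω ⟨-, h1⟩ ⟨-, h2⟩
      exact hvw (h1.symm.trans h2)
    · intro v _; exact hm v
  have hsub : (⋃ v ∈ nbr (γ n), cyl γ n ∩ {ω | ω (n + 1) = v}) ⊆ cyl γ n :=
    Set.iUnion₂_subset fun v _ => Set.inter_subset_left
  have h3 : μ (cyl γ n \ ⋃ v ∈ nbr (γ n), cyl γ n ∩ {ω | ω (n + 1) = v}) = 0 := by
    rw [measure_sdiff hsub (Finset.measurableSet_biUnion _ fun v _ => hm v).nullMeasurableSet (measure_ne_top _ _),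
      h2, law_cyl h h0 hn, tsub_self]
  refine measure_mono_null ?_ h3
  rintro ω ⟨h4, h5⟩
  refine ⟨h4, ?_⟩
  simp only [Set.mem_iUnion, not_exists]
  rintro v hv ⟨-, h6⟩
  exact h5 (by rw [h6.out]; exact mem_nbr.1 hv)

lemma ae_nn (hd : 0 < d) {μ : Measure (ℕ → V d)} {x : V d} (h : IsSRWLaw μ x) :
    ∀ᵐ ω ∂μ, ω 0 = x ∧ ∀ i, adj (ω i) (ω (i + 1)) := by
  have := h.1
  have h0 : ∀ᵐ ω ∂μ, ω 0 = x := by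
    have := h.2 0 (fun _ => x) rfl (by simp)
    rw [pow_zero] at this
    have h2 := (prob_compl_eq_zero_iff (meas_cyl (fun _ => x) 0)).2 this
    rw [ae_iff]
    refine measure_mono_null (fun ω hω => ?_) h2
    intro h3; exact hω (h3 0 le_rfl)
  have hs : ∀ n, ∀ᵐ ω ∂μ, (ω 0 = x ∧ ∀ i < n, adj (ω i) (ω (i + 1))) → adj (ω n) (ω (n + 1)) := by
    intro n
    rw [ae_iff]
    have : μ (⋃ γ : {γ : Fin (n + 1) → V d // ext' n γ 0 = x ∧ ∀ i < n, adj (ext' n γ i) (ext' n γ (i + 1))},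
        cyl (ext' n γ.1) n ∩ {ω | ¬ adj (ext' n γ.1 n) (ω (n + 1))}) = 0 :=
      measure_iUnion_null fun γ => cyl_step_zero hd h γ.2.1 γ.2.2
    refine measure_mono_null (fun ω hω => ?_) this
    have hω' := hω.out
    push Not at hω'
    obtain ⟨⟨h1, h2⟩, h3⟩ := hω'
    have e := ext'_res n ω
    refine Set.mem_iUnion.2 ⟨⟨res n ω, ?_, fun i hi => ?_⟩, res_eq_iff.1 rfl, ?_⟩
    · rw [e 0 (by omega)]; exact h1
    · rw [e i hi.le, e (i + 1) (by omega)]; exact h2 i hi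
    · show ¬ _
      rw [e n le_rfl]; exact h3
  filter_upwards [h0, ae_all_iff.2 hs] with ω h1 h2
  refine ⟨h1, fun i => ?_⟩
  induction i using Nat.strong_induction_on with
  | _ i ih => exact h2 i ⟨h1, fun j hj => ih j hj⟩

lemma cyl_zero_of_bad (hd : 0 < d) {μ : Measure (ℕ → V d)} {x : V d} (h : IsSRWLaw μ x) {n : ℕ} {γ : ℕ → V d}
    (hb : ¬ (γ 0 = x ∧ ∀ i < n, adj (γ i) (γ (i + 1)))) : μ (cyl γ n) = 0 := by
  have := ae_nn hd h
  rw [ae_iff] at this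
  refine measure_mono_null (fun ω hω => ?_) this
  intro hc
  refine hb ⟨by rw [← hω 0 (by omega)]; exact hc.1, fun i hi => ?_⟩
  rw [← hω i hi.le, ← hω (i + 1) (by omega)]; exact hc.2 i

lemma law_unique (hd : 0 < d) {μ ν : Measure (ℕ → V d)} {x : V d} (h : IsSRWLaw μ x) (h' : IsSRWLaw ν x) :
    μ = ν := by
  have := h.1
  have := h'.1
  refine ext_of_generate_finite _ gen_cyl isPi_cyl ?_ (by simp)
  rintro _ ⟨γ, n, rfl⟩
  by_cases hb : γ 0 = x ∧ ∀ i < n, adj (γ i) (γ (i + 1))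
  · rw [law_cyl h hb.1 hb.2, law_cyl h' hb.1 hb.2]
  · rw [cyl_zero_of_bad hd h hb, cyl_zero_of_bad hd h' hb]

/-- cylinder Markov property -/
lemma markov_cyl (hd : 0 < d) {P : V d → Measure (ℕ → V d)} (hP : ∀ x, IsSRWLaw (P x) x)
    {μ : Measure (ℕ → V d)} {x : V d} (h : IsSRWLaw μ x) (γ : ℕ → V d) (n : ℕ) :
    (μ.restrict (cyl γ n)).map (sh n) = μ (cyl γ n) • P (γ n) := by
  have := h.1
  by_cases hb : γ 0 = x ∧ ∀ i < n, adj (γ i) (γ (i + 1))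
  swap
  · rw [cyl_zero_of_bad hd h hb, Measure.restrict_eq_zero.2 (cyl_zero_of_bad hd h hb)]; simp
  have hc : μ (cyl γ n) = (2 * (d : ℝ≥0∞))⁻¹ ^ n := law_cyl h hb.1 hb.2
  have hc0 : μ (cyl γ n) ≠ 0 := by
    rw [hc]; exact pow_ne_zero _ (ENNReal.inv_ne_zero.2 (two_d_ne hd).2)
  have hct : μ (cyl γ n) ≠ ⊤ := measure_ne_top _ _
  have key : IsSRWLaw ((μ (cyl γ n))⁻¹ • (μ.restrict (cyl γ n)).map (sh n)) (γ n) := by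
    refine ⟨⟨?_⟩, fun k γ' h0 hadj => ?_⟩
    · rw [Measure.smul_apply, Measure.map_apply (meas_sh n) MeasurableSet.univ]
      simp [ENNReal.inv_mul_cancel hc0 hct]
    · change ((μ (cyl γ n))⁻¹ • (μ.restrict (cyl γ n)).map (sh n)) (cyl γ' k) = _
      rw [Measure.smul_apply, Measure.map_apply (meas_sh n) (meas_cyl γ' k),
        Measure.restrict_apply (meas_sh n (meas_cyl γ' k))]
      set γ'' : ℕ → V d := fun i => if i ≤ n then γ i else γ' (i - n) with hγ''
      have e1 : ∀ i, i ≤ n → γ'' i = γ i := fun i hi => by simp [hγ'', hi]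
      have e2 : ∀ i, γ'' (n + i) = γ' i := fun i => by
        by_cases hi : i = 0
        · subst hi; simp [hγ'', h0]
        · simp [hγ'', hi]
      have e : sh n ⁻¹' (cyl γ' k) ∩ cyl γ n = cyl γ'' (n + k) := by
        ext ω
        constructor
        · rintro ⟨h1, h2⟩ i hi
          by_cases hin : i ≤ n
          · rw [e1 i hin]; exact h2 i hin
          · obtain ⟨j, rfl⟩ := Nat.exists_eq_add_of_le (not_le.1 hin).le
            rw [e2]; exact h1 j (by omega)
        · intro h1
          refine ⟨fun i hi => ?_, fun i hi => ?_⟩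
          · rw [sh_apply, h1 (n + i) (by omega), e2]
          · rw [h1 i (by omega), e1 i hi]
      have hc2 : μ (cyl γ'' (n + k)) = (2 * (d : ℝ≥0∞))⁻¹ ^ (n + k) := by
        refine law_cyl h (by rw [e1 0 (by omega)]; exact hb.1) ?_
        intro i hi
        by_cases hin : i < n
        · rw [e1 i hin.le, e1 (i + 1) (by omega)]; exact hb.2 i hin
        · obtain ⟨j, rfl⟩ := Nat.exists_eq_add_of_le (not_lt.1 hin)
          rw [add_assoc, e2, e2]; exact hadj j (by omega)
      rw [e, hc2, hc, smul_eq_mul, pow_add, ← mul_assoc, ENNReal.inv_mul_cancel, one_mul]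
      · rw [← hc]; exact hc0
      · rw [← hc]; exact hct
  have := law_unique hd key (hP (γ n))
  rw [← this, smul_smul, ENNReal.mul_inv_cancel hc0 hct, one_smul]

lemma lint_part (μ : Measure (ℕ → V d)) (n : ℕ) (F : (ℕ → V d) → ℝ≥0∞) :
    ∫⁻ ω, F ω ∂μ = ∑' γ : Fin (n + 1) → V d, ∫⁻ ω in cyl (ext' n γ) n, F ω ∂μ := by
  rw [← lintegral_iUnion (fun γ => meas_cyl _ _)]
  · rw [← setLIntegral_univ]
    congr 2
    symm
    rw [Set.eq_univ_iff_forall]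
    exact fun ω => Set.mem_iUnion.2 ⟨res n ω, res_eq_iff.1 rfl⟩
  · intro γ γ' hne
    rw [Function.onFun, Set.disjoint_left]
    intro ω h1 h2
    exact hne ((res_eq_iff.2 h1).symm.trans (res_eq_iff.2 h2))

/-- Markov property, integral form -/
lemma markov (hd : 0 < d) {P : V d → Measure (ℕ → V d)} (hP : ∀ x, IsSRWLaw (P x) x)
    {μ : Measure (ℕ → V d)} {x : V d} (h : IsSRWLaw μ x) (n : ℕ) (F : (ℕ → V d) → (ℕ → V d) → ℝ≥0∞)
    (hdep : ∀ ω ω', (∀ i ≤ n, ω i = ω' i) → F ω = F ω') (hm : ∀ ω, Measurable (F ω)) :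
    ∫⁻ ω, F ω (sh n ω) ∂μ = ∫⁻ ω, (∫⁻ ω', F ω ω' ∂(P (ω n))) ∂μ := by
  rw [lint_part μ n, lint_part μ n]
  refine tsum_congr fun γ => ?_
  have e1 : ∫⁻ ω in cyl (ext' n γ) n, F ω (sh n ω) ∂μ = ∫⁻ ω in cyl (ext' n γ) n, F (ext' n γ) (sh n ω) ∂μ :=
    setLIntegral_congr_fun (meas_cyl _ _) fun ω hω => by
      rw [hdep ω _ hω]
  have e2 : ∫⁻ ω in cyl (ext' n γ) n, (∫⁻ ω', F ω ω' ∂(P (ω n))) ∂μ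
      = ∫⁻ ω in cyl (ext' n γ) n, (∫⁻ ω', F (ext' n γ) ω' ∂(P (ext' n γ n))) ∂μ :=
    setLIntegral_congr_fun (meas_cyl _ _) fun ω hω => by
      rw [hdep ω _ hω, hω n le_rfl]
  rw [e1, e2, ← lintegral_map (hm _) (meas_sh n), markov_cyl hd hP h, lintegral_smul_measure,
    setLIntegral_const, smul_eq_mul, mul_comm]

lemma markov_set (hd : 0 < d) {P : V d → Measure (ℕ → V d)} (hP : ∀ x, IsSRWLaw (P x) x)
    {μ : Measure (ℕ → V d)} {x : V d} (h : IsSRWLaw μ x) (n : ℕ) (R : (ℕ → V d) → Set (ℕ → V d))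
    (hdep : ∀ ω ω', (∀ i ≤ n, ω i = ω' i) → R ω = R ω') (hm : ∀ ω, MeasurableSet (R ω))
    (hm2 : MeasurableSet {ω | sh n ω ∈ R ω}) :
    μ {ω | sh n ω ∈ R ω} = ∫⁻ ω, P (ω n) (R ω) ∂μ := by
  have := markov hd hP h n (fun ω => (R ω).indicator 1) (fun ω ω' h => by rw [hdep ω ω' h])
    (fun ω => measurable_one.indicator (hm ω))
  simp only [lintegral_indicator_one (hm _)] at this
  rw [← this, ← lintegral_indicator_one hm2]
  rfl

/-- one step -/
lemma one_step_map (hd : 0 < d) {P : V d → Measure (ℕ → V d)} (hP : ∀ x, IsSRWLaw (P x) x) (x : V d) :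
    (P x).map (sh 1) = (2 * (d : ℝ≥0∞))⁻¹ • ∑ i, (P (x + ee i) + P (x - ee i)) := by
  have := (hP x).1
  ext E hE
  rw [Measure.map_apply (meas_sh 1) hE, Measure.smul_apply, Measure.finsetSum_apply]
  simp only [Measure.add_apply, smul_eq_mul]
  rw [← sum_nbr x (fun y => P y E), Finset.mul_sum]
  have hpath : ∀ v : V d, cyl (fun i => if i = 0 then x else v) 1 = {ω | ω 0 = x ∧ ω 1 = v} := by
    intro v; ext ω
    constructor
    · intro h; exact ⟨by simpa using h 0 (by omega), by simpa using h 1 le_rfl⟩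
    · rintro ⟨h1, h2⟩ i hi
      interval_cases i
      · simpa using h1
      · simpa using h2
  have h1 : ∀ v ∈ nbr x, (2 * (d : ℝ≥0∞))⁻¹ * P v E = P x (sh 1 ⁻¹' E ∩ {ω | ω 0 = x ∧ ω 1 = v}) := by
    intro v hv
    have := congrArg (fun m => m E) (markov_cyl hd hP (hP x) (fun i => if i = 0 then x else v) 1)
    simp only [Measure.smul_apply, smul_eq_mul] at this
    rw [Measure.map_apply (meas_sh 1) hE, Measure.restrict_apply (meas_sh 1 hE), hpath] at this
    rw [this, ← hpath, law_cyl (hP x) (by simp), pow_one]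
    · simp
    · intro i hi; interval_cases i; simpa using mem_nbr.1 hv
  rw [Finset.sum_congr rfl h1, ← measure_biUnion_finset]
  · refine measure_congr ?_
    filter_upwards [ae_nn hd (hP x)] with ω hω
    apply propext
    constructor
    · intro h
      refine Set.mem_biUnion (mem_nbr.2 ?_ : ω 1 ∈ nbr x) ⟨h, hω.1, rfl⟩
      have := hω.2 0; rwa [hω.1] at this
    · intro h
      obtain ⟨v, -, h2⟩ := Set.mem_iUnion₂.1 h
      exact h2.1
  · intro v _ w _ hvw
    rw [Function.onFun, Set.disjoint_left]
    rintro ω ⟨-, -, h1⟩ ⟨-, -, h2⟩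
    exact hvw (h1.symm.trans h2)
  · intro v _
    refine (meas_sh 1 hE).inter ?_
    rw [← hpath]; exact meas_cyl _ _

lemma one_step_lint (hd : 0 < d) {P : V d → Measure (ℕ → V d)} (hP : ∀ x, IsSRWLaw (P x) x) (x : V d)
    {F : (ℕ → V d) → ℝ≥0∞} (hF : Measurable F) :
    ∫⁻ ω, F (sh 1 ω) ∂(P x) = (2 * (d : ℝ≥0∞))⁻¹ * ∑ i, (∫⁻ ω, F ω ∂(P (x + ee i)) + ∫⁻ ω, F ω ∂(P (x - ee i))) := by
  rw [← lintegral_map hF (meas_sh 1), one_step_map hd hP, lintegral_smul_measure,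
    lintegral_finsetSum_measure]
  simp [lintegral_add_measure]

lemma one_step (hd : 0 < d) {P : V d → Measure (ℕ → V d)} (hP : ∀ x, IsSRWLaw (P x) x) (x : V d)
    {E : Set (ℕ → V d)} (hE : MeasurableSet E) :
    (P x).real (sh 1 ⁻¹' E) = avg (fun y => (P y).real E) x := by
  have := fun x => (hP x).1
  have := congrArg (fun m => m E) (one_step_map hd hP x)
  simp only [Measure.map_apply (meas_sh 1) hE, Measure.smul_apply, Measure.finsetSum_apply, Measure.add_apply, smul_eq_mul] at this
  unfold Measure.real avg
  rw [this, ENNReal.toReal_mul, ENNReal.toReal_sum]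
  · rw [div_eq_inv_mul]
    congr 1
    · rw [ENNReal.toReal_inv]; simp
    · exact Finset.sum_congr rfl fun i _ => ENNReal.toReal_add (measure_ne_top _ _) (measure_ne_top _ _)
  · intro i _; exact ENNReal.add_ne_top.2 ⟨measure_ne_top _ _, measure_ne_top _ _⟩

/-- expectation link -/
lemma lint_it (hd : 0 < d) {P : V d → Measure (ℕ → V d)} (hP : ∀ x, IsSRWLaw (P x) x)
    (B : Set (V d)) (φ : V d → ℝ) (hφ : ∀ x, 0 ≤ φ x) (t : ℕ) (x : V d) :
    ∫⁻ ω, ENNReal.ofReal (if (∀ i ≤ t, ω i ∈ B) then φ (ω t) else 0) ∂(P x) = ENNReal.ofReal (it B φ t x) := by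
  have hmeas : ∀ t, Measurable fun ω : ℕ → V d => ENNReal.ofReal (if (∀ i ≤ t, ω i ∈ B) then φ (ω t) else 0) := by
    intro t
    have : (fun ω : ℕ → V d => ENNReal.ofReal (if (∀ i ≤ t, ω i ∈ B) then φ (ω t) else 0))
      = (fun γ : Fin (t + 1) → V d => ENNReal.ofReal (if (∀ i ≤ t, ext' t γ i ∈ B) then φ (ext' t γ t) else 0)) ∘ res t := by
      ext ω
      simp only [Function.comp]
      rw [ext'_res t ω t le_rfl]
      congr 2
      refine propext (forall_congr' fun i => forall_congr' fun hi => ?_)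
      rw [ext'_res t ω i hi]
    rw [this]
    exact (measurable_of_countable _).comp (meas_res t)
  have := fun x => (hP x).1
  have hc : ∀ (F : (ℕ → V d) → ℝ≥0∞) (c : ℝ≥0∞) (x : V d), (∀ ω : ℕ → V d, ω 0 = x → F ω = c) →
      ∫⁻ ω, F ω ∂(P x) = c := by
    intro F c x h
    rw [lintegral_congr_ae (g := fun _ => c), lintegral_const, measure_univ, mul_one]
    filter_upwards [ae_nn hd (hP x)] with ω hω using h ω hω.1
  induction t generalizing x with
  | zero =>
    refine hc _ _ x fun ω hω => ?_
    simp only [it, Nat.le_zero, forall_eq, hω]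
  | succ t ih =>
    by_cases hx : x ∈ B
    · have : ∫⁻ ω, ENNReal.ofReal (if (∀ i ≤ t + 1, ω i ∈ B) then φ (ω (t + 1)) else 0) ∂(P x)
          = ∫⁻ ω, ENNReal.ofReal (if (∀ i ≤ t, sh 1 ω i ∈ B) then φ (sh 1 ω t) else 0) ∂(P x) := by
        refine lintegral_congr_ae ?_
        filter_upwards [ae_nn hd (hP x)] with ω hω
        have e : (∀ i ≤ t + 1, ω i ∈ B) ↔ (∀ i ≤ t, sh 1 ω i ∈ B) := by
          constructor
          · intro h i hi; exact h (1 + i) (by omega)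
          · intro h i hi
            rcases i with _ | i
            · rw [hω.1]; exact hx
            · have := h i (by omega); rwa [sh_apply, add_comm] at this
        rw [if_congr e rfl rfl, sh_apply, add_comm 1 t]
      rw [this, one_step_lint hd hP x (hmeas t)]
      simp_rw [ih]
      simp only [it, hx, if_true]
      unfold avg
      rw [div_eq_inv_mul, ENNReal.ofReal_mul (by positivity), ENNReal.ofReal_sum_of_nonneg]
      · congr 1
        · rw [ENNReal.ofReal_inv_of_pos (by positivity)]
          congr 1
          rw [ENNReal.ofReal_mul (by norm_num)]; simp
        · exact Finset.sum_congr rfl fun i _ => (ENNReal.ofReal_add (it_nonneg hφ _ _) (it_nonneg hφ _ _)).symm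
      · intro i _; exact add_nonneg (it_nonneg hφ _ _) (it_nonneg hφ _ _)
    · rw [it_off hx, ENNReal.ofReal_zero]
      refine hc _ _ x fun ω hω => ?_
      rw [if_neg, ENNReal.ofReal_zero]
      intro h; exact hx (hω ▸ h 0 (by omega))

lemma prob_it (hd : 0 < d) {P : V d → Measure (ℕ → V d)} (hP : ∀ x, IsSRWLaw (P x) x)
    (B A : Set (V d)) (t : ℕ) (x : V d) :
    (P x).real {ω | (∀ i ≤ t, ω i ∈ B) ∧ ω t ∈ A} = it B (ind A) t x := by
  have hm : MeasurableSet {ω : ℕ → V d | (∀ i ≤ t, ω i ∈ B) ∧ ω t ∈ A} :=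
    meas_dep t _ fun ω ω' h hω => ⟨fun i hi => by rw [← h i hi]; exact hω.1 i hi, by rw [← h t le_rfl]; exact hω.2⟩
  have := lint_it hd hP B (ind A) (ind_nonneg A) t x
  rw [Measure.real, ← lintegral_indicator_one hm]
  rw [show (∫⁻ ω, {ω : ℕ → V d | (∀ i ≤ t, ω i ∈ B) ∧ ω t ∈ A}.indicator 1 ω ∂(P x))
    = ∫⁻ ω, ENNReal.ofReal (if (∀ i ≤ t, ω i ∈ B) then ind A (ω t) else 0) ∂(P x) from ?_, this,
    ENNReal.toReal_ofReal (it_nonneg (ind_nonneg A) _ _)]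
  refine lintegral_congr fun ω => ?_
  by_cases h1 : ∀ i ≤ t, ω i ∈ B
  · by_cases h2 : ω t ∈ A
    · rw [Set.indicator_of_mem (show ω ∈ {ω : ℕ → V d | (∀ i ≤ t, ω i ∈ B) ∧ ω t ∈ A} from ⟨h1, h2⟩), if_pos h1, ind_of_mem h2]; simp
    · rw [Set.indicator_of_notMem (fun h => h2 h.2), if_pos h1, ind_of_not_mem h2]; simp
  · rw [Set.indicator_of_notMem (fun h => h1 h.1), if_neg h1]; simp

/-- `P` is the family of walk laws. -/
abbrev SRW (P : V d → Measure (ℕ → V d)) : Prop := ∀ x, IsSRWLaw (P x) x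

/-- dependence on the first `n+1` coordinates -/
def Dep {α : Type*} (n : ℕ) (F : (ℕ → V d) → α) : Prop := ∀ ω ω', (∀ i ≤ n, ω i = ω' i) → F ω = F ω'

lemma Dep.meas {n : ℕ} {A : Set (ℕ → V d)} (h : Dep n (· ∈ A)) : MeasurableSet A :=
  meas_dep n A fun ω ω' e hm => (h ω ω' e).mp hm

lemma meas_R {n : ℕ} {R : (ℕ → V d) → Set (ℕ → V d)} (hdep : Dep n R) (hm : ∀ ω, MeasurableSet (R ω)) :
    MeasurableSet {ω | sh n ω ∈ R ω} := by
  have : {ω : ℕ → V d | sh n ω ∈ R ω}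
      = ⋃ γ : Fin (n + 1) → V d, cyl (ext' n γ) n ∩ sh n ⁻¹' (R (ext' n γ)) := by
    ext ω
    simp only [Set.mem_iUnion]
    constructor
    · intro h
      refine ⟨res n ω, res_eq_iff.1 rfl, ?_⟩
      rw [Set.mem_preimage, hdep _ ω fun i hi => ext'_res n ω i hi]; exact h
    · rintro ⟨γ, h1, h2⟩
      change sh n ω ∈ R ω
      rw [hdep ω _ h1]; exact h2
  rw [this]
  exact MeasurableSet.iUnion fun γ => (meas_cyl _ _).inter (meas_sh n (hm _))

section
variable {P : V d → Measure (ℕ → V d)} {μ : Measure (ℕ → V d)} {x : V d}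

lemma mk_eq (hd : 0 < d) (hP : SRW P) (h : IsSRWLaw μ x) {n : ℕ} {A : Set (ℕ → V d)}
    (hA : Dep n (· ∈ A)) {R : (ℕ → V d) → Set (ℕ → V d)} (hdep : Dep n R)
    (hm : ∀ ω, MeasurableSet (R ω)) :
    μ {ω | ω ∈ A ∧ sh n ω ∈ R ω} = ∫⁻ ω in A, P (ω n) (R ω) ∂μ := by
  set R' : (ℕ → V d) → Set (ℕ → V d) := fun ω => if ω ∈ A then R ω else ∅
  have hd' : Dep n R' := fun ω ω' e => by
    have := hA ω ω' e
    simp only [R', this, hdep ω ω' e]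
  have hm' : ∀ ω, MeasurableSet (R' ω) := fun ω => by
    simp only [R']; split_ifs
    exacts [hm ω, MeasurableSet.empty]
  have e : {ω | ω ∈ A ∧ sh n ω ∈ R ω} = {ω | sh n ω ∈ R' ω} := by
    ext ω
    by_cases hω : ω ∈ A <;> simp [R', hω]
  rw [e, markov_set hd hP h n R' hd' hm' (meas_R hd' hm'), ← lintegral_indicator hA.meas]
  refine lintegral_congr fun ω => ?_
  by_cases hω : ω ∈ A <;> simp [R', hω]

lemma mk_le (hd : 0 < d) (hP : SRW P) (h : IsSRWLaw μ x) {n : ℕ} {A : Set (ℕ → V d)}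
    (hA : Dep n (· ∈ A)) {R : (ℕ → V d) → Set (ℕ → V d)} (hdep : Dep n R)
    (hm : ∀ ω, MeasurableSet (R ω)) {M : ℝ≥0∞} (hM : ∀ ω ∈ A, P (ω n) (R ω) ≤ M) :
    μ {ω | ω ∈ A ∧ sh n ω ∈ R ω} ≤ M * μ A := by
  rw [mk_eq hd hP h hA hdep hm, ← setLIntegral_const]
  exact setLIntegral_mono' hA.meas hM

lemma mk_ge (hd : 0 < d) (hP : SRW P) (h : IsSRWLaw μ x) {n : ℕ} {A : Set (ℕ → V d)}
    (hA : Dep n (· ∈ A)) {R : (ℕ → V d) → Set (ℕ → V d)} (hdep : Dep n R)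
    (hm : ∀ ω, MeasurableSet (R ω)) {M : ℝ≥0∞} (hM : ∀ ω ∈ A, M ≤ P (ω n) (R ω)) :
    M * μ A ≤ μ {ω | ω ∈ A ∧ sh n ω ∈ R ω} := by
  rw [mk_eq hd hP h hA hdep hm, ← setLIntegral_const]
  exact setLIntegral_mono' hA.meas hM

end

/-- first hit of `F` at time `j` through `S` -/
def fh (S F : Set (V d)) (j : ℕ) : Set (ℕ → V d) := {ω | ω j ∈ F ∧ ∀ i < j, ω i ∈ S ∧ ω i ∉ F}

/-- `F` is hit through `S` -/
def hbE (S F : Set (V d)) : Set (ℕ → V d) := {ω | ∃ j, ω j ∈ F ∧ ∀ i < j, ω i ∈ S}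

/-- probability of hitting `F` through `S` -/
noncomputable def hb (P : V d → Measure (ℕ → V d)) (S F : Set (V d)) (x : V d) : ℝ := (P x).real (hbE S F)

/-- hitting `F` through `S` and then `E` -/
def hbT (S F : Set (V d)) (E : Set (ℕ → V d)) : Set (ℕ → V d) := {ω | ∃ j, ω ∈ fh S F j ∧ sh j ω ∈ E}

lemma fh_dep (S F : Set (V d)) (j : ℕ) : Dep j (· ∈ fh S F j) := by
  intro ω ω' e
  simp only [fh, Set.mem_ofPred_eq, e j le_rfl]
  refine propext (and_congr_right fun _ => forall₂_congr fun i hi => ?_)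
  rw [e i hi.le]

lemma fh_disj (S F : Set (V d)) : Pairwise (Function.onFun Disjoint (fh S F)) := by
  intro i j hij
  rw [Function.onFun, Set.disjoint_left]
  rintro ω ⟨h1, h2⟩ ⟨h3, h4⟩
  rcases lt_or_gt_of_ne hij with h | h
  · exact (h4 i h).2 h1
  · exact (h2 j h).2 h3

lemma hbE_eq (S F : Set (V d)) : hbE S F = ⋃ j, fh S F j := by
  ext ω
  simp only [Set.mem_iUnion]
  constructor
  · rintro ⟨j, h1, h2⟩
    have hex : ∃ j, ω j ∈ F := ⟨j, h1⟩
    have hle := Nat.find_min' hex h1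
    exact ⟨Nat.find hex, Nat.find_spec hex, fun i hi => ⟨h2 i (by omega), Nat.find_min hex hi⟩⟩
  · rintro ⟨j, h1, h2⟩
    exact ⟨j, h1, fun i hi => (h2 i hi).1⟩

lemma hbE_meas (S F : Set (V d)) : MeasurableSet (hbE S F) := by
  rw [hbE_eq]; exact MeasurableSet.iUnion fun j => (fh_dep S F j).meas

lemma hbT_eq (S F : Set (V d)) (E : Set (ℕ → V d)) : hbT S F E = ⋃ j, (fh S F j ∩ sh j ⁻¹' E) := by
  ext ω; simp only [Set.mem_iUnion]; rfl

lemma hbT_meas (S F : Set (V d)) {E : Set (ℕ → V d)} (hE : MeasurableSet E) : MeasurableSet (hbT S F E) := by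
  rw [hbT_eq]; exact MeasurableSet.iUnion fun j => (fh_dep S F j).meas.inter (meas_sh j hE)

section
variable {P : V d → Measure (ℕ → V d)}

lemma hbT_sum (x : V d) (S F : Set (V d)) {E : Set (ℕ → V d)} (hE : MeasurableSet E) :
    P x (hbT S F E) = ∑' j, P x (fh S F j ∩ sh j ⁻¹' E) ∧ P x (hbE S F) = ∑' j, P x (fh S F j) := by
  rw [hbT_eq, hbE_eq]
  refine ⟨measure_iUnion ?_ fun j => (fh_dep S F j).meas.inter (meas_sh j hE),
    measure_iUnion (fh_disj S F) fun j => (fh_dep S F j).meas⟩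
  exact fun i j hij => (fh_disj S F hij).mono Set.inter_subset_left Set.inter_subset_left

lemma hbT_le (hd : 0 < d) (hP : SRW P) (x : V d) (S F : Set (V d)) {E : Set (ℕ → V d)}
    (hE : MeasurableSet E) {M : ℝ} (hM : ∀ z ∈ F, (P z).real E ≤ M) (hM0 : 0 ≤ M) :
    (P x).real (hbT S F E) ≤ M * hb P S F x := by
  have := fun x => (hP x).1
  have h : P x (hbT S F E) ≤ ENNReal.ofReal M * P x (hbE S F) := by
    rw [(hbT_sum x S F hE).1, (hbT_sum x S F hE).2, ← ENNReal.tsum_mul_left]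
    refine ENNReal.tsum_le_tsum fun j => ?_
    refine mk_le hd hP (hP x) (fh_dep S F j) (R := fun _ => E) (fun _ _ _ => rfl) (fun _ => hE) fun ω hω => ?_
    rw [ENNReal.le_ofReal_iff_toReal_le (measure_ne_top _ _) hM0]
    exact hM _ hω.1
  have := ENNReal.toReal_mono (ENNReal.mul_ne_top ENNReal.ofReal_ne_top (measure_ne_top _ _)) h
  rwa [ENNReal.toReal_mul, ENNReal.toReal_ofReal hM0] at this

lemma hbT_ge (hd : 0 < d) (hP : SRW P) (x : V d) (S F : Set (V d)) {E : Set (ℕ → V d)}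
    (hE : MeasurableSet E) {M : ℝ} (hM : ∀ z ∈ F, M ≤ (P z).real E) (hM0 : 0 ≤ M) :
    M * hb P S F x ≤ (P x).real (hbT S F E) := by
  have := fun x => (hP x).1
  have h : ENNReal.ofReal M * P x (hbE S F) ≤ P x (hbT S F E) := by
    rw [(hbT_sum x S F hE).1, (hbT_sum x S F hE).2, ← ENNReal.tsum_mul_left]
    refine ENNReal.tsum_le_tsum fun j => ?_
    refine mk_ge hd hP (hP x) (fh_dep S F j) (R := fun _ => E) (fun _ _ _ => rfl) (fun _ => hE) fun ω hω => ?_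
    rw [ENNReal.ofReal_le_iff_le_toReal (measure_ne_top _ _)]
    exact hM _ hω.1
  have := ENNReal.toReal_mono (measure_ne_top _ _) h
  rwa [ENNReal.toReal_mul, ENNReal.toReal_ofReal hM0] at this

lemma ae0 (hd : 0 < d) (hP : SRW P) (x : V d) : ∀ᵐ ω ∂(P x), ω 0 = x :=
  (ae_nn hd (hP x)).mono fun _ h => h.1

lemma real_congr {μ : Measure (ℕ → V d)} {E E' : Set (ℕ → V d)} {p : (ℕ → V d) → Prop}
    (hp : ∀ᵐ ω ∂μ, p ω) (h : ∀ ω, p ω → (ω ∈ E ↔ ω ∈ E')) : μ.real E = μ.real E' := by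
  refine measureReal_congr (hp.mono fun ω hω => ?_)
  exact propext (h ω hω)

lemma real_le {μ : Measure (ℕ → V d)} [IsFiniteMeasure μ] {E E' : Set (ℕ → V d)} {p : (ℕ → V d) → Prop}
    (hp : ∀ᵐ ω ∂μ, p ω) (h : ∀ ω, p ω → ω ∈ E → ω ∈ E') : μ.real E ≤ μ.real E' := by
  refine ENNReal.toReal_mono (measure_ne_top _ _) (measure_mono_ae (hp.mono fun ω hω => ?_))
  exact h ω hω

lemma hb_nonneg (S F : Set (V d)) (x : V d) : 0 ≤ hb P S F x := measureReal_nonneg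

lemma hb_le_one (hP : SRW P) (S F : Set (V d)) (x : V d) : hb P S F x ≤ 1 := by
  have := (hP x).1
  exact measureReal_le_one

lemma hb_one (hd : 0 < d) (hP : SRW P) {S F : Set (V d)} {x : V d} (hx : x ∈ F) : hb P S F x = 1 := by
  have := (hP x).1
  rw [← probReal_univ (μ := P x)]
  exact real_congr (ae0 hd hP x) fun ω h => by
    simp only [Set.mem_univ, iff_true]; exact ⟨0, h ▸ hx, by simp⟩

lemma hb_zero (hd : 0 < d) (hP : SRW P) {S F : Set (V d)} {x : V d} (hx : x ∉ F) (hS : x ∉ S) :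
    hb P S F x = 0 := by
  rw [← measureReal_empty (μ := P x)]
  refine real_congr (ae0 hd hP x) fun ω h => ?_
  simp only [Set.mem_empty_iff_false, iff_false]
  rintro ⟨j, h1, h2⟩
  rcases Nat.eq_zero_or_pos j with rfl | hj
  · exact hx (h ▸ h1)
  · exact hS (h ▸ h2 0 hj)

lemma hb_avg (hd : 0 < d) (hP : SRW P) {S F : Set (V d)} {x : V d} (hx : x ∉ F) (hS : x ∈ S) :
    hb P S F x = avg (hb P S F) x := by
  rw [show avg (hb P S F) x = avg (fun y => (P y).real (hbE S F)) x from rfl,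
    ← one_step hd hP x (hbE_meas S F)]
  refine real_congr (ae0 hd hP x) fun ω h => ?_
  constructor
  · rintro ⟨j, h1, h2⟩
    rcases j with _ | j
    · exact absurd (h ▸ h1) hx
    · exact ⟨j, by rw [sh_apply, add_comm]; exact h1, fun i hi => by rw [sh_apply]; exact h2 _ (by omega)⟩
  · rintro ⟨j, h1, h2⟩
    refine ⟨1 + j, h1, fun i hi => ?_⟩
    rcases i with _ | i
    · rw [h]; exact hS
    · have := h2 i (by omega); rwa [sh_apply, add_comm] at this

/-- domination by superharmonic functions -/
lemma hb_le_super (hd : 0 < d) (hP : SRW P) {S F : Set (V d)} {w : V d → ℝ} (hw : ∀ x, 0 ≤ w x)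
    (h1 : ∀ x ∈ F, 1 ≤ w x) (hs : ∀ x ∈ S, x ∉ F → avg w x ≤ w x) (x : V d) : hb P S F x ≤ w x := by
  have := fun x => (hP x).1
  set En : ℕ → Set (ℕ → V d) := fun n => {ω | ∃ j ≤ n, ω j ∈ F ∧ ∀ i < j, ω i ∈ S} with hEn
  have hdep : ∀ n, Dep n (· ∈ En n) := by
    intro n ω ω' e
    refine propext (exists_congr fun j => and_congr_right fun hj => ?_)
    rw [e j hj]
    refine and_congr_right fun _ => forall₂_congr fun i hi => ?_
    rw [e i (by omega)]
  have key : ∀ n x, (P x).real (En n) ≤ w x := by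
    intro n
    induction n with
    | zero =>
      intro x
      by_cases hx : x ∈ F
      · exact measureReal_le_one.trans (h1 x hx)
      · refine le_trans (le_of_eq ?_) (hw x)
        rw [← measureReal_empty (μ := P x)]
        refine real_congr (ae0 hd hP x) fun ω h => ?_
        simp only [Set.mem_empty_iff_false, iff_false]
        rintro ⟨j, hj, h2, -⟩
        obtain rfl : j = 0 := by omega
        exact hx (h ▸ h2)
    | succ n ih =>
      intro x
      by_cases hx : x ∈ F
      · exact measureReal_le_one.trans (h1 x hx)
      by_cases hS : x ∈ S
      · refine le_trans ?_ ((avg_mono ih x).trans (hs x hS hx))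
        rw [← one_step hd hP x (hdep n).meas]
        refine real_le (ae0 hd hP x) ?_
        rintro ω h ⟨j, hj, h2, h3⟩
        rcases j with _ | j
        · exact absurd (h ▸ h2) hx
        · exact ⟨j, by omega, by rw [sh_apply, add_comm]; exact h2,
            fun i hi => by rw [sh_apply]; exact h3 _ (by omega)⟩
      · refine le_trans (le_of_eq ?_) (hw x)
        rw [← measureReal_empty (μ := P x)]
        refine real_congr (ae0 hd hP x) fun ω h => ?_
        simp only [Set.mem_empty_iff_false, iff_false]
        rintro ⟨j, hj, h2, h3⟩
        rcases j with _ | j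
        · exact hx (h ▸ h2)
        · exact hS (h ▸ h3 0 (by omega))
  have e : hbE S F = ⋃ n, En n := by
    ext ω
    simp only [Set.mem_iUnion]
    exact ⟨fun ⟨j, h⟩ => ⟨j, j, le_rfl, h⟩, fun ⟨n, j, _, h⟩ => ⟨j, h⟩⟩
  have hmono : Monotone En := fun n n' hn ω ⟨j, hj, h⟩ => ⟨j, hj.trans hn, h⟩
  have ht := tendsto_measure_iUnion_atTop (μ := P x) hmono
  rw [← e] at ht
  have ht2 := (ENNReal.tendsto_toReal (measure_ne_top (P x) (hbE S F))).comp ht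
  exact le_of_tendsto' ht2 fun n => key n x

lemma hb_mono (hP : SRW P) {S S' F F' : Set (V d)} (hS : S ⊆ S') (hF : F ⊆ F') (x : V d) :
    hb P S F x ≤ hb P S' F' x := by
  have := (hP x).1
  exact measureReal_mono fun ω ⟨j, h1, h2⟩ => ⟨j, hF h1, fun i hi => hS (h2 i hi)⟩

lemma hb_cube (hd : 5 ≤ d) (hP : SRW P) (S : Set (V d)) (z : V d) (r : ℕ) (hr : 1 ≤ r) (x : V d) :
    hb P S (cube z r) x ≤ (d + 20) * (r : ℝ) ^ 2 / (nsq (x - z) + 20 * r ^ 2) := by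
  have hr' : (1 : ℝ) ≤ r := by exact_mod_cast hr
  have hA : (20 : ℝ) ≤ 20 * r ^ 2 := by nlinarith
  have hp := fun x => fA_pos (show (0 : ℝ) < 20 * r ^ 2 by linarith) z x
  have key := hb_le_super (by omega) hP (S := S) (F := cube z r)
    (w := fun x => ((d : ℝ) + 20) * r ^ 2 * fA (20 * r ^ 2) z x)
    (fun x => mul_nonneg (by positivity) (hp x).le) ?_ ?_ x
  · refine key.trans (le_of_eq ?_)
    simp only [fA]; ring
  · intro y hy
    have := nsq_le_of_mem hy
    have h0 := nsq_nonneg (y - z)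
    simp only [fA, mul_one_div]
    rw [le_div_iff₀ (by linarith)]
    nlinarith
  · intro y _ _
    rw [avg_smul]
    refine mul_le_mul_of_nonneg_left ?_ (by positivity)
    have := fA_super hd hA z y
    have h0 := nsq_nonneg (y - z)
    have : 0 ≤ (20 * (r : ℝ) ^ 2 + 1) / (nsq (y - z) + 20 * r ^ 2 + 1) ^ 3 := by positivity
    linarith

lemma hb_fin (hd : 5 ≤ d) (hP : SRW P) (S : Set (V d)) (K : Finset (V d)) (x : V d) :
    hb P S ↑K x ≤ ∑ y ∈ K, g0 (x - y) := by
  refine hb_le_super (by omega) hP (w := fun x => ∑ y ∈ K, g0 (x - y))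
    (fun x => Finset.sum_nonneg fun y _ => g0_nonneg _) ?_ ?_ x
  · intro y hy
    refine le_trans ?_ (Finset.single_le_sum (f := fun z => g0 (y - z)) (fun z _ => g0_nonneg _) hy)
    simpa using one_le_g0 hd
  · intro y _ _
    rw [avg_sum]
    refine Finset.sum_le_sum fun z _ => ?_
    rw [avg_shift]; exact g0_super hd _

/-- probability of avoiding `a` until exiting `D` -/
noncomputable def hh (P : V d → Measure (ℕ → V d)) (D a : Set (V d)) (x : V d) : ℝ := 1 - hb P D a x

lemma hh_eq (hP : SRW P) (D a : Set (V d)) (x : V d) : hh P D a x = (P x).real (hbE D a)ᶜ := by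
  have := (hP x).1
  rw [probReal_compl_eq_one_sub (hbE_meas D a)]; rfl

lemma hh_nonneg (hP : SRW P) (D a : Set (V d)) (x : V d) : 0 ≤ hh P D a x := sub_nonneg.2 (hb_le_one hP _ _ _)

lemma hh_le_one (D a : Set (V d)) (x : V d) : hh P D a x ≤ 1 := sub_le_self _ (hb_nonneg _ _ _)

lemma hh_mem (hd : 0 < d) (hP : SRW P) {D a : Set (V d)} {x : V d} (hx : x ∈ a) : hh P D a x = 0 := by
  rw [hh, hb_one hd hP hx, sub_self]

lemma hh_avg (hd : 0 < d) (hP : SRW P) {D a : Set (V d)} {x : V d} (hx : x ∉ a) (hD : x ∈ D) :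
    avg (hh P D a) x = hh P D a x := by
  rw [hh, hb_avg hd hP hx hD]
  rw [show hh P D a = fun y => (fun _ => (1 : ℝ)) y - hb P D a y from rfl, avg_sub, avg_const hd]

lemma hh_super (hd : 0 < d) (hP : SRW P) {D a : Set (V d)} {x : V d} (hx : x ∉ a) :
    avg (hh P D a) x ≤ hh P D a x := by
  by_cases hD : x ∈ D
  · exact (hh_avg hd hP hx hD).le
  · rw [hh, hb_zero hd hP hx hD, sub_zero]
    exact avg_le_of_le hd fun i => ⟨hh_le_one _ _ _, hh_le_one _ _ _⟩

/-- avoiding a larger set -/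
lemma hh_union (hd : 0 < d) (hP : SRW P) {D a K : Set (V d)} {M : ℝ} (hM0 : 0 ≤ M)
    (hM : ∀ z ∈ K, hh P D a z ≤ M) (x : V d) :
    hh P D a x - M * hb P Set.univ K x ≤ hh P D (a ∪ K) x := by
  have := (hP x).1
  have h1 := hbT_le hd hP x D K (hbE_meas D a).compl (M := M)
    (fun z hz => by rw [← hh_eq hP]; exact hM z hz) hM0
  have h2 : (P x).real (hbE D a)ᶜ ≤ (P x).real (hbE D (a ∪ K))ᶜ + (P x).real (hbT D K (hbE D a)ᶜ) := by
    refine (measureReal_mono ?_).trans (measureReal_union_le _ _)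
    intro ω hω
    by_cases h : ω ∈ hbE D (a ∪ K)
    · right
      obtain ⟨j, hj1, hj2⟩ := h
      have hK : ω ∈ hbE D K := by
        rcases hj1 with hj1 | hj1
        · exact absurd ⟨j, hj1, hj2⟩ hω
        · exact ⟨j, hj1, hj2⟩
      rw [hbE_eq] at hK
      obtain ⟨j, hj⟩ := Set.mem_iUnion.1 hK
      refine ⟨j, hj, ?_⟩
      rintro ⟨k, hk1, hk2⟩
      refine hω ⟨j + k, hk1, fun i hi => ?_⟩
      by_cases hij : i < j
      · exact (hj.2 i hij).1
      · obtain ⟨e, rfl⟩ := Nat.exists_eq_add_of_le (not_lt.1 hij)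
        exact hk2 e (by omega)
    · left; exact h
  rw [← hh_eq hP, ← hh_eq hP] at h2
  have h3 := mul_le_mul_of_nonneg_left (hb_mono hP (Set.subset_univ D) (le_refl K) x) hM0
  linarith

end

lemma chain (p q : V d) (K s : ℕ) (hpq : ∀ i, |q i - p i| ≤ (K * s : ℕ)) (Pr : ℕ → V d → Prop)
    (h0 : Pr 0 p)
    (hs : ∀ k x y, (∀ i, min (p i) (q i) ≤ x i ∧ x i ≤ max (p i) (q i)) →
      (∀ i, min (p i) (q i) ≤ y i ∧ y i ≤ max (p i) (q i)) → y ∈ cube x s → Pr k x → Pr (k + 1) y) :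
    Pr K q := by
  set f : ℕ → V d := fun k i => p i + max (-((k * s : ℕ) : ℤ)) (min ((k * s : ℕ) : ℤ) (q i - p i)) with hf
  have hbox : ∀ k i, min (p i) (q i) ≤ f k i ∧ f k i ≤ max (p i) (q i) := by
    intro k i; simp only [hf]; omega
  have key : ∀ k, Pr k (f k) := by
    intro k
    induction k with
    | zero => convert h0; ext i; simp only [hf]; omega
    | succ k ih =>
      refine hs k _ _ (hbox k) (hbox (k + 1)) ?_ ih
      intro i
      have e : (k + 1) * s = k * s + s := by ring
      simp only [hf, e]
      rw [abs_le]
      omega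
  convert key K using 1
  ext i
  have := hpq i
  rw [abs_le] at this
  simp only [hf]; omega

/-- The shell setup. -/
structure Shell (D a : Set (V d)) (N n : ℕ) (x0 : V d) (i0 : Fin d) (sg : ℤ) : Prop where
  sg1 : sg = 1 ∨ sg = -1
  x0i : sg * x0 i0 = n
  x0a : x0 ∈ a
  an : a ⊆ cube 0 n
  ND : cube 0 (4 * N) ⊆ D
  n1 : 1 ≤ n
  nN : n ≤ N

/-- level above the face -/
def lev (n : ℕ) (i0 : Fin d) (sg : ℤ) (z : V d) : ℤ := sg * z i0 - n

noncomputable def lam (d : ℕ) : ℝ := 1 / ((d : ℝ) ^ 2 + 8 * d + 36)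

lemma lam_pos : 0 < lam d := by unfold lam; positivity

lemma lam_le : lam d ≤ 1 := by
  unfold lam; rw [div_le_one (by positivity)]; nlinarith [sq_nonneg (d : ℝ), (Nat.cast_nonneg d : (0 : ℝ) ≤ d)]

lemma Shell.lev_le {D a : Set (V d)} {N n : ℕ} {x0 : V d} {i0 : Fin d} {sg : ℤ} (h : Shell D a N n x0 i0 sg)
    {z : V d} (hz : z ∈ a) : lev n i0 sg z ≤ 0 := by
  have := h.an hz i0
  rw [abs_le] at this
  unfold lev
  simp only [Pi.zero_apply] at this
  rcases h.sg1 with e | e <;> rw [e] <;> omega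

section
variable {P : V d → Measure (ℕ → V d)} {D a : Set (V d)} {N n : ℕ} {x0 : V d} {i0 : Fin d} {sg : ℤ}

lemma hfar (hd : 5 ≤ d) (hP : SRW P) (h : Shell D a N n x0 i0 sg) {z : V d} (hz : z ∉ cube 0 (4 * N)) :
    lam d ≤ hh P D a z := by
  have hn : (1 : ℝ) ≤ n := by exact_mod_cast h.n1
  have hN := h.nN
  rw [mem_cube] at hz; push Not at hz
  obtain ⟨j, hj⟩ := hz
  simp only [Pi.zero_apply, sub_zero] at hj
  obtain ⟨sj, hsj, hj'⟩ : ∃ sj : ℤ, (sj = 1 ∨ sj = -1) ∧ (4 * n : ℤ) ≤ sj * z j := by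
    rcases abs_cases (z j) with ⟨e, _⟩ | ⟨e, _⟩
    · exact ⟨1, Or.inl rfl, by push_cast at hj; omega⟩
    · exact ⟨-1, Or.inr rfl, by push_cast at hj; omega⟩
  have hss : (sj : ℝ) ^ 2 = 1 := by rcases hsj with e | e <;> simp [e]
  set b : V d := fun i => if i = j then -(sj * (d * n)) else 0 with hbb
  have hA : (20 : ℝ) ≤ 20 * n ^ 2 := by nlinarith
  have hp := fun x => fA_pos (show (0 : ℝ) < 20 * n ^ 2 by linarith) b x
  have nsqb : ∀ y : V d, nsq (y - b) = nsq y + 2 * (sj * y j) * (d * n) + (d * n) ^ 2 := by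
    intro y
    have e : nsq (y - b) - nsq y = ∑ i, (if i = j then 2 * (sj * (y j : ℝ)) * (d * n) + (d * n) ^ 2 else 0) := by
      unfold nsq
      rw [← Finset.sum_sub_distrib]
      refine Finset.sum_congr rfl fun i _ => ?_
      by_cases hi : i = j
      · subst hi
        simp only [hbb, Pi.sub_apply, if_true]; push_cast
        linear_combination ((d : ℝ) * n) ^ 2 * hss
      · simp [hbb, hi]
    rw [Finset.sum_ite_eq' Finset.univ j, if_pos (Finset.mem_univ j)] at e
    linarith
  have key := hb_le_super (by omega) hP (S := D) (F := a)
    (w := fun x => ((d : ℝ) ^ 2 + 3 * d + 20) * n ^ 2 * fA (20 * n ^ 2) b x)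
    (fun x => mul_nonneg (by positivity) (hp x).le) ?_ ?_ z
  · have h1 : ((d : ℝ) ^ 2 + 8 * d + 36) * n ^ 2 ≤ nsq (z - b) + 20 * n ^ 2 := by
      have hzj : (4 * n : ℝ) ≤ sj * z j := by exact_mod_cast hj'
      have h2 := sq_le_nsq z j
      have h3 : ((sj : ℝ) * z j) ^ 2 = (z j : ℝ) ^ 2 := by rw [mul_pow, hss, one_mul]
      have h4 : (4 * n : ℝ) ^ 2 ≤ (sj * z j : ℝ) ^ 2 := pow_le_pow_left₀ (by positivity) hzj 2
      have h5 : (4 * n : ℝ) * (d * n) ≤ sj * z j * (d * n) := mul_le_mul_of_nonneg_right hzj (by positivity)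
      rw [nsqb]; nlinarith
    have h2 : ((d : ℝ) ^ 2 + 3 * d + 20) * n ^ 2 * fA (20 * n ^ 2) b z
        ≤ ((d : ℝ) ^ 2 + 3 * d + 20) / ((d : ℝ) ^ 2 + 8 * d + 36) := by
      rw [fA, mul_one_div, div_le_div_iff₀ (lt_of_lt_of_le (by positivity) h1) (by positivity)]
      nlinarith [mul_le_mul_of_nonneg_left h1 (show 0 ≤ (d : ℝ) ^ 2 + 3 * d + 20 by positivity)]
    have h3 : ((d : ℝ) ^ 2 + 3 * d + 20) / ((d : ℝ) ^ 2 + 8 * d + 36) + lam d ≤ 1 := by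
      rw [lam, ← add_div, div_le_one (by positivity)]
      have : (0 : ℝ) ≤ d := by positivity
      linarith
    have : hb P D a z ≤ _ := key.trans h2
    unfold hh; linarith
  · intro y hy
    have hy2 := h.an hy
    have h1 := nsq_le_of_mem (z := 0) hy2
    rw [sub_zero] at h1
    have h2 : (sj : ℝ) * y j ≤ n := by
      have := hy2 j
      rw [abs_le] at this
      simp only [Pi.zero_apply] at this
      have : sj * y j ≤ n := by rcases hsj with e | e <;> rw [e] <;> omega
      exact_mod_cast this
    have h5 : sj * y j * (d * n : ℝ) ≤ n * (d * n) := mul_le_mul_of_nonneg_right h2 (by positivity)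
    have h0 := nsq_nonneg (y - b)
    simp only [fA, mul_one_div]
    rw [le_div_iff₀ (by linarith), nsqb]
    nlinarith
  · intro y _ _
    rw [avg_smul]
    refine mul_le_mul_of_nonneg_left ?_ (by positivity)
    have := fA_super hd hA b y
    have h0 := nsq_nonneg (y - b)
    have : 0 ≤ (20 * (n : ℝ) ^ 2 + 1) / (nsq (y - b) + 20 * n ^ 2 + 1) ^ 3 := by positivity
    linarith

lemma lev_add (hsg : sg = 1 ∨ sg = -1) (z : V d) (i : Fin d) :
    |lev n i0 sg (z + ee i) - lev n i0 sg z| ≤ 1 ∧ |lev n i0 sg (z - ee i) - lev n i0 sg z| ≤ 1 := by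
  have := (add_ee_mem z i).1 i0
  have h2 := (add_ee_mem z i).2 i0
  rw [abs_le] at *
  unfold lev
  push_cast at *
  rw [abs_le]
  rcases hsg with e | e <;> rw [e] <;> omega

/-- Reflected point at level `2s - lev`. -/
def refl' (n : ℕ) (i0 : Fin d) (sg : ℤ) (s : ℕ) (z : V d) : V d := rfl' i0 (sg * (2 * (n + s))) z

lemma lev_refl' (hsg : sg = 1 ∨ sg = -1) (s : ℕ) (z : V d) :
    lev n i0 sg (refl' n i0 sg s z) = 2 * s - lev n i0 sg z := by
  unfold lev refl'
  rw [rfl'_self]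
  rcases hsg with e | e <;> rw [e] <;> ring

lemma reflH (hd : 5 ≤ d) (hP : SRW P) (h : Shell D a N n x0 i0 sg) (s : ℕ) (z : V d)
    (hz : lev n i0 sg z ≤ s) : lam d * hh P D a z ≤ hh P D a (refl' n i0 sg s z) := by
  have hd0 : 0 < d := by omega
  have hN := h.nN
  set u : V d → ℝ := fun z => hh P D a (refl' n i0 sg s z) - lam d * hh P D a z with hu
  set F : Set (V d) := {z | lev n i0 sg z < s ∧ refl' n i0 sg s z ∈ cube 0 (4 * N)} with hF
  have hlh : ∀ z, lam d * hh P D a z ≤ lam d := fun z =>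
    mul_le_of_le_one_right lam_pos.le (hh_le_one _ _ _)
  have hbd : ∀ z, lev n i0 sg z ≤ s → z ∉ F → 0 ≤ u z := by
    intro z h1 h2
    rcases h1.lt_or_eq with h1 | h1
    · have : refl' n i0 sg s z ∉ cube 0 (4 * N) := fun hc => h2 ⟨h1, hc⟩
      have h3 := hfar hd hP h this
      have h4 := hlh z
      simp only [hu]; linarith
    · have e : refl' n i0 sg s z = z := by
        ext i
        by_cases hi : i = i0
        · subst hi
          unfold refl'; rw [rfl'_self]
          unfold lev at h1
          rcases h.sg1 with e | e <;> rw [e] at h1 ⊢ <;> omega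
        · exact rfl'_ne hi _ _
      simp only [hu, e]
      nlinarith [hh_nonneg hP D a z, lam_le (d := d)]
  have hFfin : F.Finite := by
    refine Set.Finite.subset ((cube_finite 0 (4 * N)).image (refl' n i0 sg s)) ?_
    rintro z ⟨-, h2⟩
    exact ⟨_, h2, rfl'_rfl' _ _ _⟩
  have main : ∀ z ∈ F, 0 ≤ u z := by
    refine minP_loc hd0 u F hFfin ?_ ?_
    · rintro z ⟨h1, h2⟩
      have hl := lev_refl' (n := n) (i0 := i0) h.sg1 s z
      have e1 : avg (fun y => hh P D a (refl' n i0 sg s y)) z = hh P D a (refl' n i0 sg s z) := by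
        unfold refl'
        rw [avg_rfl' i0 _ (hh P D a)]
        refine hh_avg hd0 hP (fun hc => ?_) (h.ND h2)
        have := h.lev_le hc
        change lev n i0 sg (refl' n i0 sg s z) ≤ 0 at this
        omega
      have e2 : hh P D a z ≤ avg (hh P D a) z := by
        by_cases hza : z ∈ a
        · rw [hh_mem hd0 hP hza]; exact avg_nonneg (hh_nonneg hP D a) z
        · refine (hh_avg hd0 hP hza (h.ND fun i => ?_)).ge
          have h3 := h2 i
          by_cases hi : i = i0
          · subst hi
            unfold refl' at h3
            unfold lev at h1
            rw [rfl'_self] at h3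
            simp only [Pi.zero_apply, sub_zero] at *
            rw [abs_le] at *
            rcases h.sg1 with e | e <;> rw [e] at h1 h3 <;> omega
          · unfold refl' at h3
            rwa [rfl'_ne hi] at h3
      simp only [hu]
      rw [avg_sub, avg_smul, e1]
      nlinarith [lam_pos (d := d)]
    · rintro z ⟨h1, -⟩ i
      have := lev_add (n := n) (i0 := i0) h.sg1 z i
      rw [abs_le, abs_le] at this
      exact ⟨fun hc => hbd _ (by omega) hc, fun hc => hbd _ (by omega) hc⟩
  have : 0 ≤ u z := by
    by_cases hc : z ∈ F
    · exact main z hc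
    · exact hbd z hz hc
  simp only [hu] at this; linarith

end

lemma CH (hd : 5 ≤ d) : ∃ C : ℝ, 1 ≤ C ∧ ∀ (P : V d → Measure (ℕ → V d)) (D a : Set (V d)) (N n m : ℕ)
    (x0 : V d) (i0 : Fin d) (sg : ℤ), SRW P → Shell D a N n x0 i0 sg → 40 * d < m → n + 8 * m ≤ 4 * N →
    ∀ z ∈ cube x0 m, ∀ q : V d, (∀ i, i ≠ i0 → |q i - x0 i| ≤ m) → (m : ℤ) ≤ 4 * lev n i0 sg q →
      lev n i0 sg q ≤ 5 * m → hh P D a z ≤ C * hh P D a q := by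
  obtain ⟨C, hC1, hC⟩ := harnack hd
  have hd0 : 0 < d := by omega
  refine ⟨1 / lam d * C ^ (400 * d), ?_, ?_⟩
  · exact one_le_mul_of_one_le_of_one_le ((one_le_div lam_pos).2 lam_le) (one_le_pow₀ hC1)
  intro P D a N n m x0 i0 sg hP h hm hmN z hz q hq1 hq2 hq3
  set R := (m - 1) / (20 * d) with hR
  have hR1 : 20 * d * R < m := by
    have := Nat.mul_div_le (m - 1) (20 * d); rw [← hR] at this; omega
  have hR2 : m ≤ 20 * d * (R + 1) := by
    have := Nat.lt_mul_div_succ (m - 1) (show 0 < 20 * d by omega)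
    rw [← hR] at this; omega
  have hR3 : 2 ≤ R := by
    rw [hR, Nat.le_div_iff_mul_le (by omega)]; omega
  set s := R / 2 with hs
  have hs1 : R + 1 ≤ 4 * s := by omega
  have hKs : 5 * m ≤ 400 * d * s := by
    calc 5 * m ≤ 5 * (20 * d * (R + 1)) := by omega
      _ ≤ 5 * (20 * d * (4 * s)) := by gcongr
      _ = 400 * d * s := by ring
  set p := refl' n i0 sg (2 * m) z with hp
  have hlz : |lev n i0 sg z| ≤ m := by
    have := hz i0
    have e := h.x0i
    unfold lev
    rw [abs_le] at *
    rcases h.sg1 with e' | e' <;> rw [e'] at e ⊢ <;> omega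
  rw [abs_le] at hlz
  have hlp : lev n i0 sg p = 4 * m - lev n i0 sg z := by
    rw [hp, lev_refl' h.sg1]; push_cast; ring
  have hpi : ∀ i, i ≠ i0 → p i = z i := fun i hi => rfl'_ne hi _ _
  have h1 := reflH hd hP h (2 * m) z (by push_cast; omega)
  rw [← hp] at h1
  have h2 : hh P D a p ≤ C ^ (400 * d) * hh P D a q := by
    refine chain p q (400 * d) s (fun i => ?_) (fun k x => hh P D a p ≤ C ^ k * hh P D a x) (by simp) ?_
    · refine le_trans ?_ (show ((5 * m : ℕ) : ℤ) ≤ _ by exact_mod_cast hKs)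
      by_cases hi : i = i0
      · subst hi
        unfold lev at *
        rw [abs_le]; push_cast
        rcases h.sg1 with e | e <;> simp only [e] at hlp hlz hq2 hq3 <;> omega
      · have h3 := hz i
        have h4 := hq1 i hi
        rw [hpi i hi]
        rw [abs_le] at *; push_cast; omega
    · intro k x y _ hy hyx hk
      refine hk.trans ?_
      rw [pow_succ, mul_assoc]
      refine mul_le_mul_of_nonneg_left ?_ (by positivity)
      refine hC R (by omega) (hh P D a) y (hh_nonneg hP D a) (fun w hw => ?_) x (mem_cube_comm.1 hyx)
      have h5 : (((5 * d * R : ℕ) : ℤ)) * 4 < m := by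
        have : 5 * d * R * 4 < m := by linarith
        exact_mod_cast this
      refine hh_avg hd0 hP (fun hc => ?_) (h.ND fun i => ?_)
      · have h6 := h.lev_le hc
        have h7 := hy i0
        have h8 := hw i0
        unfold lev at *
        rw [abs_le] at *
        rcases h.sg1 with e | e <;> simp only [e] at * <;> omega
      · have h6 := h.an h.x0a i
        have h7 := hy i
        have h8 := hw i
        have h9 := hz i
        rw [Pi.zero_apply, sub_zero] at *
        by_cases hi : i = i0
        · subst hi
          unfold lev at *
          rw [abs_le] at *; push_cast at *
          rcases h.sg1 with e | e <;> simp only [e] at * <;> omega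
        · have h10 := hq1 i hi
          rw [hpi i hi] at h7
          rw [abs_le] at *; push_cast at *; omega
  have h3 : hh P D a z ≤ 1 / lam d * hh P D a p := by
    rw [one_div, ← div_eq_inv_mul, le_div_iff₀ lam_pos]; linarith
  calc _ ≤ 1 / lam d * hh P D a p := h3
    _ ≤ 1 / lam d * (C ^ (400 * d) * hh P D a q) :=
        mul_le_mul_of_nonneg_left h2 (one_div_pos.2 lam_pos).le
    _ = _ := by ring

/-- the starting box -/
def box (n : ℕ) (x0 : V d) (i0 : Fin d) (sg : ℤ) (l : ℕ) : Set (V d) :=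
  {z | |lev n i0 sg z| ≤ l ∧ ∀ i, i ≠ i0 → |z i - x0 i| ≤ (2 * d * l : ℕ)}

/-- its right face -/
def gface (n : ℕ) (x0 : V d) (i0 : Fin d) (sg : ℤ) (l : ℕ) : Set (V d) :=
  {z | lev n i0 sg z = l + 1 ∧ ∀ i, i ≠ i0 → |z i - x0 i| ≤ (2 * d * l : ℕ)}

section
variable {P : V d → Measure (ℕ → V d)} {D a : Set (V d)} {N n : ℕ} {x0 : V d} {i0 : Fin d} {sg : ℤ}

lemma Shell.lev_eq (h : Shell D a N n x0 i0 sg) (z : V d) : lev n i0 sg z = sg * (z i0 - x0 i0) := by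
  have := h.x0i; unfold lev; rw [← this]; ring

lemma box_sub (h : Shell D a N n x0 i0 sg) (l : ℕ) : box n x0 i0 sg l ⊆ cube x0 (2 * d * l) := by
  rintro z ⟨h1, h2⟩ i
  by_cases hi : i = i0
  · subst hi
    rw [h.lev_eq] at h1
    have hd : 0 < d := i.pos
    have : (l : ℤ) ≤ (2 * d * l : ℕ) := by exact_mod_cast Nat.le_mul_of_pos_left l (by omega)
    rw [abs_le] at *
    rcases h.sg1 with e | e <;> rw [e] at h1 <;> omega
  · exact h2 i hi

lemma barrier (hd : 5 ≤ d) (hP : SRW P) (h : Shell D a N n x0 i0 sg) {l : ℕ} (hl : 1 ≤ l) :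
    avg (hb P (box n x0 i0 sg l \ a) (box n x0 i0 sg l ∪ gface n x0 i0 sg l)ᶜ) x0
      ≤ 8 * d * avg (hb P (box n x0 i0 sg l \ a) (gface n x0 i0 sg l)) x0 := by
  have hd0 : 0 < d := by omega
  set U := box n x0 i0 sg l with hU
  set Fg := gface n x0 i0 sg l with hFg
  set vg := hb P (U \ a) Fg with hvg
  set vb := hb P (U \ a) (U ∪ Fg)ᶜ with hvb
  have hlr : (1 : ℝ) ≤ l := by exact_mod_cast hl
  have hdr : (5 : ℝ) ≤ d := by exact_mod_cast hd
  have hs2 : (sg : ℝ) ^ 2 = 1 := by rcases h.sg1 with e | e <;> simp [e]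
  set ψ : V d → ℝ := fun x => d * (l + 1) * (lev n i0 sg x : ℝ) + d * (lev n i0 sg x : ℝ) ^ 2 - nsq (x - x0) with hψ
  have avgψ : ∀ x, avg ψ x = ψ x := by
    intro x
    have e : ∀ y, ψ y = (-(d * (l + 1) * n) + d * n ^ 2 : ℝ) + (d * (l + 1) * sg - 2 * d * n * sg) * (y i0 : ℝ)
        + d * (y i0 : ℝ) ^ 2 + (-1) * nsq (y - x0) := by
      intro y; simp only [hψ, lev]; push_cast
      linear_combination (d : ℝ) * (y i0 : ℝ) ^ 2 * hs2
    rw [show ψ = _ from funext e, avg_quad hd0]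
    have : (d : ℝ) ≠ 0 := by positivity
    field_simp; ring
  have nsqlev : ∀ y, (lev n i0 sg y : ℝ) ^ 2 ≤ nsq (y - x0) := by
    intro y
    refine le_trans (le_of_eq ?_) (sq_le_nsq (y - x0) i0)
    rw [h.lev_eq]; push_cast
    rw [mul_pow, hs2]; simp
  set w : V d → ℝ := fun x => 2 * d * (l + 1) ^ 2 * vg x - l ^ 2 * vb x - ψ x with hw
  have avgw : ∀ x, avg w x = 2 * d * (l + 1) ^ 2 * avg vg x - l ^ 2 * avg vb x - ψ x := by
    intro x
    rw [hw, avg_sub, avg_sub, avg_smul, avg_smul, avgψ]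
  have hUg : Disjoint U Fg := by
    rw [Set.disjoint_left]; rintro y ⟨h1, -⟩ ⟨h2, -⟩
    rw [abs_le] at h1; omega
  have hbd : ∀ y, |lev n i0 sg y| ≤ l + 1 → y ∉ U \ a → 0 ≤ w y := by
    intro y hy hyU
    have hn := nsqlev y
    rw [abs_le] at hy
    set t : ℝ := (lev n i0 sg y : ℝ) with ht
    by_cases h1 : y ∈ U
    · have hya : y ∈ a := by by_contra hc; exact hyU ⟨h1, hc⟩
      have e1 : vg y = 0 := hb_zero hd0 hP (fun hc => Set.disjoint_left.1 hUg h1 hc) hyU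
      have e2 : vb y = 0 := hb_zero hd0 hP (fun hc => hc (Or.inl h1)) hyU
      have h3 : t ≤ 0 := by rw [ht]; exact_mod_cast h.lev_le hya
      have h4 : -(l + 1 : ℝ) ≤ t := by rw [ht]; exact_mod_cast hy.1
      simp only [hw, e1, e2, hψ]
      rw [← ht]
      nlinarith [mul_nonneg (neg_nonneg.2 h3) (show 0 ≤ (l + 1 : ℝ) + t by linarith)]
    by_cases h2 : y ∈ Fg
    · have e1 : vg y = 1 := hb_one hd0 hP h2
      have e2 : vb y = 0 := hb_zero hd0 hP (fun hc => hc (Or.inr h2)) hyU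
      have h4 : t = l + 1 := by rw [ht, h2.1]; push_cast; ring
      simp only [hw, e1, e2, hψ]
      rw [← ht, h4] at *
      nlinarith [sq_nonneg (l + 1 : ℝ)]
    · have e1 : vg y = 0 := hb_zero hd0 hP h2 hyU
      have e2 : vb y = 1 := hb_one hd0 hP (fun hc => hc.elim h1 h2)
      simp only [hw, e1, e2, hψ]
      rw [← ht]
      by_cases h3 : ∀ i, i ≠ i0 → |y i - x0 i| ≤ (2 * d * l : ℕ)
      · have h4 : lev n i0 sg y = -(l + 1) := by
          by_contra hc
          by_cases h5 : lev n i0 sg y = l + 1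
          · exact h2 ⟨h5, h3⟩
          · exact h1 ⟨by rw [abs_le]; omega, h3⟩
        have h5 : t = -(l + 1) := by rw [ht, h4]; push_cast; ring
        rw [h5] at hn ⊢
        nlinarith [sq_nonneg (l + 1 : ℝ), (Nat.cast_nonneg l : (0:ℝ) ≤ l)]
      · push Not at h3
        obtain ⟨i, -, hi⟩ := h3
        have h5 : (2 * d * l : ℝ) ^ 2 ≤ nsq (y - x0) := by
          refine le_trans ?_ (sq_le_nsq (y - x0) i)
          rw [Pi.sub_apply, ← sq_abs ((y i - x0 i : ℤ) : ℝ), ← Int.cast_abs]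
          exact pow_le_pow_left₀ (by positivity) (by exact_mod_cast hi.le) 2
        have h6 : t ≤ l + 1 := by rw [ht]; exact_mod_cast hy.2
        have h7 : -(l + 1 : ℝ) ≤ t := by rw [ht]; exact_mod_cast hy.1
        have h8 : t ^ 2 ≤ (l + 1 : ℝ) ^ 2 := sq_le_sq' h7 h6
        have h9 : (l + 1 : ℝ) ^ 2 ≤ 4 * l ^ 2 := by nlinarith
        have h10 : d * (l + 1) * t + d * t ^ 2 ≤ 8 * d * (l : ℝ) ^ 2 := by
          have : (l + 1) * t + t ^ 2 ≤ 8 * (l : ℝ) ^ 2 := by nlinarith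
          nlinarith
        have h11 : 20 * d * (l : ℝ) ^ 2 ≤ (2 * d * l : ℝ) ^ 2 := by
          have : (0 : ℝ) ≤ d * (l : ℝ) ^ 2 := by positivity
          nlinarith
        nlinarith [sq_nonneg (l : ℝ)]
  have main : ∀ x ∈ U \ a, 0 ≤ w x := by
    refine minP_loc hd0 w (U \ a) (((cube_finite _ _).subset (box_sub h l)).subset Set.sdiff_subset) ?_ ?_
    · intro x hx
      rw [avgw]
      have e1 : vg x = avg vg x := hb_avg hd0 hP (fun hc => Set.disjoint_left.1 hUg hx.1 hc) hx
      have e2 : vb x = avg vb x := hb_avg hd0 hP (fun hc => hc (Or.inl hx.1)) hx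
      rw [← e1, ← e2]
    · intro x hx i
      have h1 := hx.1.1
      have h2 := lev_add (n := n) (i0 := i0) h.sg1 x i
      rw [abs_le] at h1
      rw [abs_le, abs_le] at h2
      exact ⟨fun hc => hbd _ (by rw [abs_le]; omega) hc, fun hc => hbd _ (by rw [abs_le]; omega) hc⟩
  have hx0 : lev n i0 sg x0 = 0 := by rw [h.lev_eq]; ring
  have key : 0 ≤ avg w x0 := by
    refine le_avg_of_le hd0 fun i => ?_
    have h2 := lev_add (n := n) (i0 := i0) h.sg1 x0 i
    rw [hx0, abs_le, abs_le] at h2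
    constructor
    · by_cases hc : x0 + ee i ∈ U \ a
      · exact main _ hc
      · exact hbd _ (by rw [abs_le]; omega) hc
    · by_cases hc : x0 - ee i ∈ U \ a
      · exact main _ hc
      · exact hbd _ (by rw [abs_le]; omega) hc
  rw [avgw] at key
  have hψ0 : ψ x0 = 0 := by simp [hψ, hx0, nsq]
  have hg : 0 ≤ avg vg x0 := avg_nonneg (hb_nonneg _ _) x0
  have h9 : (l + 1 : ℝ) ^ 2 ≤ 4 * l ^ 2 := by nlinarith
  have h10 : (l : ℝ) ^ 2 * avg vb x0 ≤ l ^ 2 * (8 * d * avg vg x0) := by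
    have : 2 * d * (l + 1 : ℝ) ^ 2 * avg vg x0 ≤ 2 * d * (4 * l ^ 2) * avg vg x0 := by gcongr
    linarith
  exact le_of_mul_le_mul_left h10 (by positivity)

/-! ### capacity -/

lemma gp_visit (hd : 5 ≤ d) (hP : SRW P) (x u : V d) :
    ∑' t, P x {ω | ω t = u} = ENNReal.ofReal (g0 (x - u)) := by
  have := (hP x).1
  obtain ⟨W, hW⟩ := dom_fin hd (Set.finite_singleton u)
  rw [g0_shift, Gp, ENNReal.ofReal_tsum_of_nonneg (fun t => it_nonneg (ind_nonneg _) _ _) (hW.summable x)]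
  refine tsum_congr fun t => ?_
  rw [← prob_it (by omega) hP, measureReal_def, ENNReal.ofReal_toReal (measure_ne_top _ _)]
  simp

lemma transient (hd : 5 ≤ d) (hP : SRW P) (x : V d) : ∀ᵐ ω ∂(P x), ∀ u : V d, {j | ω j = u}.Finite := by
  rw [ae_all_iff]
  intro u
  have := measure_setOfPred_frequently_eq_zero (μ := P x) (p := fun j ω => ω j = u)
    (by rw [gp_visit hd hP]; exact ENNReal.ofReal_ne_top)
  refine (measure_eq_zero_iff_ae_notMem.1 this).mono fun ω hω => ?_
  rw [← Set.not_infinite, ← Nat.frequently_atTop_iff_infinite]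
  exact hω

/-- escape event -/
def esc (B : Set (V d)) : Set (ℕ → V d) := {ω | ∀ j : ℕ, 1 ≤ j → ω j ∉ B}

lemma esc_meas (B : Set (V d)) : MeasurableSet (esc B) := by
  have : esc B = ⋂ j : ℕ, {ω : ℕ → V d | 1 ≤ j → ω j ∉ B} := by ext ω; simp [esc]
  rw [this]
  refine MeasurableSet.iInter fun j => Dep.meas (n := j) fun ω ω' e => ?_
  simp [e j le_rfl]

lemma cap_eq (s : Finset (V d)) : capacity P (s : Set (V d)) = ∑ u ∈ s, (P u).real (esc (s : Set (V d))) := by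
  unfold capacity
  exact Finset.tsum_subtype s fun u => (P u).real (esc (s : Set (V d)))

lemma last_exit (hd : 5 ≤ d) (hP : SRW P) (s : Finset (V d)) {x : V d} (hx : x ∈ s) :
    1 ≤ ∑ u ∈ s, g0 (x - u) * (P u).real (esc (s : Set (V d))) := by
  have := fun x => (hP x).1
  set E := esc (s : Set (V d)) with hE
  have h1 : (1 : ℝ≥0∞) ≤ ∑ u ∈ s, ENNReal.ofReal (g0 (x - u)) * P u E := by
    calc (1 : ℝ≥0∞) = P x Set.univ := measure_univ.symm
      _ ≤ P x (⋃ t, ⋃ u ∈ s, {ω | ω ∈ {ω | ω t = u} ∧ sh t ω ∈ E}) := by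
        refine measure_mono_ae (((ae0 (by omega) hP x).and (transient hd hP x)).mono ?_)
        rintro ω ⟨h0, hω⟩ -
        have hfin : {j | ω j ∈ s}.Finite := by
          refine (s.finite_toSet.biUnion fun u _ => hω u).subset fun j hj => ?_
          exact Set.mem_biUnion (show ω j ∈ (s : Set (V d)) from hj) rfl
        have hne : {j | ω j ∈ s}.Nonempty := ⟨0, show ω 0 ∈ s by rw [h0]; exact hx⟩
        obtain ⟨t, ht, hmax⟩ := Set.exists_max_image _ id hfin hne
        refine Set.mem_iUnion.2 ⟨t, Set.mem_iUnion₂.2 ⟨ω t, ht, rfl, fun j hj hc => ?_⟩⟩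
        have := hmax (t + j) hc
        simp only [id] at this; omega
      _ ≤ ∑' t, ∑ u ∈ s, P x {ω | ω ∈ {ω | ω t = u} ∧ sh t ω ∈ E} :=
        (measure_iUnion_le _).trans (ENNReal.tsum_le_tsum fun t => measure_biUnion_finset_le _ _)
      _ ≤ ∑' t, ∑ u ∈ s, P u E * P x {ω | ω t = u} := by
        refine ENNReal.tsum_le_tsum fun t => Finset.sum_le_sum fun u _ => ?_
        refine mk_le (by omega) hP (hP x) (fun ω ω' e => ?_) (R := fun _ => E) (fun _ _ _ => rfl)
          (fun _ => esc_meas _) ?_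
        · simp [e t le_rfl]
        · intro ω hω; rw [show ω t = u from hω]
      _ = ∑ u ∈ s, ENNReal.ofReal (g0 (x - u)) * P u E := by
        rw [Summable.tsum_finsetSum fun _ _ => ENNReal.summable]
        refine Finset.sum_congr rfl fun u _ => ?_
        rw [ENNReal.tsum_mul_left, gp_visit hd hP, mul_comm]
  have h2 := ENNReal.toReal_mono (ENNReal.sum_ne_top.2 fun u _ =>
    ENNReal.mul_ne_top ENNReal.ofReal_ne_top (measure_ne_top _ _)) h1
  rw [ENNReal.toReal_one, ENNReal.toReal_sum fun u _ =>
    ENNReal.mul_ne_top ENNReal.ofReal_ne_top (measure_ne_top _ _)] at h2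
  refine h2.trans (le_of_eq (Finset.sum_congr rfl fun u _ => ?_))
  rw [ENNReal.toReal_mul, ENNReal.toReal_ofReal (g0_nonneg _)]; rfl

lemma cap_ge (hd : 5 ≤ d) (hP : SRW P) {B : Set (V d)} (hB : B.Finite) (s : Finset (V d)) (hs : (s : Set (V d)) ⊆ B)
    {K : ℝ} (hK : 0 ≤ K) (h : ∀ x ∈ s, ∑ y ∈ s, g0 (x - y) ≤ K) : (s.card : ℝ) ≤ K * capacity P B := by
  lift B to Finset (V d) using hB
  rw [cap_eq, Finset.mul_sum, Finset.cast_card]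
  calc ∑ x ∈ s, (1 : ℝ) ≤ ∑ x ∈ s, ∑ u ∈ B, g0 (x - u) * (P u).real (esc (B : Set (V d))) :=
        Finset.sum_le_sum fun x hx => last_exit hd hP B (hs hx)
    _ = ∑ u ∈ B, (∑ x ∈ s, g0 (u - x)) * (P u).real (esc (B : Set (V d))) := by
        rw [Finset.sum_comm]
        refine Finset.sum_congr rfl fun u _ => ?_
        rw [Finset.sum_mul]
        refine Finset.sum_congr rfl fun x _ => ?_
        rw [← g0_neg (u - x), neg_sub]
    _ ≤ _ := Finset.sum_le_sum fun u _ =>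
        mul_le_mul_of_nonneg_right (pot_max hd s hK h u) measureReal_nonneg

lemma cap_le (hP : SRW P) {B : Set (V d)} (s : Finset (V d)) (hs : B ⊆ s) : capacity P B ≤ s.card := by
  have := fun x => (hP x).1
  lift B to Finset (V d) using s.finite_toSet.subset hs
  rw [cap_eq]
  calc _ ≤ ∑ _u ∈ B, (1 : ℝ) := Finset.sum_le_sum fun u _ => measureReal_le_one
    _ = B.card := by simp
    _ ≤ s.card := by exact_mod_cast Finset.card_le_card (by exact_mod_cast hs)

end

section
variable {P : V d → Measure (ℕ → V d)}

lemma Dom.sub {B B' : Set (V d)} {φ W : V d → ℝ} (h : Dom B φ W) (hB : B' ⊆ B) : Dom B' φ W :=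
  ⟨h.nn, h.W0, fun x hx => h.sup x (hB hx)⟩

/-- lower bound for the Green potential of a small cube -/
lemma gpL (hd : 5 ≤ d) (K : ℕ) : ∃ c : ℝ, 0 < c ∧ ∀ (x1 y : V d) (s : ℕ) (Vs : Set (V d)),
    2 * d ≤ s → (∀ i, |y i - x1 i| ≤ (K * s : ℕ)) →
    (∀ z : V d, (∀ i, min (x1 i) (y i) ≤ z i ∧ z i ≤ max (x1 i) (y i)) → cube z (3 * d * s) ⊆ Vs) →
    c * (s : ℝ) ^ 2 ≤ Gp Vs (ind (cube x1 (2 * s))) y := by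
  obtain ⟨b, hpg⟩ := polyGrowth hd
  have hd0 : 0 < d := by omega
  have hdR : (5 : ℝ) ≤ d := by exact_mod_cast hd
  set q : ℝ := (1 / (4 * (1 + d))) ^ b with hq
  refine ⟨3 * q ^ K, by positivity, ?_⟩
  intro x1 y s Vs hs hxy hbox
  have hsR : (2 * d : ℝ) ≤ s := by exact_mod_cast hs
  have hs0 : (0 : ℝ) < s := by linarith
  set u := Gp Vs (ind (cube x1 (2 * s))) with hu
  have hs1 : 1 ≤ 2 * s := by omega
  have hdom := (dom_cube hd x1 (2 * s) hs1).sub (Set.subset_univ Vs)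
  have hu0 : ∀ x, 0 ≤ u x := Gp_nonneg (ind_nonneg _)
  have hsup : ∀ x ∈ Vs, avg u x ≤ u x := fun x hx => by
    have := hdom.eqn hx
    have h2 := ind_nonneg (cube x1 (2 * s)) x
    rw [← hu] at this; linarith
  have hV1 : cube x1 (2 * s) ⊆ Vs :=
    (cube_mono (by nlinarith)).trans (hbox x1 fun i => ⟨min_le_left _ _, le_max_left _ _⟩)
  have base : ∀ x, nsq (x - x1) ≤ (s : ℝ) ^ 2 → 3 * (s : ℝ) ^ 2 ≤ u x := by
    set F : Set (V d) := {x | nsq (x - x1) < 4 * (s : ℝ) ^ 2}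
    have hFc : F ⊆ cube x1 (2 * s) := fun x hx => by
      by_contra hc
      have := nsq_ge_of_not_mem hc
      push_cast at this
      have hx' : nsq (x - x1) < 4 * (s : ℝ) ^ 2 := hx
      nlinarith
    have := minP_fin hd0 (fun x => u x - (4 * (s : ℝ) ^ 2 - nsq (x - x1))) F
      ((cube_finite x1 (2 * s)).subset hFc) (fun x hx => by
        rw [avg_sub, avg_sub, avg_const hd0, avg_nsq hd0]
        have e := hdom.eqn (hV1 (hFc hx))
        rw [ind_of_mem (hFc hx), ← hu] at e
        linarith) (fun x hx => by
        have : ¬ (nsq (x - x1) < 4 * (s : ℝ) ^ 2) := hx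
        have := hu0 x
        linarith)
    intro x hx
    have := this x
    linarith
  have := chain x1 y K s hxy
    (fun k x => ∀ x', nsq (x' - x) ≤ (s : ℝ) ^ 2 → 3 * (s : ℝ) ^ 2 * q ^ k ≤ u x')
    (by simpa using base) (by
      intro k x z hx hz hzx h x' hx'
      have hT : (s : ℝ) ^ 2 / (2 * (2 * (1 + d) * s ^ 2)) = 1 / (4 * (1 + d)) := by
        field_simp; norm_num
      have h3 : nsq (x' - x) ≤ 2 * (1 + d) * (s : ℝ) ^ 2 := by
        have h4 : nsq (x' - x) ≤ 2 * nsq (x' - z) + 2 * nsq (z - x) := by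
          simp only [nsq, Finset.mul_sum, ← Finset.sum_add_distrib]
          refine Finset.sum_le_sum fun i _ => ?_
          simp only [Pi.sub_apply]; push_cast
          nlinarith [sq_nonneg ((x' i : ℝ) - z i - (z i - x i))]
        have h5 := nsq_le_of_mem hzx
        nlinarith
      have := hpg u x ((s : ℝ) ^ 2) (2 * (1 + d) * (s : ℝ) ^ 2) (3 * (s : ℝ) ^ 2 * q ^ k)
        (by nlinarith) (by nlinarith [sq_nonneg (s : ℝ)]) (by positivity) hu0 (fun w hw => by
          refine hsup w (hbox x hx ?_)
          by_contra hc
          have h6 := nsq_ge_of_not_mem hc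
          push_cast at h6
          have : (6 * (1 + d)) * (s : ℝ) ^ 2 ≤ (9 * d ^ 2) * (s : ℝ) ^ 2 := by
            apply mul_le_mul_of_nonneg_right _ (sq_nonneg _); nlinarith
          have h7 : (0 : ℝ) ≤ 3 * d * s := by positivity
          nlinarith) h x' h3
      rw [hT] at this
      rw [pow_succ]; calc _ = 3 * (s : ℝ) ^ 2 * q ^ k * q := by ring
        _ ≤ _ := this)
  have h := this y (by simp [nsq])
  calc _ = 3 * (s : ℝ) ^ 2 * q ^ K := by ring
    _ ≤ _ := h

lemma it_anti (hd : 0 < d) (B : Set (V d)) (t : ℕ) (x : V d) :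
    it B (fun _ => 1) (t + 1) x ≤ it B (fun _ => 1) t x := by
  induction t generalizing x with
  | zero =>
    simp only [it]
    split_ifs
    · refine avg_le_of_le hd fun i => ⟨?_, ?_⟩ <;> split_ifs <;> norm_num
    · exact le_rfl
  | succ t ih =>
    rw [it, it]
    dsimp only
    split_ifs
    · exact avg_mono ih x
    · exact le_rfl

lemma Dom.split {B : Set (V d)} {φ W : V d → ℝ} (h : Dom B φ W) (T : ℕ) (x : V d) :
    Gp B φ x = ∑ t ∈ Finset.range T, it B φ t x + it B (Gp B φ) T x := by
  have key : ∀ T x, it B (Gp B φ) T x = it B φ T x + it B (Gp B φ) (T + 1) x := by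
    intro T
    induction T with
    | zero =>
      intro x
      simp only [it]
      by_cases hx : x ∈ B
      · simp only [hx, if_true]
        rw [h.eqn hx]
        congr 1
        refine avg_congr' fun i => ⟨?_, ?_⟩ <;> split_ifs with h1 <;> first | rfl | exact Gp_off h1
      · simp [hx]
    | succ T ih =>
      intro x
      rw [it, it, it]
      dsimp only
      split_ifs
      · rw [← avg_add]
        congr 1
        funext y; exact ih y
      · simp
  induction T with
  | zero =>
    simp only [Finset.range_zero, Finset.sum_empty, zero_add, it]
    split_ifs with h1
    · rfl
    · exact Gp_off h1
  | succ T ih => rw [Finset.sum_range_succ, ih, key]; ring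

/-- truncation of the Green potential in time -/
lemma gp_trunc (hd : 5 ≤ d) {Vs A0 : Set (V d)} {x1 : V d} {R : ℕ} (hR : 1 ≤ R) (hV : Vs ⊆ cube x1 R)
    (hA : A0 ⊆ cube x1 R) (T : ℕ) (hT : 0 < T) (y : V d) :
    Gp Vs (ind A0) y ≤ ∑ t ∈ Finset.range T, it Vs (ind A0) t y
      + (((d : ℝ) + 21) ^ 3 * R ^ 2) ^ 2 / T := by
  have hd0 : 0 < d := by omega
  have hle : ∀ x, ind A0 x ≤ ind (cube x1 R) x := fun x => by
    by_cases h : x ∈ A0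
    · rw [ind_of_mem h, ind_of_mem (hA h)]
    · rw [ind_of_not_mem h]; exact ind_nonneg _ _
  have hD := dom_cube hd x1 R hR
  have hdom : Dom Vs (ind A0) _ :=
    ⟨ind_nonneg _, hD.W0, fun x _ => (add_le_add_left (hle x) _).trans (hD.sup x trivial)⟩
  rw [hdom.split T y]
  set C := ((d : ℝ) + 21) ^ 3 * R ^ 2
  have hC : 0 ≤ C := by positivity
  have hT' : (0 : ℝ) < T := by exact_mod_cast hT
  have h1 : it Vs (Gp Vs (ind A0)) T y ≤ C * it Vs (fun _ => 1) T y := by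
    rw [← it_smul]
    refine it_mono subset_rfl (fun x => by simpa using hC) (fun x _ => ?_) T y
    rw [mul_one]
    exact (hdom.gp_mono hD (Set.subset_univ _) (fun x _ => hle x) x).trans (gp_cube hd x1 R hR x)
  have h2 : T * it Vs (fun _ => 1) T y ≤ C := by
    have h3 : ∑ t ∈ Finset.range T, it Vs (fun _ => 1) T y ≤ ∑ t ∈ Finset.range T, it Set.univ (ind (cube x1 R)) t y := by
      refine Finset.sum_le_sum fun t ht => ?_
      have ha : Antitone fun t => it Vs (fun _ => 1) t y := antitone_nat_of_succ_le fun t => it_anti hd0 Vs t y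
      refine (ha (Finset.mem_range.1 ht).le).trans ?_
      exact it_mono (Set.subset_univ _) (ind_nonneg _) (fun x hx => by rw [ind_of_mem (hV hx)]) t y
    rw [Finset.sum_const, Finset.card_range, nsmul_eq_mul] at h3
    refine h3.trans ((((hD.summable y).sum_le_tsum _ fun t _ => it_nonneg (ind_nonneg _) t y)).trans (gp_cube hd x1 R hR y))
  have h4 : it Vs (fun _ => 1) T y ≤ C / T := by rw [le_div_iff₀ hT']; linarith
  have h5 : C * it Vs (fun _ => 1) T y ≤ C * (C / T) := mul_le_mul_of_nonneg_left h4 hC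
  have : C * (C / T) = C ^ 2 / T := by ring
  linarith

/-- past points -/
noncomputable def past (g t : ℕ) (ω : ℕ → V d) : Finset (V d) := (Finset.range (t + 1 - g)).image ω
noncomputable def Gam (g t : ℕ) (ω : ℕ → V d) : ℝ := ∑ i ∈ Finset.range (t + 1 - g), g0 (ω i - ω t)

lemma exp_pair (hd : 5 ≤ d) (hP : SRW P) (x : V d) {i t : ℕ} (hi : i ≤ t) :
    ∫⁻ ω, ENNReal.ofReal (g0 (ω i - ω t)) ∂(P x) = ENNReal.ofReal (it Set.univ (g0 (d := d)) (t - i) 0) := by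
  have hd0 : 0 < d := by omega
  have h1 := markov hd0 hP (hP x) i (fun ω ω' => ENNReal.ofReal (g0 (ω i - ω' (t - i))))
    (fun ω ω' h => by simp only [h i le_rfl]) (fun ω => by
      refine ENNReal.measurable_ofReal.comp ?_
      have : Measurable fun v : V d => g0 (ω i - v) := measurable_of_countable _
      exact this.comp (measurable_pi_apply _))
  simp only [sh_apply, Nat.add_sub_cancel' hi] at h1
  rw [h1]
  have h2 : ∀ z : V d, ∫⁻ ω', ENNReal.ofReal (g0 (z - ω' (t - i))) ∂(P z)
      = ENNReal.ofReal (it Set.univ (g0 (d := d)) (t - i) 0) := by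
    intro z
    have := lint_it hd0 hP Set.univ (fun y => g0 (y - z)) (fun y => g0_nonneg _) (t - i) z
    rw [it_univ_shift, sub_self] at this
    rw [← this]
    refine lintegral_congr fun ω => ?_
    simp only [Set.mem_univ, implies_true, if_true]
    rw [← g0_neg, neg_sub]
  simp only [h2]
  have := (hP x).1
  simp

lemma gam_bound (hd : 5 ≤ d) (hP : SRW P) (x : V d) (g t : ℕ) {η : ℝ} (hη : 0 < η) :
    (P x).real {ω | η ≤ Gam g t ω} ≤ (∑' j, it Set.univ (g0 (d := d)) (j + g) 0) / η := by
  have hd0 : 0 < d := by omega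
  have := (hP x).1
  have hsum : Summable fun j => it Set.univ (g0 (d := d)) (j + g) 0 :=
    (summable_nat_add_iff g).2 (e_summable hd)
  have hnn : ∀ j, 0 ≤ it Set.univ (g0 (d := d)) j 0 := fun j => it_nonneg g0_nonneg j 0
  have hm : ∀ i, Measurable fun ω : ℕ → V d => ENNReal.ofReal (g0 (ω i - ω t)) := fun i => by
    refine ENNReal.measurable_ofReal.comp ?_
    have h1 : Measurable fun p : V d × V d => g0 (p.1 - p.2) := measurable_of_countable _
    have h2 : Measurable fun ω : ℕ → V d => (ω i, ω t) :=
      (measurable_pi_apply i).prodMk (measurable_pi_apply t)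
    exact h1.comp h2
  have hE : ∫⁻ ω, ENNReal.ofReal (Gam g t ω) ∂(P x) ≤ ENNReal.ofReal (∑' j, it Set.univ (g0 (d := d)) (j + g) 0) := by
    simp only [Gam]
    simp_rw [ENNReal.ofReal_sum_of_nonneg fun i _ => g0_nonneg _]
    rw [lintegral_finsetSum _ fun i _ => hm i]
    have : ∀ i ∈ Finset.range (t + 1 - g), ∫⁻ ω, ENNReal.ofReal (g0 (ω i - ω t)) ∂(P x)
        = ENNReal.ofReal (it Set.univ (g0 (d := d)) (t - i) 0) := fun i hi =>
      exp_pair hd hP x (by have := Finset.mem_range.1 hi; omega)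
    rw [Finset.sum_congr rfl this, ← Finset.sum_range_reflect,
      ← ENNReal.ofReal_sum_of_nonneg fun i _ => hnn _]
    refine ENNReal.ofReal_le_ofReal ?_
    refine le_trans (le_of_eq (Finset.sum_congr rfl fun i hi => ?_)) (hsum.sum_le_tsum (Finset.range (t + 1 - g)) fun i _ => hnn _)
    have := Finset.mem_range.1 hi
    congr 1; omega
  have h2 := meas_ge_le_lintegral_div (μ := P x) (f := fun ω => ENNReal.ofReal (Gam g t ω)) (by
      simp only [Gam]
      simp_rw [ENNReal.ofReal_sum_of_nonneg fun i _ => g0_nonneg _]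
      exact (Finset.measurable_fun_sum _ fun i _ => hm i).aemeasurable) (ε := ENNReal.ofReal η)
      (by simpa using hη) (by simp)
  have h3 : {ω : ℕ → V d | ENNReal.ofReal η ≤ ENNReal.ofReal (Gam g t ω)} = {ω | η ≤ Gam g t ω} := by
    ext ω
    simp only [Set.mem_ofPred_eq]
    exact ENNReal.ofReal_le_ofReal_iff (Finset.sum_nonneg fun i _ => g0_nonneg _)
  rw [h3] at h2
  have h4 := h2.trans (ENNReal.div_le_div_right hE _)
  rw [← ENNReal.ofReal_div_of_pos hη] at h4
  exact ENNReal.toReal_le_of_le_ofReal (div_nonneg (tsum_nonneg fun j => hnn _) hη.le) h4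

lemma first_moment {Ω : Type*} [MeasurableSpace Ω] (μ : Measure Ω) [IsProbabilityMeasure μ] (G : ℕ → Set Ω)
    (hG : ∀ t, MeasurableSet (G t)) (s : Finset ℕ) {T : ℕ} (hT : s.card ≤ T) {Av : Set Ω}
    (hAv : MeasurableSet Av) (hsub : ∀ t ∈ s, G t ⊆ Av) {k : ℝ} (hk : 0 ≤ k) :
    ∑ t ∈ s, μ.real (G t) ≤ T * μ.real {ω | k ≤ ((s.filter fun t => ω ∈ G t).card : ℝ)} + k * μ.real Av := by
  set B : Set Ω := {ω | k ≤ ((s.filter fun t => ω ∈ G t).card : ℝ)} with hB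
  have hcard : ∀ ω, ((s.filter fun t => ω ∈ G t).card : ℝ) = ∑ t ∈ s, (G t).indicator (fun _ => (1 : ℝ)) ω := by
    intro ω
    rw [Finset.card_filter]; push_cast
    exact Finset.sum_congr rfl fun t _ => by simp [Set.indicator]
  have hBm : MeasurableSet B := by
    have : Measurable fun ω => ∑ t ∈ s, (G t).indicator (fun _ => (1 : ℝ)) ω :=
      Finset.measurable_fun_sum _ fun t _ => measurable_const.indicator (hG t)
    simp only [hB, hcard]
    exact measurableSet_le measurable_const this
  have hi : ∀ {S : Set Ω}, MeasurableSet S → Integrable (S.indicator fun _ => (1 : ℝ)) μ := fun hS =>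
    (integrable_const 1).indicator hS
  have e : ∀ {S : Set Ω}, MeasurableSet S → ∫ ω, S.indicator (fun _ => (1 : ℝ)) ω ∂μ = μ.real S := fun hS => by
    rw [integral_indicator hS]; simp
  have h1 : ∑ t ∈ s, μ.real (G t) = ∫ ω, ∑ t ∈ s, (G t).indicator (fun _ => (1 : ℝ)) ω ∂μ := by
    rw [integral_finsetSum _ fun t _ => hi (hG t)]
    exact Finset.sum_congr rfl fun t _ => (e (hG t)).symm
  have h2 : T * μ.real B + k * μ.real Av
      = ∫ ω, (T * B.indicator (fun _ => (1 : ℝ)) ω + k * Av.indicator (fun _ => (1 : ℝ)) ω) ∂μ := by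
    rw [integral_add ((hi hBm).const_mul _) ((hi hAv).const_mul _), integral_const_mul, integral_const_mul, e hBm, e hAv]
  rw [h1, h2]
  refine integral_mono (integrable_finsetSum _ fun t _ => hi (hG t))
    (((hi hBm).const_mul _).add ((hi hAv).const_mul _)) fun ω => ?_
  dsimp only
  rw [← hcard]
  by_cases hω : ω ∈ B
  · rw [Set.indicator_of_mem hω]
    have : (0 : ℝ) ≤ k * Av.indicator (fun _ => (1 : ℝ)) ω :=
      mul_nonneg hk (Set.indicator_nonneg (fun _ _ => zero_le_one) ω)
    have h3 : ((s.filter fun t => ω ∈ G t).card : ℝ) ≤ T := by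
      exact_mod_cast (Finset.card_filter_le _ _).trans hT
    linarith
  · rw [Set.indicator_of_notMem hω]
    have hlt : ((s.filter fun t => ω ∈ G t).card : ℝ) < k := not_le.1 hω
    by_cases hA : ω ∈ Av
    · rw [Set.indicator_of_mem hA]; linarith
    · have : (s.filter fun t => ω ∈ G t) = ∅ :=
        Finset.filter_eq_empty_iff.2 fun t ht hc => hA (hsub t ht hc)
      rw [this, Set.indicator_of_notMem hA]; simp

end

section
variable {P : V d → Measure (ℕ → V d)}

def pre (Vs A0 : Set (V d)) (g : ℕ) (η : ℝ) (t : ℕ) : Set (ℕ → V d) :=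
  {ω | (∀ i ≤ t, ω i ∈ Vs) ∧ ω t ∈ A0 ∧ Gam g t ω ≤ η}

def good (D a U Vs A0 : Set (V d)) (g : ℕ) (η : ℝ) (t : ℕ) : Set (ℕ → V d) :=
  {ω | ω ∈ pre Vs A0 g η t ∧ sh t ω ∈ (hbE D (a ∪ U ∪ (past g t ω : Set (V d))))ᶜ}

lemma past_dep (g t : ℕ) (hg : 1 ≤ g) : Dep t (past (d := d) g t) := fun ω ω' h =>
  Finset.image_congr fun i hi => h i (by have := Finset.mem_range.1 hi; omega)

lemma pre_dep (Vs A0 : Set (V d)) (g : ℕ) (η : ℝ) (t : ℕ) (hg : 1 ≤ g) : Dep t (· ∈ pre Vs A0 g η t) := by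
  intro ω ω' h
  have e : Gam g t ω = Gam g t ω' := Finset.sum_congr rfl fun i hi => by
    rw [h i (by have := Finset.mem_range.1 hi; omega), h t le_rfl]
  have e2 : (∀ i ≤ t, ω i ∈ Vs) ↔ (∀ i ≤ t, ω' i ∈ Vs) :=
    forall₂_congr fun i hi => by rw [h i hi]
  simp only [pre, Set.mem_ofPred_eq, e, e2, h t le_rfl]

lemma R_dep (D a U : Set (V d)) (g t : ℕ) (hg : 1 ≤ g) :
    Dep t (fun ω : ℕ → V d => (hbE D (a ∪ U ∪ (past g t ω : Set (V d))))ᶜ) := fun ω ω' h => by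
  simp only [past_dep g t hg ω ω' h]

lemma good_meas (D a U Vs A0 : Set (V d)) (g : ℕ) (η : ℝ) (t : ℕ) (hg : 1 ≤ g) :
    MeasurableSet (good D a U Vs A0 g η t) :=
  (pre_dep Vs A0 g η t hg).meas.inter (meas_R (R_dep D a U g t hg) fun _ => (hbE_meas _ _).compl)

lemma good_avoid {D a U Vs A0 : Set (V d)} {g : ℕ} {η : ℝ} {t : ℕ} (hV : Disjoint Vs a) :
    good D a U Vs A0 g η t ⊆ (hbE D a)ᶜ := by
  rintro ω ⟨⟨h1, -, -⟩, h2⟩ ⟨j, hj, hi⟩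
  by_cases hjt : j ≤ t
  · exact Set.disjoint_left.1 hV (h1 j hjt) hj
  · refine h2 ⟨j - t, ?_, fun i hi' => ?_⟩
    · rw [sh_apply, Nat.add_sub_cancel' (by omega)]; exact Or.inl (Or.inl hj)
    · rw [sh_apply]; exact hi _ (by omega)

structure Geo (D a : Set (V d)) (N n m : ℕ) (x0 : V d) (i0 : Fin d) (sg : ℤ) (x1 : V d) : Prop where
  sh : Shell D a N n x0 i0 sg
  lat : ∀ i, i ≠ i0 → x1 i = x0 i
  l1 : lev n i0 sg x1 = (m / 2 : ℕ)
  hN : n + 8 * m ≤ 4 * N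

section
variable {D a : Set (V d)} {N n m : ℕ} {x0 : V d} {i0 : Fin d} {sg : ℤ} {x1 : V d}

lemma Geo.near (h : Geo D a N n m x0 i0 sg x1) {z : V d} {r : ℕ} (hz : z ∈ cube x1 r) :
    |lev n i0 sg z - (m / 2 : ℕ)| ≤ r ∧ ∀ i, i ≠ i0 → |z i - x0 i| ≤ r := by
  refine ⟨?_, fun i hi => by rw [← h.lat i hi]; exact hz i⟩
  have h1 := hz i0
  have h2 := h.l1
  rw [abs_le] at *
  unfold lev at *
  rcases h.sh.sg1 with e | e <;> subst e <;> omega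

lemma Geo.mem_iff (h : Geo D a N n m x0 i0 sg x1) {z : V d} {r : ℕ} (h1 : |lev n i0 sg z| ≤ r)
    (h2 : ∀ i, i ≠ i0 → |z i - x0 i| ≤ r) : z ∈ cube x0 r := by
  intro i
  by_cases hi : i = i0
  · subst hi
    rw [h.sh.lev_eq] at h1
    rw [abs_le] at *
    rcases h.sh.sg1 with e | e <;> subst e <;> omega
  · exact h2 i hi

lemma Geo.mem_iff1 (h : Geo D a N n m x0 i0 sg x1) {z : V d} {r : ℕ} (h1 : |lev n i0 sg z - (m / 2 : ℕ)| ≤ r)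
    (h2 : ∀ i, i ≠ i0 → |z i - x0 i| ≤ r) : z ∈ cube x1 r := by
  intro i
  by_cases hi : i = i0
  · subst hi
    have h3 := h.l1
    unfold lev at *
    rw [abs_le] at *
    rcases h.sh.sg1 with e | e <;> subst e <;> omega
  · rw [h.lat i hi]; exact h2 i hi

lemma Geo.inD (h : Geo D a N n m x0 i0 sg x1) {r : ℕ} (hr : r ≤ 8 * m) : cube x0 r ⊆ D := by
  refine Set.Subset.trans (fun z hz => ?_) h.sh.ND
  have h1 : x0 ∈ cube 0 n := h.sh.an h.sh.x0a
  have := cube_trans h1 hz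
  exact cube_mono (by have := h.hN; omega) this

/-- `V` is inside. -/
lemma Geo.Vs (h : Geo D a N n m x0 i0 sg x1) (hm : 2 ≤ m) {z : V d} (hz : z ∈ cube x1 (m / 2 - 1)) :
    z ∈ cube x0 (m - 1) ∧ z ∉ a := by
  have h1 := h.near hz
  have h2 := h1.1
  rw [abs_le] at h2
  refine ⟨h.mem_iff ?_ fun i hi => (h1.2 i hi).trans (by omega), fun hc => ?_⟩
  · rw [abs_le]; omega
  · have := h.sh.lev_le hc; omega

lemma Geo.gface_sub (h : Geo D a N n m x0 i0 sg x1) {l : ℕ} (hl : 2 * d * l + 2 ≤ m) (hd : 0 < d) {z : V d}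
    (hz : z ∈ gface n x0 i0 sg l) : z ∈ cube x0 (m - 1) := by
  have : l ≤ d * l := Nat.le_mul_of_pos_left l hd
  have e3 : 2 * d * l = 2 * (d * l) := by ring
  rw [e3] at hl
  refine h.mem_iff ?_ fun i hi => (hz.2 i hi).trans ?_
  · rw [hz.1, abs_le]; generalize d * l = q at *; omega
  · rw [e3]; generalize d * l = q at *; omega

/-- chain condition -/
lemma Geo.chain (h : Geo D a N n m x0 i0 sg x1) (hd : 5 ≤ d) {s : ℕ} (hs : 100 * d * d * s ≤ m) (hs1 : 1 ≤ s) {y : V d}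
    (hy : y ∈ gface n x0 i0 sg (3 * d * s)) (z : V d)
    (hz : ∀ i, min (x1 i) (y i) ≤ z i ∧ z i ≤ max (x1 i) (y i)) : cube z (3 * d * s) ⊆ cube x1 (m / 2 - 1) := by
  intro w hw
  have e1 : 5 * (d * s) ≤ d * d * s := by rw [mul_assoc]; exact Nat.mul_le_mul_right _ hd
  have e2 : 1 ≤ d * s := Nat.mul_pos (by omega) hs1
  have hs' : 100 * (d * d * s) ≤ m := by linarith
  have e3 : 3 * d * s = 3 * (d * s) := by ring
  have e4 : 2 * d * (3 * d * s) = 6 * (d * d * s) := by ring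
  refine h.mem_iff1 ?_ fun i hi => ?_
  · have h1 := hw i0
    have h2 := hz i0
    have h3 := hy.1
    have h4 := h.l1
    rw [e3] at h1 h3
    rw [abs_le] at *
    unfold lev at *
    generalize d * s = q at *
    generalize d * d * s = q2 at *
    rcases h.sh.sg1 with e | e <;> subst e <;>
    rcases le_total (x1 i0) (y i0) with h5 | h5 <;> simp only [h5, min_eq_left, max_eq_right, min_eq_right, max_eq_left] at h2 <;> omega
  · have h1 := hw i
    have h2 := hz i
    have h3 := hy.2 i hi
    rw [h.lat i hi] at h2
    rw [e3] at h1
    rw [e4] at h3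
    rw [abs_le] at *
    generalize d * s = q at *
    generalize d * d * s = q2 at *
    rcases le_total (x0 i) (y i) with h5 | h5 <;> simp only [h5, min_eq_left, max_eq_right, min_eq_right, max_eq_left] at h2 <;> omega

end

end

section
variable {P : V d → Measure (ℕ → V d)}

def Yt (D a A : Set (V d)) (t : ℕ) : Set (ℕ → V d) := {ω | ω t ∈ A ∧ sh t ω ∈ (hbE D a)ᶜ}

noncomputable def NY (D a A : Set (V d)) (ω : ℕ → V d) : ℝ≥0∞ := ∑' t, (Yt D a A t).indicator (fun _ => 1) ω

lemma Yt_meas (D a A : Set (V d)) (t : ℕ) : MeasurableSet (Yt D a A t) :=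
  (measurable_pi_apply t (meas_V A)).inter (meas_sh t (hbE_meas D a).compl)

lemma NY_meas (D a A : Set (V d)) : Measurable (NY D a A) :=
  Measurable.tsum fun t => measurable_const.indicator (Yt_meas D a A t)

lemma NY_card {D a A : Set (V d)} {ω : ℕ → V d} (hω : ω ∉ hbE D a) {k : ℝ} (h : NY D a A ω < ENNReal.ofReal k)
    (F : Finset ℕ) (hF : ∀ t ∈ F, ω t ∈ A ∧ ∀ i < t, ω i ∈ D) : (F.card : ℝ) ≤ k := by
  have h1 : ∀ t ∈ F, ω ∈ Yt D a A t := fun t ht => by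
    refine ⟨(hF t ht).1, ?_⟩
    rintro ⟨j, hj, hi⟩
    refine hω ⟨t + j, hj, fun i hi' => ?_⟩
    by_cases hit : i < t
    · exact (hF t ht).2 i hit
    · have := hi (i - t) (by omega)
      rwa [sh_apply, Nat.add_sub_cancel' (by omega)] at this
  have h2 : (F.card : ℝ≥0∞) ≤ NY D a A ω := by
    refine le_trans (le_of_eq ?_) (ENNReal.sum_le_tsum F)
    rw [Finset.sum_congr rfl fun t ht => Set.indicator_of_mem (h1 t ht) _]
    simp
  have h3 := h2.trans h.le
  have hk : 0 ≤ k := by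
    by_contra hc
    rw [ENNReal.ofReal_of_nonpos (by linarith)] at h
    exact not_lt_zero h
  have := ENNReal.toReal_mono (by simp) h3
  rwa [ENNReal.toReal_natCast, ENNReal.toReal_ofReal hk] at this

lemma visits (hd : 5 ≤ d) (hP : SRW P) (D a : Set (V d)) (x1 : V d) {R : ℕ} (hR : 1 ≤ R) (y : V d) {M k : ℝ}
    (hM0 : 0 ≤ M) (hM : ∀ z ∈ cube x1 R, hh P D a z ≤ M) (hk : 0 < k) :
    (P y).real {ω | ENNReal.ofReal k ≤ NY D a (cube x1 R) ω} ≤ M * (((d : ℝ) + 21) ^ 3 * R ^ 2) / k := by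
  have hd0 : 0 < d := by omega
  have := (hP y).1
  have h1 := meas_ge_le_lintegral_div (μ := P y) (NY_meas D a (cube x1 R)).aemeasurable (ε := ENNReal.ofReal k)
    (by simpa using hk) (by simp)
  have h2 : ∫⁻ ω, NY D a (cube x1 R) ω ∂(P y) ≤ ENNReal.ofReal (M * (((d : ℝ) + 21) ^ 3 * R ^ 2)) := by
    unfold NY
    rw [lintegral_tsum fun t => (measurable_const.indicator (Yt_meas D a _ t)).aemeasurable]
    have h3 : ∀ t, ∫⁻ ω, (Yt D a (cube x1 R) t).indicator (fun _ => (1 : ℝ≥0∞)) ω ∂(P y)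
        ≤ ENNReal.ofReal (M * it Set.univ (ind (cube x1 R)) t y) := by
      intro t
      rw [lintegral_indicator (Yt_meas D a _ t), setLIntegral_const, one_mul, ENNReal.ofReal_mul hM0,
        ← prob_it hd0 hP, ofReal_measureReal]
      have := mk_le hd0 hP (hP y) (n := t) (A := {ω | (∀ i ≤ t, ω i ∈ Set.univ) ∧ ω t ∈ cube x1 R})
        (fun ω ω' h => by simp [h t le_rfl]) (R := fun _ => (hbE D a)ᶜ) (fun _ _ _ => rfl)
        (fun _ => (hbE_meas D a).compl) (M := ENNReal.ofReal M) (fun ω hω => by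
          have := (hP (ω t)).1
          rw [← ofReal_measureReal, ← hh_eq hP]
          exact ENNReal.ofReal_le_ofReal (hM _ hω.2))
      refine le_trans (measure_mono ?_) this
      rintro ω ⟨h1, h2⟩
      exact ⟨⟨fun _ _ => trivial, h1⟩, h2⟩
    refine (ENNReal.tsum_le_tsum h3).trans ?_
    have hs := (dom_cube hd x1 R hR).summable y
    rw [← ENNReal.ofReal_tsum_of_nonneg (fun t => mul_nonneg hM0 (it_nonneg (ind_nonneg _) t y)) (hs.mul_left M), tsum_mul_left]
    exact ENNReal.ofReal_le_ofReal (mul_le_mul_of_nonneg_left (gp_cube hd x1 R hR y) hM0)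
  have h4 := h1.trans (ENNReal.div_le_div_right h2 _)
  rw [← ENNReal.ofReal_div_of_pos hk] at h4
  exact ENNReal.toReal_le_of_le_ofReal (by positivity) h4

lemma pre_sum (hd : 5 ≤ d) (hP : SRW P) {Vs A0 : Set (V d)} {x1 : V d} {R : ℕ} (hR : 1 ≤ R) (hV : Vs ⊆ cube x1 R)
    (hA : A0 ⊆ cube x1 R) (T g : ℕ) (hT : 0 < T) (hg : g ≤ T) {η : ℝ} (hη : 0 < η) (y : V d) :
    Gp Vs (ind A0) y - (((d : ℝ) + 21) ^ 3 * R ^ 2) ^ 2 / T - g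
      - T * ((∑' j, it Set.univ (g0 (d := d)) (j + g) 0) / η)
      ≤ ∑ t ∈ Finset.Ico g T, (P y).real (pre Vs A0 g η t) := by
  have hd0 : 0 < d := by omega
  have := (hP y).1
  have h1 := gp_trunc hd hR hV hA T hT y
  set ε := (∑' j, it Set.univ (g0 (d := d)) (j + g) 0) / η
  have h2 : ∀ t, it Vs (ind A0) t y ≤ (P y).real (pre Vs A0 g η t) + ε := fun t => by
    rw [← prob_it hd0 hP]
    refine (measureReal_mono (μ := P y) (s₂ := pre Vs A0 g η t ∪ {ω | η ≤ Gam g t ω}) ?_).trans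
      ((measureReal_union_le _ _).trans (add_le_add_right (gam_bound hd hP y g t hη) _))
    rintro ω ⟨h1, h2⟩
    by_cases h3 : Gam g t ω ≤ η
    · exact Or.inl ⟨h1, h2, h3⟩
    · exact Or.inr (not_le.1 h3).le
  have h3 : ∑ t ∈ Finset.range g, it Vs (ind A0) t y ≤ g := by
    refine (Finset.sum_le_sum (g := fun _ => (1 : ℝ)) fun t _ => ?_).trans (by simp)
    rw [← prob_it hd0 hP]; exact measureReal_le_one
  have h4 : ∑ t ∈ Finset.Ico g T, it Vs (ind A0) t y ≤ ∑ t ∈ Finset.Ico g T, (P y).real (pre Vs A0 g η t) + T * ε := by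
    refine (Finset.sum_le_sum fun t _ => h2 t).trans ?_
    rw [Finset.sum_add_distrib, Finset.sum_const, nsmul_eq_mul, Nat.card_Ico]
    have : 0 ≤ ε := div_nonneg (tsum_nonneg fun j => it_nonneg g0_nonneg _ _) hη.le
    have : ((T - g : ℕ) : ℝ) ≤ T := by exact_mod_cast Nat.sub_le _ _
    gcongr
  have h5 := Finset.sum_range_add_sum_Ico (fun t => it Vs (ind A0) t y) hg
  linarith

lemma post_bound (hd : 5 ≤ d) (hP : SRW P) {D a U K : Set (V d)} {z : V d} {C M : ℝ} (hC : 1 ≤ C)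
    (hM0 : 0 ≤ M) (hU : ∀ x ∈ U, hh P D a x ≤ M) (hK : ∀ x ∈ K, hh P D a x ≤ M)
    (hMz : M ≤ C * hh P D a z) (h1 : hb P Set.univ U z ≤ 1 / (4 * C)) (h2 : hb P Set.univ K z ≤ 1 / (4 * C)) :
    hh P D a z / 2 ≤ hh P D (a ∪ U ∪ K) z := by
  have hd0 : 0 < d := by omega
  have e1 := hh_union hd0 hP (D := D) (a := a) (K := U) hM0 hU z
  have e2 := hh_union hd0 hP (D := D) (a := a ∪ U) (K := K) hM0 (fun x hx => by
    refine le_trans ?_ (hK x hx)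
    exact sub_le_sub_left (hb_mono hP subset_rfl Set.subset_union_left x) 1) z
  have h3 : M * hb P Set.univ U z ≤ hh P D a z / 4 := by
    calc _ ≤ C * hh P D a z * (1 / (4 * C)) := mul_le_mul hMz h1 (hb_nonneg _ _ _) (by nlinarith [hh_nonneg hP D a z])
      _ = _ := by field_simp
  have h4 : M * hb P Set.univ K z ≤ hh P D a z / 4 := by
    calc _ ≤ C * hh P D a z * (1 / (4 * C)) := mul_le_mul hMz h2 (hb_nonneg _ _ _) (by nlinarith [hh_nonneg hP D a z])
      _ = _ := by field_simp
  linarith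

end

lemma hitU (hd : 5 ≤ d) {P : V d → Measure (ℕ → V d)} (hP : SRW P) {D a : Set (V d)} {N n m : ℕ} {x0 : V d} {i0 : Fin d}
    {sg : ℤ} {x1 : V d} (h : Geo D a N n m x0 i0 sg x1) {s K0 : ℕ} {C : ℝ} (hC : 1 ≤ C)
    (hK0 : 2304 * (d + 20) * (d : ℝ) ^ 4 * C ≤ K0) (hs1 : 1 ≤ s) (hs : K0 * s ≤ m) {z : V d}
    (hz : (m : ℤ) ≤ 4 * lev n i0 sg z) :
    hb P Set.univ (box n x0 i0 sg (3 * d * s)) z ≤ 1 / (4 * C) := by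
  refine (hb_mono hP subset_rfl (box_sub h.sh _) z).trans ?_
  have hr : 1 ≤ 2 * d * (3 * d * s) := by
    have : 0 < d := by omega
    have : 0 < 2 * d * (3 * d * s) := by positivity
    omega
  refine (hb_cube hd hP _ x0 _ hr z).trans ?_
  have h1 : ((m : ℝ) / 4) ^ 2 ≤ nsq (z - x0) := by
    refine le_trans ?_ (sq_le_nsq (z - x0) i0)
    have h2 := h.sh.lev_eq z
    have h3 : ((z - x0) i0 : ℤ) ^ 2 = (lev n i0 sg z) ^ 2 := by
      rw [h2, Pi.sub_apply]
      rcases h.sh.sg1 with e | e <;> subst e <;> ring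
    have h4 : (((z - x0) i0 : ℤ) : ℝ) ^ 2 = ((lev n i0 sg z : ℤ) : ℝ) ^ 2 := by exact_mod_cast h3
    rw [h4]
    have h5 : (m : ℝ) ≤ 4 * ((lev n i0 sg z : ℤ) : ℝ) := by exact_mod_cast hz
    exact pow_le_pow_left₀ (by positivity) (by linarith) 2
  have hdR : (5 : ℝ) ≤ d := by exact_mod_cast hd
  have hs1R : (1 : ℝ) ≤ s := by exact_mod_cast hs1
  have hsR : (K0 : ℝ) * s ≤ m := by exact_mod_cast hs
  have hK1 : (1 : ℝ) ≤ K0 := by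
    refine le_trans ?_ hK0
    have : (1 : ℝ) ≤ (d : ℝ) ^ 4 := one_le_pow₀ (by linarith)
    calc (1 : ℝ) ≤ 2304 * (d + 20) * 1 * 1 := by linarith
      _ ≤ _ := by gcongr
  have hm2 : (K0 : ℝ) * s ^ 2 ≤ m ^ 2 := by
    have : ((K0 : ℝ) * s) ^ 2 ≤ m ^ 2 := pow_le_pow_left₀ (by positivity) hsR 2
    have h3 : (K0 : ℝ) * s ^ 2 ≤ K0 ^ 2 * s ^ 2 := by
      apply mul_le_mul_of_nonneg_right _ (sq_nonneg _); nlinarith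
    nlinarith
  have h6 : 2304 * (d + 20) * (d : ℝ) ^ 4 * C * s ^ 2 ≤ m ^ 2 :=
    (mul_le_mul_of_nonneg_right hK0 (sq_nonneg _)).trans hm2
  push_cast
  have hpos : 0 < nsq (z - x0) + 20 * (2 * (d : ℝ) * (3 * d * s)) ^ 2 := by
    have := nsq_nonneg (z - x0)
    have : 0 < (2 * (d : ℝ) * (3 * d * s)) ^ 2 := by positivity
    linarith
  rw [div_le_div_iff₀ hpos (by positivity)]
  have : 0 < (2 * (d : ℝ) * (3 * d * s)) ^ 2 := by positivity
  nlinarith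

set_option maxHeartbeats 4000000 in
lemma fromY (hd : 5 ≤ d) : ∃ (K0 g M0 : ℕ) (c2 c3 C' η C : ℝ), 100 * d * d ≤ K0 ∧ 1 ≤ g ∧ 2 * d * K0 ≤ M0 ∧
    0 < c2 ∧ 0 < c3 ∧ 0 < C' ∧ 0 < η ∧ 1 ≤ C ∧
    ∀ (P : V d → Measure (ℕ → V d)) (D a : Set (V d)) (N n m : ℕ) (x0 : V d) (i0 : Fin d) (sg : ℤ) (x1 : V d), SRW P →
    Geo D a N n m x0 i0 sg x1 → M0 ≤ m →
    (∀ z ∈ cube x0 m, hh P D a z ≤ C * hh P D a x1) ∧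
    ∃ E2 : Set (ℕ → V d), MeasurableSet E2 ∧
      (∀ y ∈ gface n x0 i0 sg (3 * d * (m / K0)), c3 * hh P D a x1 ≤ (P y).real E2) ∧
      ∀ ω ∈ E2, ω ∉ hbE D a ∧
        (∃ τ : Finset ℕ, c2 * (m : ℝ) ^ 2 ≤ τ.card ∧ ∀ t ∈ τ, g ≤ t ∧
          ω ∈ good D a (box n x0 i0 sg (3 * d * (m / K0))) (cube x1 (m / 2 - 1)) (cube x1 (2 * (m / K0))) g η t) ∧
        ∀ F : Finset ℕ, (∀ t ∈ F, ω t ∈ cube x1 (m / 4) ∧ ∀ i < t, ω i ∈ D) → (F.card : ℝ) ≤ C' * (m : ℝ) ^ 2 := by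
  have hd0 : 0 < d := by omega
  obtain ⟨C, hC1, hCH⟩ := CH hd
  set K0 : ℕ := 100 * d * d + ⌈2304 * (d + 20) * (d : ℝ) ^ 4 * C⌉₊ with hK0
  have hK0a : 100 * d * d ≤ K0 := Nat.le_add_right _ _
  have hK0b : 2304 * (d + 20) * (d : ℝ) ^ 4 * C ≤ K0 := by
    refine (Nat.le_ceil _).trans ?_
    exact Nat.cast_le.2 (by rw [hK0]; exact Nat.le_add_left _ _)
  have hK0p : 0 < K0 := by have : 0 < 100 * d * d := by positivity
                           omega
  clear_value K0
  obtain ⟨cg, hcg, hgp⟩ := gpL hd (2 * K0)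
  set κ : ℝ := cg / (4 * K0 ^ 2) with hκ
  have hκ0 : 0 < κ := by positivity
  set C3 : ℝ := ((d : ℝ) + 21) ^ 3 with hC3
  have hC30 : 0 < C3 := by positivity
  set K2 : ℕ := ⌈4 * C3 ^ 2 / κ⌉₊ + 1 with hK2
  have hK2a : 4 * C3 ^ 2 / κ ≤ K2 := (Nat.le_ceil _).trans (by exact_mod_cast Nat.le_succ _)
  have hK2p : 0 < K2 := Nat.succ_pos _
  have hK2R : (0 : ℝ) < K2 := by exact_mod_cast hK2p
  clear_value K2
  set η : ℝ := 1 / (4 * C) with hη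
  have hη0 : 0 < η := by positivity
  obtain ⟨g, hg1, hg⟩ : ∃ g : ℕ, 1 ≤ g ∧ (∑' j, it Set.univ (g0 (d := d)) (j + g) 0) ≤ κ * η / (4 * K2) := by
    have h1 := tendsto_sum_nat_add fun j => it Set.univ (g0 (d := d)) j 0
    have h2 := (h1.eventually_lt_const (show (0 : ℝ) < κ * η / (4 * K2) by positivity)).and (Filter.eventually_ge_atTop 1)
    obtain ⟨g, h3, h4⟩ := h2.exists
    exact ⟨g, h4, h3.le⟩
  set M0 : ℕ := 2 * d * K0 + (40 * d + 1) + g + ⌈4 * g / κ⌉₊ + 8 with hM0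
  set κ' : ℝ := κ / 4 / (2 * C) with hκ'
  have hκ'0 : 0 < κ' := by positivity
  set c2 : ℝ := κ' / (2 * C) with hc2
  have hc20 : 0 < c2 := by positivity
  set c3 : ℝ := κ' / (2 * K2) with hc3
  have hc30 : 0 < c3 := by positivity
  set C' : ℝ := 2 * C * C3 / c3 with hC'
  have hC'0 : 0 < C' := by positivity
  refine ⟨K0, g, M0, c2, c3 / 2, C', η, C, hK0a, hg1, by omega, hc20, by positivity, hC'0, hη0, hC1, ?_⟩
  intro P D a N n m x0 i0 sg x1 hP h hm
  have hm1 : 2 * d * K0 ≤ m := by omega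
  have hm2 : 40 * d < m := by omega
  have hm3 : g ≤ m := by omega
  have hm4 : 4 * g / κ ≤ m := (Nat.le_ceil _).trans (Nat.cast_le.2 (by omega))
  have hm5 : 8 ≤ m := by omega
  have hmR : (0 : ℝ) < m := by exact_mod_cast (by omega : 0 < m)
  clear_value M0
  set s := m / K0 with hs
  have hs2 : 2 * d ≤ s := (Nat.le_div_iff_mul_le hK0p).2 hm1
  have hsK : K0 * s ≤ m := Nat.mul_div_le m K0
  have hs1 : 1 ≤ s := by omega
  have hms : m ≤ 2 * K0 * s := by
    have := Nat.lt_mul_div_succ m hK0p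
    rw [← hs] at this
    nlinarith
  clear_value s
  have hs100 : 100 * d * d * s ≤ m := (Nat.mul_le_mul_right _ hK0a).trans hsK
  have hs25 : 2500 * s ≤ m := by
    refine le_trans (Nat.mul_le_mul_right _ ?_) hs100
    nlinarith
  set l := 3 * d * s with hl
  have hCH' := hCH P D a N n m x0 i0 sg hP h.sh hm2 h.hN
  set h1 := hh P D a x1 with hh1
  have h10 : 0 ≤ h1 := hh_nonneg hP D a x1
  have hlev1 := h.l1
  have hUp : ∀ z ∈ cube x0 m, hh P D a z ≤ C * h1 := fun z hz =>
    hCH' z hz x1 (fun i hi => by rw [h.lat i hi]; simp) (by rw [h.l1]; omega) (by rw [h.l1]; omega)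
  refine ⟨hUp, ?_⟩
  set U := box n x0 i0 sg l with hU
  set Vs := cube x1 (m / 2 - 1) with hVs
  set A0 := cube x1 (2 * s) with hA0
  have hx1m : x1 ∈ cube x0 m := h.mem_iff (by rw [h.l1, abs_le]; omega) fun i hi => by rw [h.lat i hi]; simp
  have hVm : Vs ⊆ cube x0 m := fun z hz => cube_mono (by omega) (h.Vs (by omega) hz).1
  have hdl : 2 * d * l ≤ m := by
    rw [hl]; have : 2 * d * (3 * d * s) = 6 * (d * d * s) := by ring
    have : 100 * d * d * s = 100 * (d * d * s) := by ring
    omega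
  have hUm : U ⊆ cube x0 m := (box_sub h.sh l).trans (cube_mono hdl)
  have hDis : Disjoint Vs a := Set.disjoint_left.2 fun z hz => (h.Vs (by omega) hz).2
  set T := K2 * m ^ 2 with hT
  have hTp : 0 < T := by positivity
  have hgT : g ≤ T := by nlinarith
  have hpost : ∀ t, ∀ ω ∈ pre Vs A0 g η t, ENNReal.ofReal (h1 / (2 * C)) ≤
      P (ω t) (hbE D (a ∪ U ∪ (past g t ω : Set (V d))))ᶜ := by
    rintro t ω ⟨p1, p2, p3⟩
    have := (hP (ω t)).1
    rw [← ofReal_measureReal, ← hh_eq hP]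
    refine ENNReal.ofReal_le_ofReal ?_
    have hn := h.near p2
    have hn1 := hn.1
    rw [abs_le] at hn1
    have hl4 : (m : ℤ) ≤ 4 * lev n i0 sg (ω t) := by omega
    have hlow : ∀ z ∈ cube x0 m, hh P D a z ≤ C * hh P D a (ω t) := fun z hz =>
      hCH' z hz (ω t) (fun i hi => (hn.2 i hi).trans (by omega)) hl4 (by omega)
    have := post_bound hd hP (D := D) (a := a) (U := U) (K := (past g t ω : Set (V d))) (z := ω t) (C := C)
      (M := C * hh P D a (ω t)) hC1 (mul_nonneg (by linarith) (hh_nonneg hP _ _ _))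
      (fun z hz => hlow z (hUm hz)) (fun z hz => by
        obtain ⟨i, hi, rfl⟩ := Finset.mem_image.1 (Finset.mem_coe.1 hz)
        exact hlow _ (hVm (p1 i (by have := Finset.mem_range.1 hi; omega)))) le_rfl
      (hitU hd hP h hC1 hK0b hs1 hsK hl4) ((hb_fin hd hP _ _ _).trans (le_trans ?_ p3))
    · refine le_trans ?_ this
      have := hlow x1 hx1m
      rw [div_le_iff₀ (by positivity)]
      linarith
    · unfold past Gam
      refine (Finset.sum_image_le_of_nonneg (s := Finset.range (t + 1 - g)) (g := ω)
        (f := fun y => g0 (ω t - y)) fun _ _ => g0_nonneg _).trans (le_of_eq ?_)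
      exact Finset.sum_congr rfl fun i _ => by rw [← g0_neg, neg_sub]
  set G : ℕ → Set (ℕ → V d) := fun t => good D a U Vs A0 g η t with hG
  have hGm : ∀ t, MeasurableSet (G t) := fun t => good_meas _ _ _ _ _ _ _ _ hg1
  set B : Set (ℕ → V d) := {ω | c2 * (m : ℝ) ^ 2 ≤ (((Finset.Ico g T).filter fun t => ω ∈ G t).card : ℝ)} with hB
  set Z : Set (ℕ → V d) := {ω | ENNReal.ofReal (C' * (m : ℝ) ^ 2) ≤ NY D a (cube x1 (m / 4)) ω} with hZ
  have hBm : MeasurableSet B := by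
    have : ∀ ω, (((Finset.Ico g T).filter fun t => ω ∈ G t).card : ℝ)
        = ∑ t ∈ Finset.Ico g T, (G t).indicator (fun _ => (1 : ℝ)) ω := fun ω => by
      rw [Finset.card_filter]; push_cast
      exact Finset.sum_congr rfl fun t _ => by simp [Set.indicator]
    simp only [hB, this]
    exact measurableSet_le measurable_const (Finset.measurable_fun_sum _ fun t _ => measurable_const.indicator (hGm t))
  have hZm : MeasurableSet Z := measurableSet_le measurable_const (NY_meas _ _ _)
  refine ⟨B \ Z, hBm.diff hZm, ?_, ?_⟩
  · intro y hy
    have := (hP y).1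
    have hbox := h.chain hd hs100 hs1 hy
    have hyV : y ∈ Vs := hbox y (fun i => ⟨min_le_right _ _, le_max_right _ _⟩) (self_mem_cube _ _)
    have q1 : κ * (m : ℝ) ^ 2 ≤ Gp Vs (ind A0) y := by
      refine le_trans ?_ (hgp x1 y s Vs hs2 (fun i => (hyV i).trans (by omega)) hbox)
      rw [hκ, div_mul_eq_mul_div, div_le_iff₀ (by positivity)]
      have : (m : ℝ) ^ 2 ≤ (2 * K0 * s) ^ 2 := pow_le_pow_left₀ hmR.le (by exact_mod_cast hms) 2
      nlinarith
    have q2 := pre_sum hd hP (R := m) (x1 := x1) (by omega) (cube_mono (by omega)) (cube_mono (by omega)) T g hTp hgT hη0 y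
      (Vs := Vs) (A0 := A0)
    have hTR : (T : ℝ) = K2 * m ^ 2 := by rw [hT]; push_cast; ring
    have q3 : (((d : ℝ) + 21) ^ 3 * (m : ℝ) ^ 2) ^ 2 / T ≤ κ / 4 * m ^ 2 := by
      rw [hTR, ← hC3, div_le_iff₀ (by positivity)]
      rw [div_le_iff₀ hκ0] at hK2a
      have : 0 ≤ ((m : ℝ) ^ 2) ^ 2 := by positivity
      nlinarith
    have q4 : (g : ℝ) ≤ κ / 4 * m ^ 2 := by
      rw [div_le_iff₀ hκ0] at hm4
      have : (1 : ℝ) ≤ m := by exact_mod_cast (by omega : 1 ≤ m)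
      have : κ * m ≤ κ * m ^ 2 := by nlinarith
      linarith
    have q5 : T * ((∑' j, it Set.univ (g0 (d := d)) (j + g) 0) / η) ≤ κ / 4 * m ^ 2 := by
      rw [hTR]
      have : (∑' j, it Set.univ (g0 (d := d)) (j + g) 0) / η ≤ κ / (4 * K2) := by
        rw [div_le_iff₀ hη0]; exact hg.trans (le_of_eq (by ring))
      calc _ ≤ K2 * (m : ℝ) ^ 2 * (κ / (4 * K2)) := by gcongr
        _ = _ := by field_simp
    have q6 : κ / 4 * m ^ 2 ≤ ∑ t ∈ Finset.Ico g T, (P y).real (pre Vs A0 g η t) := by linarith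
    have q7 : κ' * m ^ 2 * h1 ≤ ∑ t ∈ Finset.Ico g T, (P y).real (G t) := by
      calc κ' * m ^ 2 * h1 = h1 / (2 * C) * (κ / 4 * m ^ 2) := by rw [hκ']; field_simp
        _ ≤ h1 / (2 * C) * ∑ t ∈ Finset.Ico g T, (P y).real (pre Vs A0 g η t) := by gcongr
        _ ≤ _ := by
          rw [Finset.mul_sum]
          refine Finset.sum_le_sum fun t _ => ?_
          have := mk_ge hd0 hP (hP y) (pre_dep Vs A0 g η t hg1) (R_dep D a U g t hg1) (fun _ => (hbE_meas _ _).compl) (hpost t)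
          have := ENNReal.toReal_mono (measure_ne_top _ _) this
          rw [ENNReal.toReal_mul, ENNReal.toReal_ofReal (by positivity)] at this
          exact this
    have q8 := first_moment (P y) G hGm (Finset.Ico g T) (T := T) (by simp) (hbE_meas D a).compl
      (fun t _ => good_avoid hDis) (k := c2 * m ^ 2) (by positivity)
    rw [← hh_eq hP] at q8
    have q9 : c2 * m ^ 2 * hh P D a y ≤ κ' / 2 * m ^ 2 * h1 := by
      calc _ ≤ c2 * m ^ 2 * (C * h1) := by gcongr; exact hUp y (hVm hyV)
        _ = _ := by rw [hc2]; field_simp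
    have q10 : c3 * h1 ≤ (P y).real B := by
      have : κ' / 2 * m ^ 2 * h1 ≤ K2 * m ^ 2 * (P y).real B := by rw [← hTR]; linarith
      have h2 : (m : ℝ) ^ 2 * (κ' / 2 * h1) ≤ m ^ 2 * (K2 * (P y).real B) := by linarith
      have h3 := le_of_mul_le_mul_left h2 (by positivity)
      rw [hc3, div_mul_eq_mul_div, div_le_iff₀ (by positivity)]
      linarith
    have q11 := visits hd hP D a x1 (R := m / 4) (by omega) y (M := C * h1) (k := C' * m ^ 2) (by positivity)
      (fun z hz => hUp z (by
        have := h.near hz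
        have h2 := this.1
        rw [abs_le] at h2
        exact h.mem_iff (by rw [abs_le]; omega) fun i hi => (this.2 i hi).trans (by omega))) (by positivity)
    have q12 : C * h1 * (((d : ℝ) + 21) ^ 3 * ((m / 4 : ℕ) : ℝ) ^ 2) / (C' * m ^ 2) ≤ c3 / 2 * h1 := by
      rw [← hC3, div_le_iff₀ (by positivity)]
      have : ((m / 4 : ℕ) : ℝ) ^ 2 ≤ m ^ 2 := pow_le_pow_left₀ (by positivity) (by exact_mod_cast Nat.div_le_self _ _) 2
      calc _ ≤ C * h1 * (C3 * m ^ 2) := by gcongr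
        _ = _ := by rw [hC']; field_simp
    have q13 : (P y).real B ≤ (P y).real (B \ Z) + (P y).real Z := by
      refine (measureReal_mono (μ := P y) (s₂ := (B \ Z) ∪ Z) (fun ω hω => ?_)).trans (measureReal_union_le _ _)
      by_cases hz : ω ∈ Z
      · exact Or.inr hz
      · exact Or.inl ⟨hω, hz⟩
    linarith
  · rintro ω ⟨hωB, hωZ⟩
    have hb1 : c2 * (m : ℝ) ^ 2 ≤ (((Finset.Ico g T).filter fun t => ω ∈ G t).card : ℝ) := hωB
    have hav : ω ∉ hbE D a := by
      have : 0 < ((Finset.Ico g T).filter fun t => ω ∈ G t).card := by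
        have : (0 : ℝ) < c2 * (m : ℝ) ^ 2 := by positivity
        exact_mod_cast this.trans_le hb1
      obtain ⟨t, ht⟩ := Finset.card_pos.1 this
      exact good_avoid hDis (Finset.mem_filter.1 ht).2
    refine ⟨hav, ⟨_, hb1, fun t ht => ?_⟩, fun F hF => NY_card hav (not_le.1 hωZ) F hF⟩
    have := Finset.mem_filter.1 ht
    exact ⟨(Finset.mem_Ico.1 this.1).1, this.2⟩

section
variable {P : V d → Measure (ℕ → V d)}

def avP (D a : Set (V d)) : Set (ℕ → V d) := sh 1 ⁻¹' (hbE D a)ᶜ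

def I1 (D : Set (V d)) (W : ℕ → V d) (B : Set (V d)) : Prop := ∀ v ∈ B, ∃ j, W j = v ∧ ∀ i < j, W i ∈ D

def I2 (D : Set (V d)) (x0 : V d) (m : ℕ) (W : ℕ → V d) (B : Set (V d)) : Prop :=
  ∀ s u, s < u → (∀ i ≤ s, ∀ j ≥ u, (∀ k < j, W k ∈ D) → W j ≠ W i) → (∀ i < u, W i ∈ cube x0 (m - 1)) →
    ∃ r, s ≤ r ∧ r < u ∧ W r ∈ B ∧ ∀ r' > r, (∀ k < r', W k ∈ D) → W r' ≠ W r

lemma avP_meas (D a : Set (V d)) : MeasurableSet (avP D a) := meas_sh 1 (hbE_meas D a).compl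

lemma avP_real (hd : 0 < d) (hP : SRW P) (D a : Set (V d)) (x : V d) :
    (P x).real (avP D a) = avg (hh P D a) x := by
  rw [avP, one_step hd hP x (hbE_meas D a).compl]
  exact congrArg (fun f => avg f x) (funext fun y => (hh_eq hP D a y).symm)

/-- energy bound -/
lemma energy (hd : 5 ≤ d) (hP : SRW P) {B : Set (V d)} (hB : B.Finite) (τ : Finset ℕ) (ξ : ℕ → V d)
    (hξ : ∀ t ∈ τ, ξ t ∈ B) (hinj : Set.InjOn ξ τ) {κ : ℝ} (hκ : 0 ≤ κ)
    (h : ∀ t ∈ τ, ∑ t' ∈ τ.filter (· < t), g0 (ξ t' - ξ t) ≤ κ) :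
    (τ.card : ℝ) ≤ 4 * (g0 (0 : V d) + 2 * κ) * capacity P B := by
  have h1 := one_le_g0 hd
  set R : ℝ := g0 (0 : V d) + 2 * κ with hR
  have hR0 : 0 < R := by linarith
  set row : ℕ → ℝ := fun t => ∑ t' ∈ τ, g0 (ξ t - ξ t') with hrow
  have hrow0 : ∀ t, 0 ≤ row t := fun t => Finset.sum_nonneg fun _ _ => g0_nonneg _
  have hsplit : ∀ t ∈ τ, row t = g0 (0 : V d) + ∑ t' ∈ τ.filter (· < t), g0 (ξ t' - ξ t)
      + ∑ t' ∈ τ.filter (t < ·), g0 (ξ t - ξ t') := by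
    intro t ht
    have e1 : ∑ t' ∈ τ.filter (· < t), g0 (ξ t' - ξ t) = ∑ t' ∈ τ, if t' < t then g0 (ξ t - ξ t') else 0 := by
      rw [Finset.sum_filter]
      refine Finset.sum_congr rfl fun t' _ => ?_
      rw [← g0_neg (ξ t - ξ t'), neg_sub]
    have e2 : g0 (0 : V d) = ∑ t' ∈ τ, if t' = t then g0 (ξ t - ξ t') else 0 := by
      rw [Finset.sum_ite_eq' τ t]; simp [ht]
    rw [e1, e2, Finset.sum_filter, ← Finset.sum_add_distrib, ← Finset.sum_add_distrib]
    refine Finset.sum_congr rfl fun t' _ => ?_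
    rcases lt_trichotomy t' t with h | h | h
    · simp [h, h.ne, h.not_gt]
    · simp [h]
    · simp [h, h.ne', h.not_gt]
  have hcomm : ∑ t ∈ τ, ∑ t' ∈ τ.filter (t < ·), g0 (ξ t - ξ t') = ∑ t ∈ τ, ∑ t' ∈ τ.filter (· < t), g0 (ξ t' - ξ t) := by
    simp only [Finset.sum_filter]
    rw [Finset.sum_comm]
  have htot : ∑ t ∈ τ, row t ≤ τ.card * R := by
    rw [Finset.sum_congr rfl hsplit, Finset.sum_add_distrib, Finset.sum_add_distrib, hcomm]
    have := Finset.sum_le_sum h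
    simp only [Finset.sum_const, nsmul_eq_mul] at *
    rw [hR]; nlinarith
  set s := τ.filter (fun t => row t ≤ 2 * R) with hs
  have hcard : (τ.card : ℝ) ≤ 2 * s.card := by
    have h2 : ((τ.filter (fun t => ¬ row t ≤ 2 * R)).card : ℝ) * (2 * R) ≤ ∑ t ∈ τ, row t := by
      rw [← nsmul_eq_mul]
      refine (Finset.card_nsmul_le_sum _ row _ fun t ht => ?_).trans
        (Finset.sum_le_sum_of_subset_of_nonneg (Finset.filter_subset _ _) fun t _ _ => hrow0 t)
      exact (not_le.1 (Finset.mem_filter.1 ht).2).le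
    have h3 : (τ.card : ℝ) = s.card + (τ.filter (fun t => ¬ row t ≤ 2 * R)).card := by
      rw [hs, ← Nat.cast_add, Finset.card_filter_add_card_filter_not]
    have h4 : 2 * ((τ.filter (fun t => ¬ row t ≤ 2 * R)).card : ℝ) ≤ τ.card := by
      nlinarith
    linarith
  have hinj' : Set.InjOn ξ s := hinj.mono (Finset.filter_subset _ _)
  have := cap_ge hd hP hB (s.image ξ) (by
    intro v hv
    obtain ⟨t, ht, rfl⟩ := Finset.mem_image.1 (Finset.mem_coe.1 hv)
    exact hξ t (Finset.mem_filter.1 ht).1) (K := 2 * R) (by linarith) (by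
    intro x hx
    obtain ⟨t, ht, rfl⟩ := Finset.mem_image.1 hx
    rw [Finset.sum_image hinj']
    exact (Finset.sum_le_sum_of_subset_of_nonneg (Finset.filter_subset _ _) fun _ _ _ => g0_nonneg _).trans
      (Finset.mem_filter.1 ht).2)
  rw [Finset.card_image_of_injOn hinj'] at this
  linarith

lemma nn_cube {W : ℕ → V d} (hW : ∀ i, adj (W i) (W (i + 1))) (i k : ℕ) : W (i + k) ∈ cube (W i) k := by
  induction k with
  | zero => exact self_mem_cube _ _
  | succ k ih =>
    have h1 : W (i + k + 1) ∈ cube (W (i + k)) 1 := by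
      obtain ⟨j, h | h⟩ := adj_iff.1 (hW (i + k)) <;> rw [h]
      exacts [(add_ee_mem _ j).1, (add_ee_mem _ j).2]
    exact cube_trans ih h1

/-- choosing well separated times -/
lemma residue (τ : Finset ℕ) (g : ℕ) (hg : 1 ≤ g) : ∃ τ' ⊆ τ, (τ.card : ℝ) ≤ g * τ'.card ∧
    ∀ t ∈ τ', ∀ t' ∈ τ', t' < t → t' + g ≤ t := by
  rcases Nat.eq_zero_or_pos τ.card with h0 | h0
  · exact ⟨∅, by simp, by simp [h0], by simp⟩
  by_contra hc
  push Not at hc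
  have hlt : ∀ k ∈ Finset.range g, ((τ.filter (fun t => t % g = k)).card : ℝ) < τ.card / g := by
    intro k _
    by_contra h1
    push Not at h1
    obtain ⟨t, ht, t', ht', h2, h3⟩ := hc _ (Finset.filter_subset (fun t => t % g = k) τ) (by
      rw [div_le_iff₀ (by exact_mod_cast hg)] at h1; linarith)
    have h4 := (Finset.mem_filter.1 ht).2
    have h5 := (Finset.mem_filter.1 ht').2
    have : g ∣ t - t' := (Nat.modEq_iff_dvd' h2.le).1 (h5.trans h4.symm)
    have := Nat.le_of_dvd (by omega) this
    omega
  have h1 := Finset.card_eq_sum_card_fiberwise (s := τ) (t := Finset.range g) (f := fun t => t % g)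
    (fun t _ => Finset.mem_coe.2 (Finset.mem_range.2 (Nat.mod_lt _ hg)))
  have h2 := Finset.sum_lt_sum_of_nonempty (s := Finset.range g) ⟨0, Finset.mem_range.2 hg⟩ hlt
  rw [← Nat.cast_sum, ← h1] at h2
  simp only [Finset.sum_const, Finset.card_range, nsmul_eq_mul] at h2
  have : (g : ℝ) ≠ 0 := by positivity
  field_simp at h2
  exact lt_irrefl _ h2

end

section
variable {P : V d → Measure (ℕ → V d)} {D a : Set (V d)} {N n m : ℕ} {x0 : V d} {i0 : Fin d} {sg : ℤ} {x1 : V d}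

/-- probability comparison -/
lemma large_prob (hd : 5 ≤ d) (hP : SRW P) (h : Geo D a N n m x0 i0 sg x1) {l : ℕ} (hl : 1 ≤ l) (hlm : 2 * d * l + 2 ≤ m)
    {C c3 : ℝ} (hC : 1 ≤ C) (hc3 : 0 < c3) (hH : ∀ z ∈ cube x0 m, hh P D a z ≤ C * hh P D a x1)
    {E2 : Set (ℕ → V d)} (hE : MeasurableSet E2) (hE2 : ∀ y ∈ gface n x0 i0 sg l, c3 * hh P D a x1 ≤ (P y).real E2) :
    c3 / (C * (1 + 8 * d)) * (P x0).real (avP D a) ≤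
      (P x0).real (sh 1 ⁻¹' hbT (box n x0 i0 sg l \ a) (gface n x0 i0 sg l) E2) := by
  have hd0 : 0 < d := by omega
  set U := box n x0 i0 sg l
  set Fg := gface n x0 i0 sg l
  set H := hh P D a x1
  have hH0 : 0 ≤ H := hh_nonneg hP _ _ _
  set vg := hb P (U \ a) Fg with hvg
  set vb := hb P (U \ a) (U ∪ Fg)ᶜ with hvb
  have hUc : U ⊆ cube x0 (2 * d * l) := box_sub h.sh l
  have hUm : U ⊆ cube x0 m := hUc.trans (cube_mono (by omega))
  have hUD : U ⊆ D := hUm.trans (h.inD (by omega))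
  have x0U : x0 ∈ U := by
    have : lev n i0 sg x0 = 0 := by rw [h.sh.lev_eq]; simp
    exact ⟨by rw [this]; simp, fun i _ => by simp only [sub_self, abs_zero]; positivity⟩
  have hnb : ∀ x ∈ U, ∀ y ∈ cube x 1, y ∈ cube x0 m := fun x hx y hy =>
    cube_mono (by omega) (cube_trans (hUc hx) hy)
  have off : ∀ y, y ∈ cube x0 m → y ∉ U \ a → hh P D a y ≤ C * H * (vg y + vb y) := by
    intro y hy hyU
    have h0 : 0 ≤ C * H := by positivity
    by_cases hya : y ∈ a
    · rw [hh_mem hd0 hP hya]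
      exact mul_nonneg h0 (add_nonneg (hb_nonneg _ _ _) (hb_nonneg _ _ _))
    have hyU' : y ∉ U := fun hc => hyU ⟨hc, hya⟩
    have h1 : 1 ≤ vg y + vb y := by
      by_cases hF : y ∈ Fg
      · have : vg y = 1 := hb_one hd0 hP hF
        have : 0 ≤ vb y := hb_nonneg _ _ _
        linarith
      · have : vb y = 1 := hb_one hd0 hP (fun hc => hc.elim hyU' hF)
        have : 0 ≤ vg y := hb_nonneg _ _ _
        linarith
    calc hh P D a y ≤ C * H := hH y hy
      _ ≤ _ := le_mul_of_one_le_right h0 h1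
  have onU := minP_loc hd0 (fun y => C * H * (vg y + vb y) - hh P D a y) (U \ a)
    (((cube_finite _ _).subset hUc).subset Set.sdiff_subset) (by
      intro x hx
      rw [avg_sub, avg_smul, avg_add, hh_avg hd0 hP hx.2 (hUD hx.1)]
      have e1 : vg x = avg vg x := hb_avg hd0 hP (fun hc => by
        have h1 := hx.1.1; rw [hc.1, abs_le] at h1; omega) hx
      have e2 : vb x = avg vb x := hb_avg hd0 hP (fun hc => hc (Or.inl hx.1)) hx
      rw [← e1, ← e2]) (by
      intro x hx i
      exact ⟨fun hc => sub_nonneg.2 (off _ (hnb x hx.1 _ (add_ee_mem x i).1) hc),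
        fun hc => sub_nonneg.2 (off _ (hnb x hx.1 _ (add_ee_mem x i).2) hc)⟩)
  have all : ∀ y ∈ cube x0 1, hh P D a y ≤ C * H * (vg y + vb y) := by
    intro y hy
    by_cases hyU : y ∈ U \ a
    · have := onU y hyU; linarith
    · exact off y (hnb x0 x0U y hy) hyU
  have hp : (P x0).real (avP D a) ≤ C * H * ((1 + 8 * d) * avg vg x0) := by
    rw [avP_real hd0 hP]
    calc avg (hh P D a) x0 ≤ avg (fun y => C * H * (vg y + vb y)) x0 :=
          avg_mono' fun i => ⟨all _ (add_ee_mem x0 i).1, all _ (add_ee_mem x0 i).2⟩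
      _ = C * H * (avg vg x0 + avg vb x0) := by rw [avg_smul, avg_add]
      _ ≤ _ := by
          refine mul_le_mul_of_nonneg_left ?_ (by positivity)
          have := barrier hd hP h.sh hl
          linarith
  have hq : c3 * H * avg vg x0 ≤ (P x0).real (sh 1 ⁻¹' hbT (U \ a) Fg E2) := by
    rw [one_step hd0 hP x0 (hbT_meas _ _ hE), ← avg_smul]
    exact avg_mono (fun y => hbT_ge hd0 hP y _ _ hE hE2 (by positivity)) x0
  refine le_trans ?_ hq
  rw [div_mul_eq_mul_div, div_le_iff₀ (by positivity)]
  calc _ ≤ c3 * (C * H * ((1 + 8 * d) * avg vg x0)) := mul_le_mul_of_nonneg_left hp hc3.le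
    _ = _ := by ring

/-- deterministic part -/
lemma large_det (hd : 5 ≤ d) (hP : SRW P) (h : Geo D a N n m x0 i0 sg x1) {l s g : ℕ} (hlm : 2 * d * l + 2 ≤ m)
    (hl4 : 4 * l + 4 ≤ m) (hg : 1 ≤ g) (hsg : 2 * s + g ≤ m / 4)
    {c2 C' η : ℝ} (hc2 : 0 < c2) (hη : 0 < η) {W : ℕ → V d} (W0 : W 0 = x0) (hW : ∀ i, adj (W i) (W (i + 1)))
    {J : ℕ} (hJ : 1 ≤ J) (hleg : ∀ i, 1 ≤ i → i < J → W i ∈ box n x0 i0 sg l)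
    (hτ : ∃ τ : Finset ℕ, c2 * (m : ℝ) ^ 2 ≤ τ.card ∧ ∀ t ∈ τ, g ≤ t ∧
          sh J W ∈ good D a (box n x0 i0 sg l) (cube x1 (m / 2 - 1)) (cube x1 (2 * s)) g η t)
    (hF : ∀ F : Finset ℕ, (∀ t ∈ F, sh J W t ∈ cube x1 (m / 4) ∧ ∀ i < t, sh J W i ∈ D) → (F.card : ℝ) ≤ C' * (m : ℝ) ^ 2)
    {B : Set (V d)} (hB1 : I1 D W B) (hB2 : I2 D x0 m W B) :
    c2 * (m : ℝ) ^ 2 ≤ g * (4 * (g0 (0 : V d) + 2 * ((2 * d) ^ (d * g) * η))) * capacity P (cube x1 (m / 4) ∩ B) ∧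
    capacity P (cube x1 (m / 4) ∩ B) ≤ C' * (m : ℝ) ^ 2 := by
  have hd0 : 0 < d := by omega
  have hfin : (cube x1 (m / 4) ∩ B).Finite := (cube_finite _ _).subset Set.inter_subset_left
  have x0U : x0 ∈ box n x0 i0 sg l := by
    have : lev n i0 sg x0 = 0 := by rw [h.sh.lev_eq]; simp
    exact ⟨by rw [this]; simp, fun i _ => by simp only [sub_self, abs_zero]; positivity⟩
  have hU : ∀ i < J, W i ∈ box n x0 i0 sg l := by
    intro i hi
    rcases Nat.eq_zero_or_pos i with e | e
    · rw [e, W0]; exact x0U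
    · exact hleg i e hi
  constructor
  · obtain ⟨τ, hτc, hτg⟩ := hτ
    have hin : ∀ t ∈ τ, ∀ i ≤ J + t, W i ∈ cube x0 (m - 1) := by
      intro t ht i hi
      by_cases hiJ : i < J
      · exact cube_mono (by omega) (box_sub h.sh l (hU i hiJ))
      · have := (hτg t ht).2.1.1 (i - J) (by omega)
        rw [sh_apply, Nat.add_sub_cancel' (by omega)] at this
        exact (h.Vs (by omega) this).1
    have hinD : ∀ t ∈ τ, ∀ i ≤ J + t, W i ∈ D := fun t ht i hi => h.inD (by omega) (hin t ht i hi)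
    have hr : ∀ t ∈ τ, ∃ r, J + (t - g) ≤ r ∧ r < J + t ∧ W r ∈ B ∧ ∀ r' > r, (∀ k < r', W k ∈ D) → W r' ≠ W r := by
      intro t ht
      have hgt := (hτg t ht).1
      refine hB2 (J + (t - g)) (J + t) (by omega) ?_ fun i hi => hin t ht i hi.le
      intro i hi j hj hk he
      refine (hτg t ht).2.2 ⟨j - (J + t), ?_, fun k hk' => ?_⟩
      · rw [sh_apply, sh_apply, show J + (t + (j - (J + t))) = j by omega, he]
        by_cases hiJ : i < J
        · exact Or.inl (Or.inr (hU i hiJ))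
        · refine Or.inr (Finset.mem_coe.2 (Finset.mem_image.2 ⟨i - J, Finset.mem_range.2 (by omega), ?_⟩))
          rw [sh_apply, Nat.add_sub_cancel' (by omega)]
      · rw [sh_apply, sh_apply]; exact hk _ (by omega)
    choose! r hr1 hr2 hr3 hr4 using hr
    obtain ⟨τ', hsub, hcard, hsep⟩ := residue τ g hg
    have hlt : ∀ t ∈ τ', ∀ t' ∈ τ', t' < t → r t' < r t := by
      intro t ht t' ht' h1
      have := hsep t ht t' ht' h1
      have := hr1 t (hsub ht)
      have := hr2 t' (hsub ht')
      omega
    have hne : ∀ t ∈ τ', ∀ t' ∈ τ', t' < t → W (r t) ≠ W (r t') := by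
      intro t ht t' ht' h1
      refine hr4 t' (hsub ht') _ (hlt t ht t' ht' h1) fun k hk => hinD t (hsub ht) k ?_
      have := hr2 t (hsub ht); omega
    have key := energy hd hP hfin τ' (fun t => W (r t)) (by
      intro t ht
      refine ⟨?_, hr3 t (hsub ht)⟩
      have h1 := (hτg t (hsub ht)).2.1.2.1
      have h2 := hr1 t (hsub ht)
      have h3 := hr2 t (hsub ht)
      have h4 := nn_cube hW (r t) (J + t - r t)
      rw [Nat.add_sub_cancel' h3.le] at h4
      exact cube_mono (by omega) (cube_trans h1 (mem_cube_comm.1 h4))) (by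
      intro t ht t' ht' he
      by_contra hc
      rcases Nat.lt_or_gt_of_ne hc with h1 | h1
      · exact hne t' ht' t ht h1 he.symm
      · exact hne t ht t' ht' h1 he) (κ := (2 * d) ^ (d * g) * η) (by positivity) (by
      intro t ht
      have htg := (hτg t (hsub ht))
      have h2 := hr1 t (hsub ht)
      have h3 := hr2 t (hsub ht)
      have h4 := nn_cube hW (r t) (J + t - r t)
      rw [Nat.add_sub_cancel' h3.le] at h4
      have h4' : W (J + t) ∈ cube (W (r t)) g := cube_mono (by omega) h4
      calc ∑ t' ∈ τ'.filter (· < t), g0 (W (r t') - W (r t))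
          ≤ ∑ t' ∈ τ'.filter (· < t), (2 * d) ^ (d * g) * g0 (W (r t') - W (J + t)) := by
            refine Finset.sum_le_sum fun t' _ => ?_
            have := crude g0 (W (r t') - W (r t)) g g0_nonneg hd0 (fun x _ => g0_super hd x) (W (r t') - W (J + t)) (by
              intro i
              have := h4' i
              simp only [Pi.sub_apply]
              rw [abs_le] at *
              omega)
            rw [div_le_iff₀ (by positivity)] at this
            linarith
        _ = (2 * d) ^ (d * g) * ∑ t' ∈ τ'.filter (· < t), g0 (W (r t') - W (J + t)) := by rw [Finset.mul_sum]
        _ ≤ (2 * d) ^ (d * g) * η := by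
            refine mul_le_mul_of_nonneg_left (le_trans ?_ htg.2.1.2.2) (by positivity)
            have hinj : Set.InjOn (fun t' => r t' - J) (τ'.filter (· < t)) := by
              intro p hp q hq he
              have hp' := (Finset.mem_filter.1 (Finset.mem_coe.1 hp)).1
              have hq' := (Finset.mem_filter.1 (Finset.mem_coe.1 hq)).1
              have hp1 := hr1 p (hsub hp')
              have hq1 := hr1 q (hsub hq')
              simp only at he
              by_contra hc
              rcases Nat.lt_or_gt_of_ne hc with h1 | h1
              · have := hlt q hq' p hp' h1; omega
              · have := hlt p hp' q hq' h1; omega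
            unfold Gam
            calc _ = ∑ i ∈ (τ'.filter (· < t)).image (fun t' => r t' - J), g0 (sh J W i - sh J W t) := by
                  rw [Finset.sum_image hinj]
                  refine Finset.sum_congr rfl fun p hp => ?_
                  have hp1 := hr1 p (hsub (Finset.mem_filter.1 hp).1)
                  rw [sh_apply, sh_apply, Nat.add_sub_cancel' (by omega)]
              _ ≤ _ := by
                  refine Finset.sum_le_sum_of_subset_of_nonneg ?_ fun _ _ _ => g0_nonneg _
                  intro i hi
                  obtain ⟨p, hp, rfl⟩ := Finset.mem_image.1 hi
                  have hp' := Finset.mem_filter.1 hp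
                  have h5 := hsep t ht p hp'.1 hp'.2
                  have h6 := hr2 p (hsub hp'.1)
                  exact Finset.mem_range.2 (by omega))
    have hg' : (0 : ℝ) ≤ g := by positivity
    calc c2 * (m : ℝ) ^ 2 ≤ τ.card := hτc
      _ ≤ g * τ'.card := hcard
      _ ≤ g * (4 * (g0 (0 : V d) + 2 * ((2 * d) ^ (d * g) * η)) * capacity P (cube x1 (m / 4) ∩ B)) :=
          mul_le_mul_of_nonneg_left key hg'
      _ = _ := by ring
  · have hidx : ∀ v ∈ cube x1 (m / 4) ∩ B, ∃ i, sh J W i = v ∧ ∀ k < i, sh J W k ∈ D := by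
      rintro v ⟨hvA, hvB⟩
      obtain ⟨j, hj, hjD⟩ := hB1 v hvB
      have hJj : J ≤ j := by
        by_contra hc
        have h1 := (hU j (by omega)).1
        rw [hj] at h1
        have h2 := (h.near hvA).1
        rw [abs_le] at h1 h2
        omega
      refine ⟨j - J, ?_, fun k hk => hjD _ (by omega)⟩
      rw [sh_apply, Nat.add_sub_cancel' hJj, hj]
    choose! ix hix1 hix2 using hidx
    have hc := cap_le hP (B := cube x1 (m / 4) ∩ B) hfin.toFinset (by simp)
    refine hc.trans (le_trans (le_of_eq ?_) (hF (hfin.toFinset.image ix) ?_))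
    · rw [Finset.card_image_of_injOn]
      intro v hv v' hv' he
      rw [← hix1 v (by simpa using hv), ← hix1 v' (by simpa using hv'), he]
    · intro t ht
      obtain ⟨v, hv, rfl⟩ := Finset.mem_image.1 ht
      have hv' := hfin.mem_toFinset.1 hv
      exact ⟨by rw [hix1 v hv']; exact hv'.1, hix2 v hv'⟩

end

/-- the core statement at scale `m` -/
def Core (d : ℕ) (c C1 : ℝ) (m : ℕ) : Prop :=
  ∀ (P : V d → Measure (ℕ → V d)) (D a : Set (V d)) (N n : ℕ) (x0 : V d) (i0 : Fin d) (sg : ℤ) (x1 : V d), SRW P →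
    Geo D a N n m x0 i0 sg x1 →
    ∃ E : Set (ℕ → V d), MeasurableSet E ∧ E ⊆ avP D a ∧ c * (P x0).real (avP D a) ≤ (P x0).real E ∧
      ∀ W ∈ E, W 0 = x0 → (∀ i, adj (W i) (W (i + 1))) → ∀ B, I1 D W B → I2 D x0 m W B →
        c * (m : ℝ) ^ 2 ≤ capacity P (cube x1 (m / 4) ∩ B) ∧ capacity P (cube x1 (m / 4) ∩ B) ≤ C1 * (m : ℝ) ^ 2

lemma Core.mono {c c' C1 C1' : ℝ} {m : ℕ} (h : Core d c C1 m) (hc : c' ≤ c) (hC : C1 ≤ C1') : Core d c' C1' m := by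
  intro P D a N n x0 i0 sg x1 hP hG
  obtain ⟨E, h1, h2, h3, h4⟩ := h P D a N n x0 i0 sg x1 hP hG
  refine ⟨E, h1, h2, (mul_le_mul_of_nonneg_right hc measureReal_nonneg).trans h3, fun W hW a1 a2 B a3 a4 => ?_⟩
  obtain ⟨b1, b2⟩ := h4 W hW a1 a2 B a3 a4
  exact ⟨(mul_le_mul_of_nonneg_right hc (by positivity)).trans b1, b2.trans (mul_le_mul_of_nonneg_right hC (by positivity))⟩

lemma large (hd : 5 ≤ d) : ∃ (M : ℕ) (c C1 : ℝ), 0 < c ∧ 0 < C1 ∧ ∀ m, M ≤ m → Core d c C1 m := by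
  have hd0 : 0 < d := by omega
  obtain ⟨K0, g, M0, c2, c3, C', η, C, hK0, hg, hM0, hc2, hc3, hC', hη, hC, H⟩ := fromY hd
  set R : ℝ := g * (4 * (g0 (0 : V d) + 2 * ((2 * d) ^ (d * g) * η))) with hR
  have hR0 : 0 < R := by
    have := one_le_g0 hd
    have : (1 : ℝ) ≤ g := by exact_mod_cast hg
    positivity
  refine ⟨M0 + 100 * g, min (c3 / (C * (1 + 8 * d))) (c2 / R), C', lt_min (by positivity) (by positivity), hC', ?_⟩
  intro m hm P D a N n x0 i0 sg x1 hP h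
  obtain ⟨hH, E2, hE2m, hE2, hE2p⟩ := H P D a N n m x0 i0 sg x1 hP h (by omega)
  set s := m / K0 with hs
  set l := 3 * d * s with hl
  have hdd : 25 ≤ d * d := Nat.mul_le_mul hd hd
  have hK0' : 100 * (d * d) ≤ K0 := by rw [← mul_assoc]; exact hK0
  have hKm : K0 ≤ m := by
    have : K0 ≤ 2 * d * K0 := Nat.le_mul_of_pos_left _ (by omega)
    omega
  have hs1 : 1 ≤ s := (Nat.one_le_div_iff (by omega)).2 hKm
  have hsm : s * K0 ≤ m := Nat.div_mul_le_self m K0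
  have hsm2 : 100 * (d * d * s) ≤ m := by
    calc 100 * (d * d * s) = s * (100 * (d * d)) := by ring
      _ ≤ s * K0 := Nat.mul_le_mul_left _ hK0'
      _ ≤ m := hsm
  have h5 : 25 * s ≤ d * d * s := Nat.mul_le_mul_right _ hdd
  have h6 : 5 * (d * s) ≤ d * d * s := by rw [mul_assoc]; exact Nat.mul_le_mul_right _ hd
  have hds : 1 ≤ d * s := Nat.mul_pos hd0 hs1
  have el : l = 3 * (d * s) := by rw [hl]; ring
  have el2 : 2 * d * l = 6 * (d * d * s) := by rw [hl]; ring
  have hlm : 2 * d * l + 2 ≤ m := by rw [el2]; omega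
  have hl4 : 4 * l + 4 ≤ m := by rw [el]; omega
  have hl1 : 1 ≤ l := by omega
  have hsg : 2 * s + g ≤ m / 4 := by omega
  have hprob := large_prob hd hP h hl1 hlm hC hc3 hH hE2m hE2
  have hUD : box n x0 i0 sg l ⊆ D := (box_sub h.sh l).trans (h.inD (by omega))
  refine ⟨_, meas_sh 1 (hbT_meas (box n x0 i0 sg l \ a) (gface n x0 i0 sg l) hE2m), ?_, ?_, ?_⟩
  · rintro W ⟨j, hj, hjE⟩ ⟨k, hk, hkD⟩
    by_cases hkj : k < j
    · exact (hj.2 k hkj).1.2 hk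
    · refine (hE2p _ hjE).1 ⟨k - j, ?_, fun i hi => ?_⟩
      · rw [sh_apply, Nat.add_sub_cancel' (by omega)]; exact hk
      · rw [sh_apply]; exact hkD _ (by omega)
  · exact (mul_le_mul_of_nonneg_right (min_le_left _ _) measureReal_nonneg).trans hprob
  · rintro W ⟨j, hj, hjE⟩ W0 hW B hB1 hB2
    rw [sh_sh] at hjE
    obtain ⟨-, hτ, hF⟩ := hE2p _ hjE
    have := large_det hd hP h hlm hl4 hg hsg hc2 hη W0 hW (J := 1 + j) (by omega) (by
      intro i hi1 hij
      have := (hj.2 (i - 1) (by omega)).1.1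
      rwa [sh_apply, Nat.add_sub_cancel' hi1] at this) hτ hF hB1 hB2
    refine ⟨?_, this.2⟩
    refine (mul_le_mul_of_nonneg_right (min_le_right _ _) (by positivity)).trans ?_
    rw [div_mul_eq_mul_div, div_le_iff₀ hR0]
    linarith [this.1]

def ray (x0 : V d) (i0 : Fin d) (sg : ℤ) (i : ℕ) : V d := fun j => x0 j + if j = i0 then sg * i else 0

lemma ray_adj (x0 : V d) (i0 : Fin d) {sg : ℤ} (h : sg = 1 ∨ sg = -1) (i : ℕ) :
    adj (ray x0 i0 sg i) (ray x0 i0 sg (i + 1)) := by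
  refine adj_iff.2 ⟨i0, ?_⟩
  rcases h with e | e <;> subst e
  · left; ext j; by_cases hj : j = i0
    · subst hj; simp [ray, ee]; ring
    · simp [ray, ee, hj]
  · right; ext j; by_cases hj : j = i0
    · subst hj; simp [ray, ee]; ring
    · simp [ray, ee, hj]

section
variable {P : V d → Measure (ℕ → V d)} {D a : Set (V d)} {N n m : ℕ} {x0 : V d} {i0 : Fin d} {sg : ℤ} {x1 : V d}

lemma lev_ray (h : Shell D a N n x0 i0 sg) (i : ℕ) : lev n i0 sg (ray x0 i0 sg i) = i := by
  rw [h.lev_eq]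
  rcases h.sg1 with e | e <;> simp [e, ray]

lemma Shell.ray_not (h : Shell D a N n x0 i0 sg) {i : ℕ} (hi : 1 ≤ i) : ray x0 i0 sg i ∉ a := fun hc => by
  have := h.lev_le hc
  rw [lev_ray h] at this; omega

lemma Geo.ray_x1 (h : Geo D a N n m x0 i0 sg x1) : ray x0 i0 sg (m / 2) = x1 := by
  ext j
  by_cases hj : j = i0
  · subst hj
    have h1 := h.l1
    rw [h.sh.lev_eq] at h1
    simp only [ray, if_true]
    rcases h.sh.sg1 with e | e <;> subst e <;> omega
  · simp [ray, hj, h.lat j hj]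

lemma small_q (hd : 5 ≤ d) (hP : SRW P) (h : Geo D a N n m x0 i0 sg x1) (hm : 1 ≤ m) {T : ℕ} (hT : 2 * m ≤ T)
    (hT2 : (d + 20) * (m : ℝ) ^ 2 * 2 / lam d ≤ T) :
    lam d / (2 * (2 * d) ^ (d * m)) * (P x0).real (avP D a) ≤ hh P D (a ∪ cube x0 m) (ray x0 i0 sg (2 * T)) := by
  have hd0 : 0 < d := by omega
  have hl := lam_pos (d := d)
  obtain ⟨y, hyQ, hy⟩ := Set.exists_max_image (cube x0 m) (hh P D a) (cube_finite _ _) ⟨x0, self_mem_cube _ _⟩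
  set S := hh P D a y with hS
  have hS0 : 0 ≤ S := hh_nonneg hP _ _ _
  have hp : (P x0).real (avP D a) ≤ S := by
    rw [avP_real hd0 hP]
    exact avg_le_of_le hd0 fun i => ⟨hy _ (cube_mono hm (add_ee_mem x0 i).1), hy _ (cube_mono hm (add_ee_mem x0 i).2)⟩
  have hlevQ : ∀ z ∈ cube x0 m, |lev n i0 sg z| ≤ m := by
    intro z hz
    have := hz i0
    rw [h.sh.lev_eq]
    rw [abs_le] at *
    rcases h.sh.sg1 with e | e <;> subst e <;> omega
  have hly := hlevQ y hyQ
  rw [abs_le] at hly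
  set ys := refl' n i0 sg T y with hys
  have hlys : lev n i0 sg ys = 2 * T - lev n i0 sg y := lev_refl' h.sh.sg1 T y
  have hlat : ∀ j, j ≠ i0 → ys j = y j := by
    intro j hj; simp [hys, refl', rfl', hj]
  have h1 : lam d * S ≤ hh P D a ys := reflH hd hP h.sh T y (by omega)
  have h2 : hb P Set.univ (cube x0 m) ys ≤ lam d / 2 := by
    refine (hb_cube hd hP Set.univ x0 m hm ys).trans ?_
    have hT1 : (1 : ℝ) ≤ T := by exact_mod_cast (by omega : 1 ≤ T)
    have h3 : (T : ℝ) ≤ nsq (ys - x0) := by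
      refine le_trans ?_ (sq_le_nsq (ys - x0) i0)
      have h4 : (T : ℝ) ≤ (lev n i0 sg ys : ℝ) := by
        have : (T : ℤ) ≤ lev n i0 sg ys := by omega
        exact_mod_cast this
      have h5 : (((ys - x0) i0 : ℤ) : ℝ) ^ 2 = (lev n i0 sg ys : ℝ) ^ 2 := by
        rw [h.sh.lev_eq]
        rcases h.sh.sg1 with e | e <;> rw [e] <;> push_cast <;> simp only [Pi.sub_apply] <;> push_cast <;> ring
      rw [h5]; nlinarith
    rw [div_le_iff₀ hl] at hT2
    have hn0 := nsq_nonneg (ys - x0)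
    rw [div_le_iff₀ (by positivity)]
    have : 0 ≤ lam d * (20 * (m : ℝ) ^ 2) := by positivity
    nlinarith
  have h3 := hh_union hd0 hP hS0 hy ys
  have h4 : lam d * S / 2 ≤ hh P D (a ∪ cube x0 m) ys := by nlinarith
  have h5 := crude (hh P D (a ∪ cube x0 m)) ys m (fun x => hh_nonneg hP _ _ x) hd0 (by
    intro x hx
    refine hh_super hd0 hP ?_
    have hx0 := hx i0
    have e1 : lev n i0 sg x - lev n i0 sg ys = sg * (x i0 - ys i0) := by unfold lev; ring
    have hlx : 2 * (T : ℤ) - 2 * m ≤ lev n i0 sg x := by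
      rw [abs_le] at hx0
      rcases h.sh.sg1 with e | e <;> rw [e] at e1 ⊢ <;> rw [e] at hlys hly <;> omega
    rintro (hc | hc)
    · have := h.sh.lev_le hc; omega
    · have := hlevQ x hc; rw [abs_le] at this; omega) (ray x0 i0 sg (2 * T)) (by
    intro j
    by_cases hj : j = i0
    · subst hj
      have e1 := lev_ray h.sh (2 * T)
      rw [h.sh.lev_eq] at e1 hlys hly
      rw [h.sh.lev_eq] at hlys
      rw [abs_le]
      push_cast at e1
      rcases h.sh.sg1 with e | e <;> subst e <;> omega
    · have := hyQ j
      rw [hlat j hj]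
      simp only [ray, hj, if_false, add_zero]
      rw [abs_le] at *; omega)
  have hpos : (0 : ℝ) < (2 * d) ^ (d * m) := by positivity
  refine le_trans ?_ h5
  rw [div_mul_eq_mul_div, div_le_div_iff₀ (by positivity) hpos]
  have h6 : lam d * (P x0).real (avP D a) ≤ 2 * hh P D (a ∪ cube x0 m) ys := by nlinarith
  calc _ ≤ 2 * hh P D (a ∪ cube x0 m) ys * (2 * d) ^ (d * m) := mul_le_mul_of_nonneg_right h6 hpos.le
    _ = _ := by ring

end

lemma small (hd : 5 ≤ d) (m : ℕ) (hm : 1 ≤ m) : ∃ c C1 : ℝ, 0 < c ∧ 0 < C1 ∧ Core d c C1 m := by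
  have hd0 : 0 < d := by omega
  have hl := lam_pos (d := d)
  have hg := one_le_g0 hd
  set T : ℕ := 2 * m + ⌈(d + 20) * (m : ℝ) ^ 2 * 2 / lam d⌉₊ with hT
  have hT2 : (d + 20) * (m : ℝ) ^ 2 * 2 / lam d ≤ T :=
    (Nat.le_ceil _).trans (Nat.cast_le.2 (Nat.le_add_left _ _))
  have hT1 : 2 * m ≤ T := Nat.le_add_right _ _
  clear_value T
  set c0 : ℝ := lam d / (2 * (2 * d) ^ (d * m)) with hc0
  have hm1 : (1 : ℝ) ≤ m := by exact_mod_cast hm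
  refine ⟨min ((1 / (2 * d)) ^ (2 * T) * c0) (1 / (g0 (0 : V d) * m ^ 2)), (2 * (m / 4 : ℕ) + 1) ^ d, lt_min (by positivity) (by positivity),
    by positivity, ?_⟩
  intro P D a N n x0 i0 sg x1 hP h
  set γ := ray x0 i0 sg with hγ
  set R := (hbE D (a ∪ cube x0 m))ᶜ with hR
  have hRm : MeasurableSet R := (hbE_meas _ _).compl
  have hlevQ : ∀ z ∈ cube x0 m, lev n i0 sg z ≤ m := by
    intro z hz
    have := hz i0
    rw [h.sh.lev_eq]
    rw [abs_le] at *
    rcases h.sh.sg1 with e | e <;> subst e <;> omega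
  have hcd : Dep (2 * T) (· ∈ cyl γ (2 * T)) := by
    intro ω ω' e
    refine propext (forall₂_congr fun i hi => ?_)
    rw [e i hi]
  refine ⟨{ω | ω ∈ cyl γ (2 * T) ∧ sh (2 * T) ω ∈ R}, meas_R (R := fun ω => {ω' | ω ∈ cyl γ (2 * T) ∧ ω' ∈ R})
    (fun ω ω' e => by
      have := hcd ω ω' e
      simp only at this
      simp only [this]) (fun ω => ?_), ?_, ?_, ?_⟩
  · by_cases hω : ω ∈ cyl γ (2 * T)
    · simpa [hω] using hRm
    · simp [hω]
  · rintro W ⟨hWc, hWR⟩ ⟨k, hk, hkD⟩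
    rw [sh_apply] at hk
    by_cases hk2 : 1 + k ≤ 2 * T
    · rw [hWc _ hk2] at hk
      exact h.sh.ray_not (by omega) hk
    · refine hWR ⟨1 + k - 2 * T, Or.inl ?_, fun i hi => ?_⟩
      · rw [sh_apply, Nat.add_sub_cancel' (by omega)]; exact hk
      · have := hkD (2 * T + i - 1) (by omega)
        rw [sh_apply] at this ⊢
        rwa [show 1 + (2 * T + i - 1) = 2 * T + i by omega] at this
  · have := fun x => (hP x).1
    have hq := small_q hd hP h hm hT1 hT2
    have h1 := mk_ge hd0 hP (hP x0) hcd (R := fun _ => R) (fun _ _ _ => rfl) (fun _ => hRm)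
      (M := P (γ (2 * T)) R) (fun ω hω => by rw [hω (2 * T) le_rfl])
    rw [law_cyl (hP x0) (by ext j; simp [ray]) (fun i _ => ray_adj x0 i0 h.sh.sg1 i)] at h1
    have h2 := ENNReal.toReal_mono (measure_ne_top _ _) h1
    rw [ENNReal.toReal_mul, ENNReal.toReal_pow, ENNReal.toReal_inv, ENNReal.toReal_mul] at h2
    rw [hh_eq hP] at hq
    refine le_trans ?_ h2
    simp only [ENNReal.toReal_ofNat, ENNReal.toReal_natCast]
    calc _ ≤ (1 / (2 * d)) ^ (2 * T) * c0 * (P x0).real (avP D a) :=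
          mul_le_mul_of_nonneg_right (min_le_left _ _) measureReal_nonneg
      _ = (1 / (2 * d)) ^ (2 * T) * (c0 * (P x0).real (avP D a)) := by ring
      _ ≤ (1 / (2 * d)) ^ (2 * T) * (P (γ (2 * T))).real R := mul_le_mul_of_nonneg_left hq (by positivity)
      _ = _ := by rw [one_div, mul_comm]; rfl
  · rintro W ⟨hWc, hWR⟩ W0 hW B hB1 hB2
    have hWx : W (m / 2) = x1 := by rw [hWc _ (by omega), hγ, h.ray_x1]
    obtain ⟨r, hr1, hr2, hr3, -⟩ := hB2 (m / 2) (m / 2 + 1) (by omega) (by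
      intro i hi j hj hD he
      by_cases hj2 : j ≤ 2 * T
      · rw [hWc j hj2, hWc i (by omega)] at he
        have e1 := lev_ray h.sh i
        have e2 := lev_ray h.sh j
        rw [← hγ] at e1 e2
        rw [he, e1] at e2
        omega
      · refine hWR ⟨j - 2 * T, Or.inr ?_, fun k hk => ?_⟩
        · rw [sh_apply, Nat.add_sub_cancel' (by omega), he]
          have := nn_cube hW 0 i
          rw [zero_add, W0] at this
          exact cube_mono (by omega) this
        · rw [sh_apply]; exact hD _ (by omega)) (by
      intro i hi
      have := nn_cube hW 0 i
      rw [zero_add, W0] at this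
      exact cube_mono (by omega) this)
    have er : r = m / 2 := by omega
    rw [er, hWx] at hr3
    have hfin : (cube x1 (m / 4) ∩ B).Finite := (cube_finite _ _).subset Set.inter_subset_left
    constructor
    · have := cap_ge hd hP hfin {x1} (by simpa using ⟨self_mem_cube _ _, hr3⟩) (K := g0 (0 : V d)) (by linarith) (by simp)
      simp only [Finset.card_singleton, Nat.cast_one] at this
      refine (mul_le_mul_of_nonneg_right (min_le_right _ _) (by positivity)).trans ?_
      rw [div_mul_eq_mul_div, div_le_iff₀ (by positivity)]
      nlinarith [sq_nonneg (m : ℝ)]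
    · have := cap_le hP (B := cube x1 (m / 4) ∩ B) (cube_finite x1 (m / 4)).toFinset (by simp)
      rw [cube_card] at this
      refine this.trans ?_
      push_cast
      refine le_mul_of_one_le_right (by positivity) (by nlinarith)

lemma core (hd : 5 ≤ d) : ∃ c C1 : ℝ, 0 < c ∧ 0 < C1 ∧ ∀ m, 1 ≤ m → Core d c C1 m := by
  obtain ⟨M, c, C1, hc, hC1, H⟩ := large hd
  have key : ∀ k, ∃ c C1 : ℝ, 0 < c ∧ 0 < C1 ∧ ∀ m, 1 ≤ m → (M ≤ m ∨ m < k) → Core d c C1 m := by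
    intro k
    induction k with
    | zero => exact ⟨c, C1, hc, hC1, fun m _ h => H m (by omega)⟩
    | succ k ih =>
      obtain ⟨c, C1, hc, hC1, H⟩ := ih
      rcases Nat.eq_zero_or_pos k with h0 | h0
      · exact ⟨c, C1, hc, hC1, fun m h1 h => H m h1 (by omega)⟩
      obtain ⟨c', C1', hc', hC1', H'⟩ := small hd k h0
      refine ⟨min c c', max C1 C1', lt_min hc hc', lt_max_of_lt_left hC1, fun m h1 h => ?_⟩
      by_cases hk : m = k
      · subst hk; exact H'.mono (min_le_right _ _) (le_max_right _ _)
      · exact (H m h1 (by omega)).mono (min_le_left _ _) (le_max_left _ _)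
  obtain ⟨c, C1, hc, hC1, H⟩ := key M
  exact ⟨c, C1, hc, hC1, fun m h1 => H m h1 (by omega)⟩

lemma adj_cube {x y : V d} (h : adj x y) : y ∈ cube x 1 := by
  obtain ⟨j, h | h⟩ := adj_iff.1 h <;> rw [h]
  exacts [(add_ee_mem _ j).1, (add_ee_mem _ j).2]

lemma not_inner {x v : V d} {m : ℕ} (hm : 1 ≤ m) (h : v ∈ cube x (m - 1)) : v ∉ innerBdry (cube x m) := by
  rintro ⟨-, y, hy, hc⟩
  have := cube_trans h (adj_cube hy)
  rw [Nat.sub_add_cancel hm] at this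
  exact hc this

lemma inner_coord {x z : V d} {r : ℕ} (h : x ∈ innerBdry (cube z r)) : ∃ i, |x i - z i| = r := by
  obtain ⟨hx, y, hy, hc⟩ := h
  rw [mem_cube] at hc
  push Not at hc
  obtain ⟨i, hi⟩ := hc
  refine ⟨i, le_antisymm (hx i) ?_⟩
  have := adj_cube hy i
  by_contra hlt
  push Not at hlt
  rw [abs_lt] at hlt
  rw [abs_le] at this
  rw [lt_abs] at hi
  push_cast at this
  omega

lemma exit_le {D : Set (V d)} {ω : ℕ → V d} {j : ℕ} : (j : ENat) ≤ exitTimeE D ω ↔ ∀ i < j, ω i ∈ D := by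
  unfold exitTimeE
  split_ifs with h
  · rw [Nat.cast_le, Nat.le_find_iff]
    simp
  · push Not at h
    simp [h]

lemma st1 {D : Set (V d)} {ω : ℕ → V d} {j : ℕ} (h : ∀ i < j, ω i ∈ D) : stopAt D ω j = ω j :=
  if_pos (exit_le.2 h)

lemma st2 {D : Set (V d)} {ω : ℕ → V d} {j : ℕ} (h : stopAt D ω j ∈ D) : ∀ i ≤ j, ω i ∈ D := by
  by_cases hj : ∀ i < j, ω i ∈ D
  · rw [st1 hj] at h
    intro i hi
    rcases hi.lt_or_eq with h1 | h1
    · exact hj i h1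
    · rwa [h1]
  · exfalso
    have h1 : stopAt D ω j = ω (exitTime D ω) := if_neg (fun hc => hj (exit_le.1 hc))
    push Not at hj
    obtain ⟨i, -, hi⟩ := hj
    have hex : ∃ i, ω i ∉ D := ⟨i, hi⟩
    have h2 : exitTime D ω = Nat.find hex := by
      unfold exitTime exitTimeE
      rw [dif_pos hex]; rfl
    rw [h1, h2] at h
    exact Nat.find_spec hex h

lemma st3 {D : Set (V d)} {ω : ℕ → V d} {j : ℕ} (h : stopAt D ω j ∈ D) : stopAt D ω j = ω j :=
  st1 fun i hi => st2 h i hi.le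

structure SP (D : Set (V d)) (S : ℕ → V d) : Prop where
  nn : ∀ j, S j ∈ D → adj (S j) (S (j + 1))
  fin : ∀ p ∈ D, {j | S j = p}.Finite

def nice (ω : ℕ → V d) : Prop := ω 0 = 0 ∧ (∀ i, adj (ω i) (ω (i + 1))) ∧ ∀ u : V d, {j | ω j = u}.Finite

lemma nice.sp {ω : ℕ → V d} (h : nice ω) (D : Set (V d)) : SP D (stopAt D ω) := by
  constructor
  · intro j hj
    rw [st3 hj, st1 (j := j + 1) fun i hi => st2 hj i (by omega)]
    exact h.2.1 j
  · intro p hp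
    refine (h.2.2 p).subset fun j hj => ?_
    have hj' : stopAt D ω j = p := hj
    change ω j = p
    rw [← hj', st3 (by rw [hj']; exact hp)]

section
variable {D : Set (V d)} {S : ℕ → V d}

lemma SP.last (h : SP D S) {t : ℕ} (ht : S t ∈ D) : t ≤ lastVisit S t ∧ S (lastVisit S t) = S t ∧
    ∀ j > lastVisit S t, S j ≠ S t := by
  have hf : {j | t ≤ j ∧ S j = S t}.Finite := (h.fin _ ht).subset fun j hj => hj.2
  have hm : lastVisit S t ∈ {j | t ≤ j ∧ S j = S t} := Nat.sSup_mem ⟨t, le_rfl, rfl⟩ hf.bddAbove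
  refine ⟨hm.1, hm.2, fun j hj he => ?_⟩
  have : j ≤ lastVisit S t := le_csSup hf.bddAbove ⟨hm.1.trans hj.le, he⟩
  omega

lemma SP.step (h : SP D S) {k : ℕ} (hk : S (leTime S k + 1) ∈ D) : leTime S k < leTime S (k + 1) ∧
    S (leTime S (k + 1)) = S (leTime S k + 1) ∧ ∀ j > leTime S (k + 1), S j ≠ S (leTime S (k + 1)) := by
  obtain ⟨h1, h2, h3⟩ := h.last hk
  have e : leTime S (k + 1) = lastVisit S (leTime S k + 1) := rfl
  rw [e]
  exact ⟨by omega, h2, fun j hj => by rw [h2]; exact h3 j hj⟩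

lemma SP.cstep (h : SP D S) {z : V d} {r : ℕ} (hD : cube z r ⊆ D) {k : ℕ} (hk : S (leTime S k) ∈ cube z r)
    (hn : S (leTime S k) ∉ innerBdry (cube z r)) : S (leTime S k + 1) ∈ cube z r := by
  by_contra hc
  exact hn ⟨hk, _, h.nn _ (hD hk), hc⟩

lemma SP.seg (h : SP D S) {z : V d} {r : ℕ} (hD : cube z r ⊆ D) {k1 : ℕ} (hk : S (leTime S k1) ∈ cube z r)
    (q : ℕ) (hn : ∀ j, k1 ≤ j → j < k1 + q → S (leTime S j) ∉ innerBdry (cube z r)) :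
    S (leTime S (k1 + q)) ∈ cube z r ∧ leTime S k1 + q ≤ leTime S (k1 + q) := by
  induction q with
  | zero => exact ⟨hk, le_rfl⟩
  | succ q ih =>
    obtain ⟨i1, i2⟩ := ih fun j h1 h2 => hn j h1 (by omega)
    have h1 := h.cstep hD i1 (hn _ (by omega) (by omega))
    have h2 := h.step (hD h1)
    rw [← add_assoc, h2.2.1]
    exact ⟨h1, by omega⟩

lemma SP.hit (h : SP D S) {z : V d} {r : ℕ} (hD : cube z r ⊆ D) {k1 : ℕ} (hk : S (leTime S k1) ∈ cube z r) :
    ∃ k, k1 ≤ k ∧ S (leTime S k) ∈ innerBdry (cube z r) := by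
  by_contra hc
  push Not at hc
  have key := fun q => h.seg hD hk q fun j h1 _ => hc j h1
  have hfin : (⋃ p ∈ cube z r, {j | S j = p}).Finite := (cube_finite z r).biUnion fun p hp => h.fin p (hD hp)
  obtain ⟨b, hb'⟩ := hfin.bddAbove
  have h1 := (key (b + 1)).2
  have h2 : leTime S (k1 + (b + 1)) ≤ b := hb' (Set.mem_biUnion (key (b + 1)).1 rfl)
  omega

end

lemma hitIdx_eq {A : Set (V d)} {γ : ℕ → V d} (h : ∃ j, γ j ∈ A) :
    γ (hitIdx A γ) ∈ A ∧ ∀ j < hitIdx A γ, γ j ∉ A := by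
  have e : hitIdx A γ = Nat.find h := by unfold hitIdx hitTimeE; rw [dif_pos h]; rfl
  rw [e]
  exact ⟨Nat.find_spec h, fun j hj => Nat.find_min h hj⟩

lemma hitIdx_uniq {A : Set (V d)} {γ : ℕ → V d} {k : ℕ} (h : γ k ∈ A) (h2 : ∀ j < k, γ j ∉ A) : hitIdx A γ = k := by
  obtain ⟨h3, h4⟩ := hitIdx_eq ⟨k, h⟩
  rcases lt_trichotomy (hitIdx A γ) k with h5 | h5 | h5
  · exact absurd h3 (h2 _ h5)
  · exact h5
  · exact absurd h (h4 _ h5)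

lemma hitIdxFrom_eq {A : Set (V d)} {γ : ℕ → V d} {t : ℕ} (h : ∃ j, t ≤ j ∧ γ j ∈ A) :
    t ≤ hitIdxFrom A t γ ∧ γ (hitIdxFrom A t γ) ∈ A ∧ ∀ j, t ≤ j → j < hitIdxFrom A t γ → γ j ∉ A := by
  have e : hitIdxFrom A t γ = Nat.find h := by unfold hitIdxFrom; rw [dif_pos h]
  rw [e]
  exact ⟨(Nat.find_spec h).1, (Nat.find_spec h).2, fun j h1 h2 hc => Nat.find_min h h2 ⟨h1, hc⟩⟩

noncomputable def kk (D : Set (V d)) (n : ℕ) (ω : ℕ → V d) : ℕ := hitIdx (innerBdry (cube 0 n)) (lerw D ω)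

noncomputable def sig (D : Set (V d)) (n : ℕ) (ω : ℕ → V d) : ℕ := leTime (stopAt D ω) (kk D n ω)

section
variable {D : Set (V d)} {n : ℕ} {ω : ℕ → V d}

lemma start (hω : nice ω) (hD : cube 0 n ⊆ D) : stopAt D ω (leTime (stopAt D ω) 0) ∈ cube 0 n ∧
    ∀ j > leTime (stopAt D ω) 0, stopAt D ω j ≠ stopAt D ω (leTime (stopAt D ω) 0) := by
  have h0 : stopAt D ω 0 = 0 := by rw [st1 (by simp), hω.1]
  have h1 : stopAt D ω 0 ∈ cube 0 n := by rw [h0]; exact self_mem_cube _ _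
  obtain ⟨-, h2, h3⟩ := (hω.sp D).last (hD h1)
  have e : leTime (stopAt D ω) 0 = lastVisit (stopAt D ω) 0 := rfl
  rw [e, h2]
  exact ⟨h1, h3⟩

lemma alpha_spec (hω : nice ω) (hD : cube 0 n ⊆ D) :
    lerw D ω (kk D n ω) ∈ innerBdry (cube 0 n) ∧ (∀ k < kk D n ω, lerw D ω k ∉ innerBdry (cube 0 n)) ∧
    (∀ k ≤ kk D n ω, lerw D ω k ∈ cube 0 n ∧ ∀ j > leTime (stopAt D ω) k, stopAt D ω j ≠ lerw D ω k) ∧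
    (∀ k < kk D n ω, leTime (stopAt D ω) k < leTime (stopAt D ω) (k + 1)) := by
  have hS := hω.sp D
  have hs := start hω hD
  obtain ⟨k, -, hk⟩ := hS.hit hD hs.1
  obtain ⟨h1, h2⟩ := hitIdx_eq (γ := lerw D ω) ⟨k, hk⟩
  have hc : ∀ k ≤ kk D n ω, lerw D ω k ∈ cube 0 n := by
    intro k hk
    have := (hS.seg hD hs.1 k fun j _ hj => h2 j (by unfold kk at hk; omega)).1
    rwa [zero_add] at this
  have hst : ∀ k < kk D n ω, _ := fun k hk =>
    hS.step (k := k) (hD (hS.cstep hD (hc k hk.le) (h2 k hk)))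
  refine ⟨h1, h2, fun k hk => ⟨hc k hk, ?_⟩, fun k hk => (hst k hk).1⟩
  cases k with
  | zero => exact hs.2
  | succ k => exact (hst k (by omega)).2.2

lemma le_sig (hω : nice ω) (hD : cube 0 n ⊆ D) {k : ℕ} (hk : k ≤ kk D n ω) : leTime (stopAt D ω) k ≤ sig D n ω := by
  have h := (alpha_spec hω hD).2.2.2
  obtain ⟨q, hq⟩ := Nat.exists_eq_add_of_le hk
  unfold sig
  have : ∀ p, p ≤ q → leTime (stopAt D ω) k ≤ leTime (stopAt D ω) (k + p) := by
    intro p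
    induction p with
    | zero => intro _; exact le_rfl
    | succ p ih => intro hp; exact (ih (by omega)).trans (h (k + p) (by omega)).le
  rw [hq]; exact this q le_rfl

lemma mem_alpha {v : V d} : v ∈ alphaList D n ω ↔ ∃ k ≤ kk D n ω, lerw D ω k = v := by
  unfold alphaList kk
  simp only [List.mem_map, List.mem_range, Nat.lt_succ_iff]

lemma end_alpha : endPt (alphaList D n ω) = lerw D ω (kk D n ω) := by
  unfold endPt alphaList kk
  simp [List.range_succ]

lemma alpha_geo (hω : nice ω) (hD : cube 0 n ⊆ D) : (∀ v ∈ alphaList D n ω, v ∈ cube 0 n) ∧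
    endPt (alphaList D n ω) ∈ alphaList D n ω ∧ endPt (alphaList D n ω) ∈ innerBdry (cube 0 n) := by
  have h := alpha_spec hω hD
  refine ⟨fun v hv => ?_, ?_, ?_⟩
  · obtain ⟨k, hk, rfl⟩ := mem_alpha.1 hv
    exact (h.2.2.1 k hk).1
  · rw [end_alpha]; exact mem_alpha.2 ⟨_, le_rfl, rfl⟩
  · rw [end_alpha]; exact h.1

lemma alpha_sig (hω : nice ω) (hD : cube 0 n ⊆ D) : stopAt D ω (sig D n ω) = endPt (alphaList D n ω) ∧
    ω (sig D n ω) = endPt (alphaList D n ω) ∧ (∀ i ≤ sig D n ω, ω i ∈ D) ∧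
    ∀ j > sig D n ω, stopAt D ω j ∉ alphaList D n ω := by
  have h := alpha_spec hω hD
  have e : stopAt D ω (sig D n ω) = endPt (alphaList D n ω) := by rw [end_alpha]; rfl
  have hin : stopAt D ω (sig D n ω) ∈ D := by
    rw [e, end_alpha]; exact hD (h.2.2.1 _ le_rfl).1
  refine ⟨e, by rw [← e, st3 hin], st2 hin, fun j hj hc => ?_⟩
  obtain ⟨k, hk, hk2⟩ := mem_alpha.1 hc
  exact (h.2.2.1 k hk).2 j (lt_of_le_of_lt (le_sig hω hD hk) hj) hk2.symm

lemma avoid_of (hω : nice ω) (hD : cube 0 n ⊆ D) :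
    sh (sig D n ω) ω ∈ avP D {v | v ∈ alphaList D n ω} := by
  obtain ⟨-, -, h3, h4⟩ := alpha_sig hω hD
  rintro ⟨j, hj, hjD⟩
  rw [sh_sh, sh_apply] at hj
  refine h4 (sig D n ω + 1 + j) (by omega) ?_
  rw [st1]
  · exact hj
  · intro i hi
    by_cases h : i ≤ sig D n ω
    · exact h3 i h
    · have := hjD (i - (sig D n ω + 1)) (by omega)
      rwa [sh_sh, sh_apply, Nat.add_sub_cancel' (by omega)] at this

lemma transfer {ω' : ℕ → V d} (hω' : nice ω') (hD : cube 0 n ⊆ D)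
    (hag : ∀ i ≤ sig D n ω', ω i = ω' i)
    (hav : sh (sig D n ω') ω ∈ avP D {v | v ∈ alphaList D n ω'}) :
    alphaList D n ω = alphaList D n ω' ∧ sig D n ω = sig D n ω' := by
  obtain ⟨-, -, hinD, hav'⟩ := alpha_sig hω' hD
  set t := sig D n ω' with ht
  set S := stopAt D ω with hS
  set S' := stopAt D ω' with hS'
  have hsp := alpha_spec hω' hD
  have hagS : ∀ i ≤ t, S i = S' i := by
    intro i hi
    rw [hS, hS', st1 (fun j hj => hinD j (by omega)), st1 (fun j hj => by rw [hag j (by omega)]; exact hinD j (by omega)), hag i hi]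
  have hno : ∀ j > t, S j ∉ alphaList D n ω' := by
    intro j hj hc
    have hjD : S j ∈ D := hD ((alpha_geo hω' hD).1 _ hc)
    refine hav ⟨j - (t + 1), ?_, fun i hi => ?_⟩
    · rw [sh_sh, sh_apply, Nat.add_sub_cancel' (by omega), ← st3 hjD]; exact hc
    · rw [sh_sh, sh_apply]; exact st2 hjD _ (by omega)
  have lv : ∀ s ≤ t, S' s ∈ alphaList D n ω' → lastVisit S s = lastVisit S' s := by
    intro s hs hsa
    unfold lastVisit
    congr 1
    ext j
    change (s ≤ j ∧ S j = S s) ↔ (s ≤ j ∧ S' j = S' s)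
    rw [hagS s hs]
    by_cases hj : j ≤ t
    · rw [hagS j hj]
    · constructor
      · rintro ⟨-, h2⟩; exact absurd (h2 ▸ hsa) (hno j (by omega))
      · rintro ⟨-, h2⟩; exact absurd (h2 ▸ hsa) (hav' j (by omega))
  have hle : ∀ k ≤ kk D n ω', leTime S k = leTime S' k := by
    intro k
    induction k with
    | zero =>
      intro _
      have h0 : S' (leTime S' 0) = S' 0 := by
        have h1 : stopAt D ω' 0 ∈ D := by
          rw [st1 (by simp), hω'.1]; exact hD (self_mem_cube _ _)
        exact ((hω'.sp D).last h1).2.1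
      exact lv 0 (Nat.zero_le _) (mem_alpha.2 ⟨0, Nat.zero_le _, h0⟩)
    | succ k ih =>
      intro hk
      have e := ih (by omega)
      have h1 : leTime S' k + 1 ≤ t := (Nat.succ_le_of_lt (hsp.2.2.2 k (by omega))).trans (le_sig hω' hD hk)
      have h2 : S' (leTime S' k + 1) ∈ D := hD ((hω'.sp D).cstep hD (hsp.2.2.1 k (by omega)).1 (hsp.2.1 k (by omega)))
      have h3 := ((hω'.sp D).step h2).2.1
      change lastVisit S (leTime S k + 1) = lastVisit S' (leTime S' k + 1)
      rw [e]
      exact lv _ h1 (mem_alpha.2 ⟨k + 1, hk, h3⟩)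
  have hL : ∀ k ≤ kk D n ω', lerw D ω k = lerw D ω' k := by
    intro k hk
    change S (leTime S k) = S' (leTime S' k)
    rw [hle k hk]; exact hagS _ (le_sig hω' hD hk)
  have hkk : kk D n ω = kk D n ω' := hitIdx_uniq (by rw [hL _ le_rfl]; exact hsp.1)
    fun j hj => by rw [hL j hj.le]; exact hsp.2.1 j hj
  constructor
  · unfold alphaList
    change (List.range (kk D n ω + 1)).map _ = (List.range (kk D n ω' + 1)).map _
    rw [hkk]
    refine List.map_congr_left fun k hk => hL k ?_
    have := List.mem_range.1 hk; omega
  · unfold sig; rw [hkk]; exact hle _ le_rfl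

lemma beta_spec (hω : nice ω) (hD : cube 0 n ⊆ D) {m : ℕ} (hm : 1 ≤ m)
    (hD2 : cube (endPt (alphaList D n ω)) m ⊆ D) :
    I1 D (sh (sig D n ω) ω) {v | v ∈ betaList D n m ω} ∧
    I2 D (endPt (alphaList D n ω)) m (sh (sig D n ω) ω) {v | v ∈ betaList D n m ω} := by
  have hSP := hω.sp D
  obtain ⟨a1, a2, a3, a4⟩ := alpha_sig hω hD
  set x0 := endPt (alphaList D n ω) with hx0
  set t := sig D n ω with ht
  set S := stopAt D ω with hS
  set k1 := kk D n ω with hk1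
  have ek1 : leTime S k1 = t := rfl
  have eγ : lerw D ω k1 = x0 := end_alpha.symm
  have h0 : S (leTime S k1) ∈ cube x0 m := by rw [ek1, a1]; exact self_mem_cube _ _
  obtain ⟨b1, b2, b3⟩ := hitIdxFrom_eq (γ := lerw D ω) (hSP.hit hD2 h0)
  set k2 := hitIdxFrom (innerBdry (cube x0 m)) k1 (lerw D ω) with hk2
  have memb : ∀ v, v ∈ betaList D n m ω ↔ ∃ k, k1 ≤ k ∧ k ≤ k2 ∧ lerw D ω k = v := by
    intro v
    have e : betaList D n m ω = (List.range (k2 - k1 + 1)).map fun i => lerw D ω (k1 + i) := by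
      rw [hk2, ← eγ]; rfl
    rw [e]
    simp only [List.mem_map, List.mem_range]
    constructor
    · rintro ⟨i, hi, rfl⟩; exact ⟨k1 + i, by omega, by omega, rfl⟩
    · rintro ⟨k, h1, h2, rfl⟩; exact ⟨k - k1, by omega, by rw [Nat.add_sub_cancel' h1]⟩
  constructor
  · intro v hv
    obtain ⟨k, c1, c2, rfl⟩ := (memb v).1 hv
    obtain ⟨q, rfl⟩ := Nat.exists_eq_add_of_le c1
    obtain ⟨e1, e2⟩ := hSP.seg hD2 h0 q fun j h1 h2 => b3 j h1 (by omega)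
    have hin : S (leTime S (k1 + q)) ∈ D := hD2 e1
    refine ⟨leTime S (k1 + q) - t, ?_, fun i hi => ?_⟩
    · rw [sh_apply, Nat.add_sub_cancel' (by omega)]; exact (st3 hin).symm
    · rw [sh_apply]; exact st2 hin _ (by omega)
  · intro s u hsu hdis hcub
    have hWS : ∀ i < u, S (t + i) = sh t ω i := by
      intro i hi
      refine st1 fun j hj => ?_
      by_cases hjt : j ≤ t
      · exact a3 j hjt
      · have := hcub (j - t) (by omega)
        rw [sh_apply, Nat.add_sub_cancel' (by omega)] at this
        exact hD2 (cube_mono (by omega) this)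
    have hstep : ∀ k, t ≤ leTime S k → leTime S k < t + s → leTime S k < leTime S (k + 1) ∧ leTime S (k + 1) < t + u ∧
        ∀ j > leTime S (k + 1), S j ≠ S (leTime S (k + 1)) := by
      intro k c1 c2
      have e1 := hWS (leTime S k + 1 - t) (by omega)
      rw [Nat.add_sub_cancel' (by omega)] at e1
      have e2 : S (leTime S k + 1) ∈ D := by
        rw [e1]; exact hD2 (cube_mono (by omega) (hcub _ (by omega)))
      obtain ⟨f1, f2, f3⟩ := hSP.step e2
      refine ⟨f1, ?_, f3⟩
      by_contra hc
      push Not at hc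
      have hin : S (leTime S (k + 1)) ∈ D := by rw [f2]; exact e2
      refine hdis (leTime S k + 1 - t) (by omega) (leTime S (k + 1) - t) (by omega) (fun i hi => ?_) ?_
      · rw [sh_apply]; exact st2 hin _ (by omega)
      · rw [← e1, ← f2, sh_apply, Nat.add_sub_cancel' (by omega)]; exact (st3 hin).symm
    have hinc : ∀ q, (∀ p < q, leTime S (k1 + p) < t + s) → t + q ≤ leTime S (k1 + q) ∧ leTime S (k1 + q) < t + u ∧
        ∀ j > leTime S (k1 + q), S j ≠ S (leTime S (k1 + q)) := by
      intro q
      induction q with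
      | zero =>
        intro _
        refine ⟨le_of_eq ek1.symm, ?_, ((alpha_spec hω hD).2.2.1 k1 le_rfl).2⟩
        change leTime S k1 < t + u
        omega
      | succ q ih =>
        intro hp
        obtain ⟨i1, i2, -⟩ := ih fun p hp' => hp p (by omega)
        obtain ⟨f1, f2, f3⟩ := hstep (k1 + q) (by omega) (hp q (by omega))
        change t + (q + 1) ≤ leTime S (k1 + q + 1) ∧ _
        exact ⟨by omega, f2, f3⟩
    have hex : ∃ q, t + s ≤ leTime S (k1 + q) := by
      by_contra hc
      push Not at hc
      have := (hinc s fun p _ => hc p).1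
      have := hc s
      omega
    set q := Nat.find hex with hq
    have hq1 : t + s ≤ leTime S (k1 + q) := Nat.find_spec hex
    have hq2 : ∀ p < q, leTime S (k1 + p) < t + s := fun p hp => not_le.1 (Nat.find_min hex hp)
    obtain ⟨g1, g2, g3⟩ := hinc q hq2
    have hval : ∀ p ≤ q, S (leTime S (k1 + p)) ∈ cube x0 (m - 1) := by
      intro p hp
      obtain ⟨i1, i2, -⟩ := hinc p fun p' hp' => hq2 p' (by omega)
      have := hWS (leTime S (k1 + p) - t) (by omega)
      rw [Nat.add_sub_cancel' (by omega)] at this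
      rw [this]; exact hcub _ (by omega)
    have hk2q : k1 + q ≤ k2 := by
      by_contra hc
      push Not at hc
      obtain ⟨p, hp⟩ := Nat.exists_eq_add_of_le b1
      have := hval p (by omega)
      rw [← hp] at this
      exact not_inner hm this b2
    have eW := hWS (leTime S (k1 + q) - t) (by omega)
    refine ⟨leTime S (k1 + q) - t, by omega, by omega, ?_, ?_⟩
    · rw [← eW, Nat.add_sub_cancel' (by omega)]
      exact (memb _).2 ⟨k1 + q, by omega, hk2q, rfl⟩
    · intro r' hr' hpre
      rw [← eW, Nat.add_sub_cancel' (by omega)]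
      have : S (t + r') = sh t ω r' := st1 fun j hj => by
        by_cases hjt : j ≤ t
        · exact a3 j hjt
        · have := hpre (j - t) (by omega)
          rwa [sh_apply, Nat.add_sub_cancel' (by omega)] at this
      rw [← this]
      exact g3 _ (by omega)

end

/-- the prefix event -/
def preA (D : Set (V d)) (n : ℕ) (a : List (V d)) (t : ℕ) : Set (ℕ → V d) :=
  {ω | ∃ ω', nice ω' ∧ (∀ i ≤ t, ω i = ω' i) ∧ alphaList D n ω' = a ∧ sig D n ω' = t}

lemma preA_dep (D : Set (V d)) (n : ℕ) (a : List (V d)) (t : ℕ) : Dep t (· ∈ preA D n a t) := by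
  have key : ∀ ω ω' : ℕ → V d, (∀ i ≤ t, ω i = ω' i) → ω ∈ preA D n a t → ω' ∈ preA D n a t := by
    rintro ω ω' h ⟨w, h1, h2, h3⟩
    exact ⟨w, h1, fun i hi => (h i hi).symm.trans (h2 i hi), h3⟩
  exact fun ω ω' h => propext ⟨key ω ω' h, key ω' ω fun i hi => (h i hi).symm⟩

lemma geo_of {D : Set (V d)} {N n m : ℕ} (hD : cube 0 (4 * N) ⊆ D) (hn : 16 ≤ n) (hN : n + m ≤ N) (hm : m ≤ n / 8)
    {a : List (V d)} (h1 : ∀ v ∈ a, v ∈ cube (0 : V d) n) (h2 : endPt a ∈ a) (h3 : endPt a ∈ innerBdry (cube (0 : V d) n)) :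
    ∃ i0 sg, Geo D {v | v ∈ a} N n m (endPt a) i0 sg (x1pt (endPt a) n m) := by
  have h : ∃ i : Fin d, |endPt a i| = (n : ℤ) := by
    obtain ⟨i, hi⟩ := inner_coord h3
    exact ⟨i, by simpa using hi⟩
  have hs := Classical.choose_spec h
  refine ⟨Classical.choose h, if 0 ≤ endPt a (Classical.choose h) then 1 else -1, ⟨?_, ?_, h2, h1, hD, by omega, by omega⟩, ?_, ?_, by omega⟩
  · split_ifs <;> simp
  · split_ifs with h0
    · rw [abs_of_nonneg h0] at hs; omega
    · rw [abs_of_neg (not_le.1 h0)] at hs; omega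
  · intro i hi
    simp only [x1pt, faceDir, dif_pos h, Pi.add_apply, Pi.smul_apply, if_neg hi, smul_zero, add_zero]
  · simp only [x1pt, faceDir, dif_pos h, Pi.add_apply, Pi.smul_apply, lev, smul_eq_mul]
    split_ifs with h0
    · rw [abs_of_nonneg h0] at hs; omega
    · rw [abs_of_neg (not_le.1 h0)] at hs; omega

lemma final (hd : 5 ≤ d) {c C1 : ℝ} (hc : 0 < c) {N n m : ℕ} (hcore : Core d c C1 m) {D : Set (V d)} (hD : cube 0 (4 * N) ⊆ D)
    (hn : 16 ≤ n) (hm1 : 1 ≤ m) (hN : n + m ≤ N) (hm : m ≤ n / 8) {P : V d → Measure (ℕ → V d)} (hP : SRW P)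
    {μ : Measure (ℕ → V d)} (hμ : IsSRWLaw μ 0) {a : List (V d)} (ha : μ {ω | alphaList D n ω = a} ≠ 0) :
    c ≤ (ProbabilityTheory.cond μ { ω | alphaList D n ω = a }
              { ω | c * (m : ℝ) ^ 2 ≤
                      capacity P (boxA (endPt a) n m ∩ { v | v ∈ betaList D n m ω }) ∧
                    capacity P (boxA (endPt a) n m ∩ { v | v ∈ betaList D n m ω })
                      ≤ C1 * (m : ℝ) ^ 2 }).toReal := by
  have hd0 : 0 < d := by omega
  have hpr : IsProbabilityMeasure μ := hμ.1
  have hDn : cube (0 : V d) n ⊆ D := (cube_mono (by omega)).trans hD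
  have hnice : ∀ᵐ ω ∂μ, nice ω := by
    have h1 := transient hd hP (0 : V d)
    rw [law_unique hd0 (hP 0) hμ] at h1
    filter_upwards [ae_nn hd0 hμ, h1] with ω a1 a2
    exact ⟨a1.1, a1.2, a2⟩
  set s := {ω : ℕ → V d | alphaList D n ω = a} with hs
  set T := { ω : ℕ → V d | c * (m : ℝ) ^ 2 ≤
                      capacity P (boxA (endPt a) n m ∩ { v | v ∈ betaList D n m ω }) ∧
                    capacity P (boxA (endPt a) n m ∩ { v | v ∈ betaList D n m ω })
                      ≤ C1 * (m : ℝ) ^ 2 } with hT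
  obtain ⟨w, hw, hwa⟩ : ∃ w, nice w ∧ alphaList D n w = a := by
    by_contra hcon
    push Not at hcon
    exact ha (measure_eq_zero_iff_ae_notMem.2 (hnice.mono fun ω h => hcon ω h))
  have hgeo := alpha_geo hw hDn
  rw [hwa] at hgeo
  obtain ⟨i0, sg, G⟩ := geo_of (m := m) hD hn hN hm hgeo.1 hgeo.2.1 hgeo.2.2
  obtain ⟨E, E1, E2, E3, E4⟩ := hcore P D {v | v ∈ a} N n (endPt a) i0 sg _ hP G
  set x0 := endPt a with hx0
  set av := avP D {v | v ∈ a} with hav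
  have hprx : IsProbabilityMeasure (P x0) := (hP x0).1
  have hAt : ∀ t, ∀ ω ∈ preA D n a t, ω t = x0 := by
    rintro t ω ⟨w', h1, h2, h3, h4⟩
    have := (alpha_sig h1 hDn).2.1
    rw [h3, h4] at this
    rw [h2 t le_rfl, this]
  have tr : ∀ t, ∀ ω ∈ preA D n a t, sh t ω ∈ av → alphaList D n ω = a ∧ sig D n ω = t := by
    rintro t ω ⟨w', h1, h2, h3, h4⟩ h5
    subst h4
    have := transfer h1 hDn h2 (by rw [h3]; exact h5)
    rw [h3] at this; exact this
  set Sm := ∑' t, μ (preA D n a t) with hSm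
  have up : μ s ≤ P x0 av * Sm := by
    have h1 : μ s ≤ μ (⋃ t, {ω | ω ∈ preA D n a t ∧ sh t ω ∈ av}) := by
      refine measure_mono_ae (hnice.mono fun ω h hω => ?_)
      refine Set.mem_iUnion.2 ⟨sig D n ω, ⟨ω, h, fun _ _ => rfl, hω, rfl⟩, ?_⟩
      have := avoid_of h hDn
      rwa [show alphaList D n ω = a from hω] at this
    refine h1.trans ((measure_iUnion_le _).trans ?_)
    rw [hSm, ← ENNReal.tsum_mul_left]
    refine ENNReal.tsum_le_tsum fun t => ?_
    exact mk_le hd0 hP hμ (preA_dep D n a t) (R := fun _ => av) (fun _ _ _ => rfl) (fun _ => avP_meas _ _)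
      fun ω hω => by rw [hAt t ω hω]
  have lo : P x0 E * Sm ≤ μ (T ∩ s) := by
    have h1 : μ (⋃ t, {ω | ω ∈ preA D n a t ∧ sh t ω ∈ E}) ≤ μ (T ∩ s) := by
      refine measure_mono_ae (hnice.mono fun ω h hω => ?_)
      obtain ⟨t, h2, h3⟩ := Set.mem_iUnion.1 hω
      obtain ⟨h4, h5⟩ := tr t ω h2 (E2 h3)
      have hb1 := beta_spec h hDn hm1 (by rw [h4]; exact G.inD (by omega))
      rw [h4, h5] at hb1
      exact ⟨E4 (sh t ω) h3 (hAt t ω h2) (fun i => h.2.1 (t + i)) _ hb1.1 hb1.2, h4⟩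
    refine le_trans ?_ h1
    rw [measure_iUnion, hSm, ← ENNReal.tsum_mul_left]
    · refine ENNReal.tsum_le_tsum fun t => ?_
      exact mk_ge hd0 hP hμ (preA_dep D n a t) (R := fun _ => E) (fun _ _ _ => rfl) (fun _ => E1)
        fun ω hω => by rw [hAt t ω hω]
    · intro t t' htt
      refine Set.disjoint_left.2 fun ω h2 h3 => htt ?_
      rw [← (tr t ω h2.1 (E2 h2.2)).2, (tr t' ω h3.1 (E2 h3.2)).2]
    · exact fun t => (preA_dep D n a t).meas.inter (meas_sh t E1)
  have E3' : ENNReal.ofReal c * P x0 av ≤ P x0 E := by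
    rw [Measure.real, Measure.real] at E3
    rw [← ENNReal.ofReal_toReal (measure_ne_top (P x0) av), ← ENNReal.ofReal_mul hc.le,
      ← ENNReal.ofReal_toReal (measure_ne_top (P x0) E)]
    exact ENNReal.ofReal_le_ofReal E3
  have fin : ENNReal.ofReal c * μ s ≤ μ (T ∩ s) :=
    calc ENNReal.ofReal c * μ s ≤ ENNReal.ofReal c * (P x0 av * Sm) := by gcongr
      _ = (ENNReal.ofReal c * P x0 av) * Sm := by ring
      _ ≤ P x0 E * Sm := by gcongr
      _ ≤ _ := lo
  have hst : μ s ≠ ⊤ := measure_ne_top μ s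
  have hcond : ENNReal.ofReal c ≤ ProbabilityTheory.cond μ s T := by
    rw [ProbabilityTheory.cond, Measure.smul_apply, smul_eq_mul]
    calc ENNReal.ofReal c = (μ s)⁻¹ * (ENNReal.ofReal c * μ s) := by
          rw [mul_comm (ENNReal.ofReal c), ← mul_assoc, ENNReal.inv_mul_cancel ha hst, one_mul]
      _ ≤ (μ s)⁻¹ * μ (T ∩ s) := by gcongr
      _ ≤ _ := mul_le_mul_right (Measure.le_restrict_apply s T) _
  have : IsFiniteMeasure (ProbabilityTheory.cond μ s) := by infer_instance
  exact (ENNReal.ofReal_le_iff_le_toReal (measure_ne_top _ _)).1 hcond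

/-- Proposition 5.1(b).  Let `d ≥ 5`, and adopt the shell setup.  There are constants
`c > 0` and `C₁`, depending only on `d`, with
`P( c m² ≤ Cap(A ∩ β) ≤ C₁ m² | α ) ≥ c`. -/
theorem capacity_of_beta :
    ∀ d : ℕ, 5 ≤ d → ∃ c C₁ : ℝ, 0 < c ∧ 0 < C₁ ∧
      ∀ (N n m : ℕ) (D : Set (V d)),
        1 ≤ N → cube 0 (4 * N) ⊆ D → 16 ≤ n → n < n + m → n + m ≤ N → m ≤ n / 8 →
      ∀ P : V d → Measure (ℕ → V d), (∀ x, IsSRWLaw (P x) x) →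
      ∀ μ : Measure (ℕ → V d), IsSRWLaw μ 0 →
      ∀ a : List (V d), μ { ω | alphaList D n ω = a } ≠ 0 →
        c ≤ (ProbabilityTheory.cond μ { ω | alphaList D n ω = a }
              { ω | c * (m : ℝ) ^ 2 ≤
                      capacity P (boxA (endPt a) n m ∩ { v | v ∈ betaList D n m ω }) ∧
                    capacity P (boxA (endPt a) n m ∩ { v | v ∈ betaList D n m ω })
                      ≤ C₁ * (m : ℝ) ^ 2 }).toReal := by
  intro d hd
  obtain ⟨c, C1, hc, hC1, H⟩ := core hd
  exact ⟨c, C1, hc, hC1, fun N n m D _ hD hn hm1 hN hm P hP μ hμ a ha =>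
    final hd hc (H m (by omega)) hD hn (by omega) hN hm hP hμ ha⟩


end USFPaper
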